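/- arXiv:2507.22230 — 2 statements merged into one kernel-verified Lean document; each statement's English description precedes it below -/
import Mathlib

section
/- Let T be the complete universal real tree with valence 2^ℵ₀. Then there exist 2^(2^ℵ₀) pairwise non-isomorphic groups each of which admits a free transitive action by isometries on T; that is, there is a family of groups indexed by a set of cardinality 2^(2^ℵ₀), pairwise non-isomorphic, each acting freely and transitively by isometries on T. -/
open Cardinal

noncomputable section

/-- A metric space is *geodesic* if every pair of points is joined by a geodesic. -/
def GeodesicSpace (T : Type) [MetricSpace T] : Prop :=
  ∀ x y : T, ∃ γ : ℝ → T, γ 0 = x ∧ γ (dist x y) = y ∧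
    ∀ s ∈ Set.Icc (0:ℝ) (dist x y), ∀ t ∈ Set.Icc (0:ℝ) (dist x y),
      dist (γ s) (γ t) = |s - t|

/-- 0-hyperbolicity: for all basepoints `p`, the Gromov products satisfy
`(x,y)_p ≥ min ((x,z)_p, (z,y)_p)`. -/
def ZeroHyp (T : Type) [MetricSpace T] : Prop :=
  ∀ p x y z : T,
    min ((dist x p + dist z p - dist x z) / 2) ((dist z p + dist y p - dist z y) / 2) ≤
      (dist x p + dist y p - dist x y) / 2

/-- An ℝ-tree: a geodesic metric space which is 0-hyperbolic. -/
def IsRTree (T : Type) [MetricSpace T] : Prop := GeodesicSpace T ∧ ZeroHyp T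

/-- The valence of a point `x`: the cardinality of the set of connected components of
`T \ {x}`. -/
def valence (T : Type) [MetricSpace T] (x : T) : Cardinal :=
  #(ConnectedComponents {y : T // y ≠ x})

/-- An action of a group `G` by isometries, given as a map `φ : G → T → T`. -/
def IsometricAction {G T : Type} [Group G] [MetricSpace T] (φ : G → T → T) : Prop :=
  (∀ g : G, Isometry (φ g)) ∧ (∀ x : T, φ 1 x = x) ∧
  (∀ g h : G, ∀ x : T, φ (g * h) x = φ g (φ h x))

/-- The action is free. -/
def FreeAction {G T : Type} [Group G] (φ : G → T → T) : Prop :=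
  ∀ g : G, ∀ x : T, φ g x = x → g = 1

/-- The action is transitive. -/
def TransAction {G T : Type} (φ : G → T → T) : Prop :=
  ∀ x y : T, ∃ g : G, φ g x = y

/-- A line in a metric space: the image of an isometric embedding of ℝ. -/
def IsLine {T : Type} [MetricSpace T] (L : Set T) : Prop :=
  ∃ γ : ℝ → T, Isometry γ ∧ Set.range γ = L

/-- The (setwise) stabiliser of a subset `L` under the action `φ`. -/
def setStab {G T : Type} (φ : G → T → T) (L : Set T) : Set G :=
  {g | φ g '' L = L}

namespace RTree

variable {T T' : Type} [MetricSpace T] [MetricSpace T']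

theorem four_point (hT : IsRTree T) (x y z w : T) :
    dist x y + dist z w ≤ dist x z + dist y w ∨ dist x y + dist z w ≤ dist x w + dist y z := by
  have h := hT.2 w x y z
  rw [dist_comm z y] at h
  rcases min_le_iff.1 h with h | h
  · left; linarith
  · right; linarith

theorem dist_of_between (hT : IsRTree T) {b y z a : T}
    (hz : dist b z + dist z y = dist b y) (ha : dist b a + dist a y = dist b y) :
    dist z a = |dist b z - dist b a| := by
  have h1 := dist_triangle b z a
  have h2 := dist_triangle b a z
  rw [dist_comm a z] at h2
  rcases four_point hT b y z a with h | h
  · rw [dist_comm y a] at h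
    rw [abs_of_nonneg] <;> linarith [dist_nonneg (x := z) (y := a)]
  · rw [dist_comm y z] at h
    rw [abs_of_nonpos] <;> linarith [dist_nonneg (x := z) (y := a)]

/-- The set of directions at a point. -/
abbrev Dir (x : T) : Type := ConnectedComponents {y : T // y ≠ x}

/-- The direction at `x` of a point `y ≠ x`. -/
def dir (x y : T) (h : y ≠ x) : Dir x := ConnectedComponents.mk ⟨y, h⟩

theorem exists_dir {x : T} (d : Dir x) : ∃ y, ∃ h : y ≠ x, dir x y h = d := by
  obtain ⟨⟨y, h⟩, rfl⟩ := ConnectedComponents.surjective_coe d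
  exact ⟨y, h, rfl⟩

theorem same_side_trans (hT : IsRTree T) {x y z w : T}
    (h1 : dist y z < dist y x + dist x z) (h2 : dist z w < dist z x + dist x w) :
    dist y w < dist y x + dist x w := by
  rw [dist_comm z x] at h2
  rcases four_point hT y w x z with h | h
  · rw [dist_comm w z] at h; linarith
  · rw [dist_comm w x] at h; linarith

theorem dir_eq_iff (hT : IsRTree T) {x y z : T} (hy : y ≠ x) (hz : z ≠ x) :
    dir x y hy = dir x z hz ↔ dist y z < dist y x + dist x z := by
  constructor
  · intro h
    let S : Set {y : T // y ≠ x} := {w | dist y w < dist y x + dist x w}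
    have hSo : IsOpen S := by
      apply isOpen_lt <;> fun_prop
    have hSc : IsOpen Sᶜ := by
      rw [Metric.isOpen_iff]
      intro w hw
      refine ⟨dist x w, dist_pos.2 (Ne.symm w.2), fun v hv hvS => hw ?_⟩
      refine same_side_trans hT hvS ?_
      have : dist (v : T) w < dist x w := hv
      have h3 := dist_pos.2 v.2
      change dist (v : T) w < dist (v : T) x + dist x w
      linarith
    have hclopen : IsClopen S := ⟨⟨hSc⟩, hSo⟩
    have hyS : (⟨y, hy⟩ : {y : T // y ≠ x}) ∈ S := by
      have h1 := dist_pos.2 hy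
      have h2 := dist_pos.2 hy.symm
      change dist y y < dist y x + dist x y
      rw [dist_self]; linarith
    have hmem := hclopen.connectedComponent_subset hyS
    have h' : connectedComponent (⟨z, hz⟩ : {y : T // y ≠ x}) = connectedComponent ⟨y, hy⟩ :=
      ConnectedComponents.coe_eq_coe.1 h.symm
    exact hmem (h' ▸ mem_connectedComponent)
  · intro h
    obtain ⟨γ, h0, h1, hγ⟩ := hT.1 y z
    have hne : ∀ s ∈ Set.Icc (0 : ℝ) (dist y z), γ s ≠ x := by
      intro s hs hsx
      have e1 := hγ 0 ⟨le_rfl, dist_nonneg⟩ s hs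
      have e2 := hγ s hs (dist y z) ⟨dist_nonneg, le_rfl⟩
      rw [h0, hsx, zero_sub, abs_neg, abs_of_nonneg hs.1] at e1
      rw [h1, hsx, abs_of_nonpos (by linarith [hs.2])] at e2
      linarith
    let δ : Set.Icc (0 : ℝ) (dist y z) → {y : T // y ≠ x} := fun s => ⟨γ s, hne s s.2⟩
    have hδ : Continuous δ := by
      have : Isometry δ := Isometry.of_dist_eq fun s t => hγ s s.2 t t.2
      exact this.continuous
    have hpre : IsPreconnected (Set.range δ) := by
      have : PreconnectedSpace (Set.Icc (0 : ℝ) (dist y z)) :=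
        Subtype.preconnectedSpace isPreconnected_Icc
      exact isPreconnected_range hδ
    refine ConnectedComponents.coe_eq_coe'.2 ?_
    have hz' : (⟨z, hz⟩ : {y : T // y ≠ x}) ∈ Set.range δ :=
      ⟨⟨dist y z, dist_nonneg, le_rfl⟩, Subtype.ext h1⟩
    have hy' : (⟨y, hy⟩ : {y : T // y ≠ x}) ∈ Set.range δ :=
      ⟨⟨0, le_rfl, dist_nonneg⟩, Subtype.ext h0⟩
    exact hpre.subset_connectedComponent hz' hy'

theorem dir_ne_iff (hT : IsRTree T) {x y z : T} (hy : y ≠ x) (hz : z ≠ x) :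
    dir x y hy ≠ dir x z hz ↔ dist y z = dist y x + dist x z := by
  rw [Ne, dir_eq_iff hT, not_lt]
  exact ⟨fun h => le_antisymm (dist_triangle _ _ _) h, fun h => h.ge⟩

end RTree

namespace RTree

variable {T T' : Type} [MetricSpace T] [MetricSpace T']

/-- A pair of corresponding points together with a matching of the directions at these points. -/
structure Match (T T' : Type) [MetricSpace T] [MetricSpace T'] where
  src : T
  tgt : T'
  equiv : Dir src ≃ Dir tgt

/-- Compatibility of two matches. -/
structure Compat (p q : Match T T') : Prop where
  dist_eq : dist p.src q.src = dist p.tgt q.tgt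
  dir_eq : ∀ (h : q.src ≠ p.src) (h' : q.tgt ≠ p.tgt),
    p.equiv (dir p.src q.src h) = dir p.tgt q.tgt h'
  eq_of : p.src = q.src → p = q

/-- A partial isometry with convex domain, with compatible matchings of directions. -/
structure IsPartial (R : Set (Match T T')) : Prop where
  compat : ∀ p ∈ R, ∀ q ∈ R, Compat p q
  convex : ∀ p ∈ R, ∀ q ∈ R, ∀ x, dist p.src x + dist x q.src = dist p.src q.src →
    ∃ r ∈ R, r.src = x

theorem compat_refl (p : Match T T') : Compat p p :=
  ⟨by simp, fun h => (h rfl).elim, fun _ => rfl⟩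

theorem isPartial_singleton (p : Match T T') : IsPartial {p} := by
  constructor
  · rintro _ rfl _ rfl; exact compat_refl _
  · intro q hq r hr x hx
    rw [hq, hr, dist_self, dist_comm x] at hx
    exact ⟨p, rfl, dist_eq_zero.1 (by linarith [dist_nonneg (x := p.src) (y := x)])⟩

theorem isPartial_sUnion {c : Set (Set (Match T T'))} (hc : ∀ R ∈ c, IsPartial R)
    (hchain : IsChain (· ⊆ ·) c) : IsPartial (⋃₀ c) := by
  have key : ∀ p ∈ ⋃₀ c, ∀ q ∈ ⋃₀ c, ∃ R ∈ c, p ∈ R ∧ q ∈ R := by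
    rintro p ⟨R, hR, hp⟩ q ⟨S, hS, hq⟩
    rcases hchain.total hR hS with h | h
    · exact ⟨S, hS, h hp, hq⟩
    · exact ⟨R, hR, hp, h hq⟩
  constructor
  · intro p hp q hq
    obtain ⟨R, hR, hp, hq⟩ := key p hp q hq
    exact (hc R hR).compat p hp q hq
  · intro p hp q hq x hx
    obtain ⟨R, hR, hp, hq⟩ := key p hp q hq
    obtain ⟨r, hr, h⟩ := (hc R hR).convex p hp q hq x hx
    exact ⟨r, ⟨R, hR, hr⟩, h⟩

theorem exists_equiv_one {α β : Type} (e : α ≃ β) (a : α) (b : β) : ∃ f : α ≃ β, f a = b := by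
  classical
  exact ⟨e.trans (Equiv.swap (e a) b), by simp⟩

theorem exists_equiv_two {α β : Type} (e : α ≃ β) {a a' : α} {b b' : β} (ha : a ≠ a')
    (hb : b ≠ b') : ∃ f : α ≃ β, f a = b ∧ f a' = b' := by
  classical
  obtain ⟨f, hf⟩ := exists_equiv_one e a b
  refine ⟨f.trans (Equiv.swap (f a') b'), ?_, by simp⟩
  rw [Equiv.trans_apply, hf, Equiv.swap_apply_of_ne_of_ne _ hb]
  rw [← hf]
  exact fun h => ha (f.injective h)

theorem IsPartial.union {R N : Set (Match T T')} (hR : IsPartial R)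
    (hN : ∀ p ∈ N, ∀ q ∈ N, Compat p q) (hRN : ∀ p ∈ R, ∀ q ∈ N, Compat p q ∧ Compat q p)
    (hcRN : ∀ p ∈ R, ∀ q ∈ N, ∀ x, dist p.src x + dist x q.src = dist p.src q.src →
      ∃ r ∈ R ∪ N, r.src = x)
    (hcN : ∀ p ∈ N, ∀ q ∈ N, ∀ x, dist p.src x + dist x q.src = dist p.src q.src →
      ∃ r ∈ R ∪ N, r.src = x) : IsPartial (R ∪ N) := by
  constructor
  · rintro p (hp | hp) q (hq | hq)
    · exact hR.compat p hp q hq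
    · exact (hRN p hp q hq).1
    · exact (hRN q hq p hp).2
    · exact hN p hp q hq
  · rintro p (hp | hp) q (hq | hq) x hx
    · obtain ⟨r, hr, h⟩ := hR.convex p hp q hq x hx
      exact ⟨r, Or.inl hr, h⟩
    · exact hcRN p hp q hq x hx
    · refine hcRN q hq p hp x ?_
      rw [dist_comm q.src x, dist_comm x p.src, dist_comm q.src, add_comm]
      exact hx
    · exact hcN p hp q hq x hx

/-- A limit point of the domain of a partial isometry can be added to the domain. -/
theorem IsPartial.extend_limit [CompleteSpace T'] (hT : IsRTree T) (hT' : IsRTree T')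
    (hE : ∀ (x : T) (y : T'), Nonempty (Dir x ≃ Dir y))
    {R : Set (Match T T')} (hR : IsPartial R) {y : T} (hy : ∀ p ∈ R, p.src ≠ y)
    (hlim : ∀ ε > 0, ∃ p ∈ R, dist p.src y < ε) :
    ∃ m : Match T T', m.src = y ∧ IsPartial (R ∪ {m}) := by
  have hex : ∀ n : ℕ, ∃ p ∈ R, dist p.src y < 1 / ((n : ℝ) + 1) := fun n =>
    hlim _ (by positivity)
  choose p hpR hpd using hex
  have hsrc : Filter.Tendsto (fun n => (p n).src) Filter.atTop (nhds y) := by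
    rw [tendsto_iff_dist_tendsto_zero]
    exact squeeze_zero (fun _ => dist_nonneg) (fun n => (hpd n).le)
      tendsto_one_div_add_atTop_nhds_zero_nat
  have hcau : CauchySeq fun n => (p n).tgt := by
    have h := hsrc.cauchySeq
    rw [Metric.cauchySeq_iff] at h ⊢
    simpa only [← (hR.compat _ (hpR _) _ (hpR _)).dist_eq] using h
  obtain ⟨y', hy'⟩ := cauchySeq_tendsto_of_complete hcau
  have hd : ∀ q ∈ R, dist q.src y = dist q.tgt y' := by
    intro q hq
    refine tendsto_nhds_unique (tendsto_const_nhds.dist hsrc) ?_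
    simp only [(hR.compat _ hq _ (hpR _)).dist_eq]
    exact tendsto_const_nhds.dist hy'
  have hne : ∀ q ∈ R, q.tgt ≠ y' := by
    intro q hq h
    exact hy q hq (dist_eq_zero.1 (by rw [hd q hq, h, dist_self]))
  have hd' : ∀ q ∈ R, dist y q.src = dist y' q.tgt := by
    intro q hq; rw [dist_comm, hd q hq, dist_comm]
  have hlt : ∀ p ∈ R, ∀ q ∈ R, dist p.src q.src < dist p.src y + dist y q.src := by
    intro p hp q hq
    refine lt_of_le_of_ne (dist_triangle _ _ _) fun h => ?_
    obtain ⟨r, hr, h⟩ := hR.convex p hp q hq y h.symm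
    exact hy r hr h
  obtain ⟨o, hoR, -⟩ := hlim 1 one_pos
  obtain ⟨β, hβ⟩ := exists_equiv_one (hE y y').some (dir y o.src (hy o hoR))
    (dir y' o.tgt (hne o hoR))
  have hβ' : ∀ q, ∀ hq : q ∈ R, β (dir y q.src (hy q hq)) = dir y' q.tgt (hne q hq) := by
    intro q hq
    rw [(dir_eq_iff hT (hy q hq) (hy o hoR)).2 (hlt q hq o hoR), hβ, dir_eq_iff hT',
      ← (hR.compat _ hoR _ hq).dist_eq, ← hd _ hoR, ← hd' _ hq]
    exact hlt o hoR q hq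
  refine ⟨⟨y, y', β⟩, rfl, hR.union ?_ ?_ ?_ ?_⟩
  · rintro _ rfl _ rfl; exact compat_refl _
  · rintro q hq _ rfl
    refine ⟨⟨hd q hq, ?_, fun h => (hy q hq h).elim⟩,
      ⟨hd' q hq, fun _ _ => hβ' q hq, fun h => (hy q hq h.symm).elim⟩⟩
    intro h h'
    obtain ⟨r, hr, hry⟩ := hlim (dist q.src y) (dist_pos.2 (hy q hq))
    change q.equiv (dir q.src y h) = dir q.tgt y' h'
    have hrq : r.src ≠ q.src := by rintro e; rw [e] at hry; exact lt_irrefl _ hry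
    have hrq' : r.tgt ≠ q.tgt := by
      intro e
      apply hrq
      rw [← dist_eq_zero, (hR.compat _ hr _ hq).dist_eq, e, dist_self]
    have h1 : dist y r.src < dist y q.src + dist q.src r.src := by
      rw [dist_comm y, dist_comm y]
      linarith [dist_nonneg (x := q.src) (y := r.src)]
    rw [(dir_eq_iff hT h hrq).2 h1, (hR.compat _ hq _ hr).dir_eq hrq hrq', eq_comm,
      dir_eq_iff hT', ← hd' _ hr, ← hd' _ hq, ← (hR.compat _ hq _ hr).dist_eq]
    exact h1
  · rintro q hq _ rfl x hx
    by_cases hxy : x = y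
    · exact ⟨_, Or.inr rfl, hxy.symm⟩
    change dist q.src x + dist x y = dist q.src y at hx
    obtain ⟨r, hr, hry⟩ := hlim (dist x y) (dist_pos.2 hxy)
    obtain ⟨s, hs, hsx⟩ := hR.convex q hq r hr x (by
      refine le_antisymm ?_ (dist_triangle _ _ _)
      rcases four_point hT q.src y x r.src with h | h
      · linarith [dist_comm y r.src, dist_nonneg (x := x) (y := r.src)]
      · linarith [dist_comm y x])
    exact ⟨s, Or.inl hs, hsx⟩
  · rintro _ rfl _ rfl x hx
    refine ⟨_, Or.inr rfl, ?_⟩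
    rw [dist_self, dist_comm x] at hx
    exact dist_eq_zero.1 (by linarith [dist_nonneg (x := y) (y := x)])

end RTree

namespace RTree

variable {T T' : Type} [MetricSpace T] [MetricSpace T']

/-- A partial isometry can be extended along a segment leaving its domain. -/
theorem IsPartial.extend_segment (hT : IsRTree T) (hT' : IsRTree T')
    (hE : ∀ (x : T) (y : T'), Nonempty (Dir x ≃ Dir y))
    {R : Set (Match T T')} (hR : IsPartial R) {m : Match T T'} (hm : m ∈ R) {x : T}
    (hx : x ≠ m.src)
    (hleave : ∀ z, dist m.src z + dist z x = dist m.src x → z ≠ m.src → ∀ p ∈ R, p.src ≠ z) :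
    ∃ N : Set (Match T T'), N.Nonempty ∧ (∀ p ∈ N, p ∉ R) ∧ IsPartial (R ∪ N) := by
  obtain ⟨z, hz, hzd⟩ := exists_dir (m.equiv (dir m.src x hx))
  obtain ⟨γ, hγ0, hγ1, hγ⟩ := hT.1 m.src x
  obtain ⟨γ', hγ0', hγ1', hγ'⟩ := hT'.1 m.tgt z
  set a := m.src with ha
  set a' := m.tgt with ha'
  set r := min (dist a x) (dist a' z) with hr
  have hr0 : 0 < r := lt_min (dist_pos.2 hx.symm) (dist_pos.2 hz.symm)
  have hrx : r ≤ dist a x := min_le_left _ _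
  have hrz : r ≤ dist a' z := min_le_right _ _
  -- distances along the two segments
  have g0 : ∀ s, 0 < s → s < r → dist a (γ s) = s := by
    intro s h0 h1
    have := hγ 0 ⟨le_rfl, dist_nonneg⟩ s ⟨h0.le, by linarith⟩
    rwa [hγ0, zero_sub, abs_neg, abs_of_pos h0] at this
  have g1 : ∀ s, 0 < s → s < r → dist (γ s) x = dist a x - s := by
    intro s h0 h1
    have := hγ s ⟨h0.le, by linarith⟩ (dist a x) ⟨dist_nonneg, le_rfl⟩
    rwa [hγ1, abs_sub_comm, abs_of_nonneg (by linarith)] at this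
  have g2 : ∀ s t, 0 < s → s < r → 0 < t → t < r → dist (γ s) (γ t) = |s - t| :=
    fun s t h0 h1 h2 h3 => hγ s ⟨h0.le, by linarith⟩ t ⟨h2.le, by linarith⟩
  have g0' : ∀ s, 0 < s → s < r → dist a' (γ' s) = s := by
    intro s h0 h1
    have := hγ' 0 ⟨le_rfl, dist_nonneg⟩ s ⟨h0.le, by linarith⟩
    rwa [hγ0', zero_sub, abs_neg, abs_of_pos h0] at this
  have g1' : ∀ s, 0 < s → s < r → dist (γ' s) z = dist a' z - s := by
    intro s h0 h1
    have := hγ' s ⟨h0.le, by linarith⟩ (dist a' z) ⟨dist_nonneg, le_rfl⟩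
    rwa [hγ1', abs_sub_comm, abs_of_nonneg (by linarith)] at this
  have g2' : ∀ s t, 0 < s → s < r → 0 < t → t < r → dist (γ' s) (γ' t) = |s - t| :=
    fun s t h0 h1 h2 h3 => hγ' s ⟨h0.le, by linarith⟩ t ⟨h2.le, by linarith⟩
  -- points of the domain project to `a`
  have hsplit : ∀ p ∈ R, ∀ h : p.src ≠ a, dir a p.src h ≠ dir a x hx := by
    intro p hp h heq
    rw [dir_eq_iff hT] at heq
    set s := (dist p.src a + dist a x - dist p.src x) / 2 with hs
    have hs0 : 0 < s := by rw [hs]; linarith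
    have hsx : s ≤ dist a x := by
      have := dist_triangle p.src x a
      rw [dist_comm x a] at this
      rw [hs]; linarith
    have e0 : dist a (γ s) = s := by
      have := hγ 0 ⟨le_rfl, dist_nonneg⟩ s ⟨hs0.le, hsx⟩
      rwa [hγ0, zero_sub, abs_neg, abs_of_pos hs0] at this
    have e1 : dist (γ s) x = dist a x - s := by
      have := hγ s ⟨hs0.le, hsx⟩ (dist a x) ⟨dist_nonneg, le_rfl⟩
      rwa [hγ1, abs_sub_comm, abs_of_nonneg (by linarith)] at this
    obtain ⟨q, hq, hqs⟩ := hR.convex m hm p hp (γ s) (by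
      refine le_antisymm ?_ (dist_triangle _ _ _)
      change dist a (γ s) + dist (γ s) p.src ≤ dist a p.src
      have c1 := dist_comm p.src (γ s)
      have c2 := dist_comm p.src a
      have c3 := dist_comm p.src x
      rcases four_point hT a x p.src (γ s) with h | h
      · rw [dist_comm x (γ s)] at h; linarith
      · rw [dist_comm x p.src] at h; linarith)
    refine hleave (γ s) (by rw [e0, e1]; ring) ?_ q hq hqs
    intro e
    change γ s = a at e
    rw [e, dist_self] at e0
    linarith
  have hne' : ∀ p ∈ R, p.src ≠ a → p.tgt ≠ a' := by
    intro p hp h e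
    apply h
    rw [← dist_eq_zero, (hR.compat p hp m hm).dist_eq]
    change dist p.tgt a' = 0
    rw [e, dist_self]
  have hpx : ∀ p ∈ R, dist p.src x = dist p.src a + dist a x := by
    intro p hp
    by_cases h : p.src = a
    · rw [h, dist_self, zero_add]
    · exact (dir_ne_iff hT h hx).1 (hsplit p hp h)
  have hpz : ∀ p ∈ R, dist p.tgt z = dist p.tgt a' + dist a' z := by
    intro p hp
    by_cases h : p.src = a
    · have : p = m := (hR.compat p hp m hm).eq_of h
      rw [this, dist_self, zero_add]
    · refine (dir_ne_iff hT' (hne' p hp h) hz).1 ?_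
      rw [hzd, ← (hR.compat m hm p hp).dir_eq h (hne' p hp h)]
      exact fun e => hsplit p hp h (m.equiv.injective e)
  have hpg : ∀ p ∈ R, ∀ s, 0 < s → s < r → dist p.src (γ s) = dist p.src a + s := by
    intro p hp s h0 h1
    have t1 := dist_triangle p.src (γ s) x
    have t2 := dist_triangle p.src a (γ s)
    have := hpx p hp
    rw [g1 s h0 h1] at t1
    rw [g0 s h0 h1] at t2
    linarith
  have hpg' : ∀ p ∈ R, ∀ s, 0 < s → s < r → dist p.tgt (γ' s) = dist p.tgt a' + s := by
    intro p hp s h0 h1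
    have t1 := dist_triangle p.tgt (γ' s) z
    have t2 := dist_triangle p.tgt a' (γ' s)
    have := hpz p hp
    rw [g1' s h0 h1] at t1
    rw [g0' s h0 h1] at t2
    linarith
  have hga : ∀ s, 0 < s → s < r → a ≠ γ s := fun s h0 h1 e => by
    have := g0 s h0 h1; rw [← e, dist_self] at this; linarith
  have hga' : ∀ s, 0 < s → s < r → a' ≠ γ' s := fun s h0 h1 e => by
    have := g0' s h0 h1; rw [← e, dist_self] at this; linarith
  have hgx : ∀ s, 0 < s → s < r → x ≠ γ s := fun s h0 h1 e => by
    have := g1 s h0 h1; rw [← e, dist_self] at this; linarith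
  have hgz : ∀ s, 0 < s → s < r → z ≠ γ' s := fun s h0 h1 e => by
    have := g1' s h0 h1; rw [← e, dist_self] at this; linarith
  have hβ : ∀ s (h0 : 0 < s) (h1 : s < r), ∃ β : Dir (γ s) ≃ Dir (γ' s),
      β (dir _ a (hga s h0 h1)) = dir _ a' (hga' s h0 h1) ∧
      β (dir _ x (hgx s h0 h1)) = dir _ z (hgz s h0 h1) := by
    intro s h0 h1
    refine exists_equiv_two (hE _ _).some ?_ ?_
    · rw [dir_ne_iff hT, g0 s h0 h1, g1 s h0 h1]; ring
    · rw [dir_ne_iff hT', g0' s h0 h1, g1' s h0 h1]; ring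
  choose β hβa hβx using hβ
  let f : Set.Ioo 0 r → Match T T' := fun s => ⟨γ s, γ' s, β s s.2.1 s.2.2⟩
  refine ⟨Set.range f, ⟨_, ⟨r / 2, by constructor <;> linarith⟩, rfl⟩, ?_, hR.union ?_ ?_ ?_ ?_⟩
  · rintro _ ⟨⟨s, h0, h1⟩, rfl⟩ hp
    refine hleave (γ s) (by rw [g0 s h0 h1, g1 s h0 h1]; ring) (hga s h0 h1).symm _ hp rfl
  · rintro _ ⟨⟨s, h0, h1⟩, rfl⟩ _ ⟨⟨t, h2, h3⟩, rfl⟩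
    have es := g2 s t h0 h1 h2 h3
    have es' := g2' s t h0 h1 h2 h3
    refine ⟨es.trans es'.symm, ?_, ?_⟩
    · intro h h'
      change γ t ≠ γ s at h
      change γ' t ≠ γ' s at h'
      change β s h0 h1 (dir (γ s) (γ t) h) = dir (γ' s) (γ' t) h'
      rw [dist_comm] at es es'
      rcases lt_trichotomy s t with hst | rfl | hst
      · rw [abs_of_neg (by linarith)] at es es'
        have : dir (γ s) (γ t) h = dir (γ s) x (hgx s h0 h1) := by
          rw [dir_eq_iff hT, g1 s h0 h1, g1 t h2 h3, es]; linarith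
        rw [this, hβx, eq_comm, dir_eq_iff hT', g1' s h0 h1, g1' t h2 h3, es']; linarith
      · exact (h rfl).elim
      · rw [abs_of_pos (by linarith)] at es es'
        have : dir (γ s) (γ t) h = dir (γ s) a (hga s h0 h1) := by
          rw [dir_eq_iff hT, dist_comm, dist_comm _ a, g0 s h0 h1, g0 t h2 h3, es]; linarith
        rw [this, hβa, eq_comm, dir_eq_iff hT', dist_comm, dist_comm _ a', g0' s h0 h1,
          g0' t h2 h3, es']; linarith
    · intro h
      change γ s = γ t at h
      rw [h, dist_self, eq_comm, abs_eq_zero, sub_eq_zero] at es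
      subst es
      rfl
  · rintro p hp _ ⟨⟨s, h0, h1⟩, rfl⟩
    have es := hpg p hp s h0 h1
    have es' := hpg' p hp s h0 h1
    have ed : dist p.src a = dist p.tgt a' := (hR.compat p hp m hm).dist_eq
    have hps : p.src ≠ γ s := fun e => by
      rw [e, dist_self] at es; linarith [dist_nonneg (x := γ s) (y := a)]
    refine ⟨⟨?_, ?_, fun h => (hps h).elim⟩, ⟨?_, ?_, fun h => (hps h.symm).elim⟩⟩
    · change dist p.src (γ s) = dist p.tgt (γ' s)
      rw [es, es', ed]
    · intro h h'
      change γ s ≠ p.src at h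
      change γ' s ≠ p.tgt at h'
      change p.equiv (dir p.src (γ s) h) = dir p.tgt (γ' s) h'
      by_cases hpa : p.src = a
      · obtain rfl : p = m := (hR.compat p hp m hm).eq_of hpa
        have : dir p.src (γ s) h = dir p.src x hx := by
          rw [dir_eq_iff hT, dist_comm _ p.src]
          change dist (γ s) x < dist a (γ s) + dist a x
          rw [g0 s h0 h1, g1 s h0 h1]; linarith
        rw [this, ← hzd, eq_comm, dir_eq_iff hT', dist_comm _ p.tgt]
        change dist (γ' s) z < dist a' (γ' s) + dist a' z
        rw [g0' s h0 h1, g1' s h0 h1]; linarith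
      · have hpa' := hne' p hp hpa
        have hd0 := dist_pos.2 hpa
        have : dir p.src (γ s) h = dir p.src a (Ne.symm hpa) := by
          rw [dir_eq_iff hT, dist_comm, dist_comm _ p.src, es, g0 s h0 h1]
          linarith
        rw [this, (hR.compat p hp m hm).dir_eq (Ne.symm hpa) (Ne.symm hpa'), eq_comm,
          dir_eq_iff hT', dist_comm, dist_comm _ p.tgt, es']
        change dist a' (γ' s) < dist p.tgt a' + s + dist p.tgt a'
        rw [g0' s h0 h1]; linarith
    · change dist (γ s) p.src = dist (γ' s) p.tgt
      rw [dist_comm, es, dist_comm (γ' s), es', ed]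
    · intro h h'
      change β s h0 h1 (dir (γ s) p.src h) = dir (γ' s) p.tgt h'
      have : dir (γ s) p.src h = dir (γ s) a (hga s h0 h1) := by
        rw [dir_eq_iff hT, es]
        linarith [dist_comm a p.src, dist_nonneg (x := γ s) (y := a)]
      rw [this, hβa, eq_comm, dir_eq_iff hT', es']
      linarith [dist_comm a' p.tgt, dist_nonneg (x := γ' s) (y := a')]
  · rintro p hp _ ⟨⟨s, h0, h1⟩, rfl⟩ y hy
    change dist p.src y + dist y (γ s) = dist p.src (γ s) at hy
    have es := hpg p hp s h0 h1
    have hb : dist p.src a + dist a (γ s) = dist p.src (γ s) := by rw [es, g0 s h0 h1]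
    rcases le_or_gt (dist p.src y) (dist p.src a) with hya | hya
    · have h2 := dist_of_between hT hy hb
      rw [abs_of_nonpos (by linarith)] at h2
      obtain ⟨q, hq, e⟩ := hR.convex p hp m hm y (by
        change dist p.src y + dist y a = dist p.src a
        linarith)
      exact ⟨q, Or.inl hq, e⟩
    · set t := dist p.src y - dist p.src a with ht
      have ht0 : 0 < t := by rw [ht]; linarith
      have hts : t ≤ s := by rw [ht]; linarith [dist_nonneg (x := y) (y := γ s)]
      have ht1 : t < r := by linarith
      have et := hpg p hp t ht0 ht1
      have h3 : dist p.src (γ t) + dist (γ t) (γ s) = dist p.src (γ s) := by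
        rw [et, es, g2 t s ht0 ht1 h0 h1, abs_of_nonpos (by linarith)]; ring
      have h2 := dist_of_between hT hy h3
      rw [et, ht, show dist p.src y - (dist p.src a + (dist p.src y - dist p.src a)) = 0 by ring,
        abs_zero, dist_eq_zero] at h2
      exact ⟨_, Or.inr ⟨⟨t, ht0, ht1⟩, rfl⟩, h2.symm⟩
  · have main : ∀ s t, ∀ (h0 : 0 < s) (h1 : s ≤ t) (h2 : t < r), ∀ y,
        dist (γ s) y + dist y (γ t) = dist (γ s) (γ t) → ∃ q ∈ R ∪ Set.range f, q.src = y := by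
      intro s t h0 h1 h2 y hy
      set u := s + dist (γ s) y with hu
      have e := g2 s t h0 (by linarith) (by linarith) h2
      rw [abs_of_nonpos (by linarith)] at e
      have hu0 : 0 < u := by linarith [dist_nonneg (x := γ s) (y := y)]
      have hut : u ≤ t := by linarith [dist_nonneg (x := y) (y := γ t)]
      have e1 := g2 s u h0 (by linarith) hu0 (by linarith)
      rw [abs_of_nonpos (by linarith [dist_nonneg (x := γ s) (y := y)])] at e1
      have e2 := g2 u t hu0 (by linarith) (by linarith) h2
      rw [abs_of_nonpos (by linarith)] at e2
      have h3 : dist (γ s) (γ u) + dist (γ u) (γ t) = dist (γ s) (γ t) := by linarith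
      have h4 := dist_of_between hT hy h3
      rw [e1, hu, show dist (γ s) y - -(s - (s + dist (γ s) y)) = 0 by ring,
        abs_zero, dist_eq_zero] at h4
      exact ⟨_, Or.inr ⟨⟨u, hu0, by linarith⟩, rfl⟩, h4.symm⟩
    rintro _ ⟨⟨s, h0, h1⟩, rfl⟩ _ ⟨⟨t, h2, h3⟩, rfl⟩ y hy
    rcases le_total s t with hst | hst
    · exact main s t h0 hst h3 y hy
    · refine main t s h2 hst h1 y ?_
      rw [dist_comm (γ t) y, dist_comm y (γ s), dist_comm (γ t), add_comm]
      exact hy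

end RTree

namespace RTree

variable {T T' : Type} [MetricSpace T] [MetricSpace T']

/-- Along a segment leaving a set from a point of that set, there is a last point in the closure
of the set. -/
theorem exists_last {γ : ℝ → T} {l : ℝ} (hl : 0 ≤ l)
    (hγ : ∀ s ∈ Set.Icc (0 : ℝ) l, ∀ t ∈ Set.Icc (0 : ℝ) l, dist (γ s) (γ t) = |s - t|)
    {A : Set T} (h0 : γ 0 ∈ A) : ∃ t ∈ Set.Icc 0 l,
      (∀ ε > 0, ∃ s ∈ Set.Icc 0 t, γ s ∈ A ∧ dist (γ s) (γ t) < ε) ∧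
      ∀ s ∈ Set.Ioc t l, γ s ∉ A := by
  set S := {s | s ∈ Set.Icc 0 l ∧ γ s ∈ A} with hS
  have hne : S.Nonempty := ⟨0, ⟨le_rfl, hl⟩, h0⟩
  have hbd : BddAbove S := ⟨l, fun s hs => hs.1.2⟩
  have ht0 : 0 ≤ sSup S := le_csSup hbd ⟨⟨le_rfl, hl⟩, h0⟩
  have htl : sSup S ≤ l := csSup_le hne fun s hs => hs.1.2
  refine ⟨sSup S, ⟨ht0, htl⟩, ?_, ?_⟩
  · intro ε hε
    obtain ⟨s, hs, hlt⟩ := exists_lt_of_lt_csSup hne (sub_lt_self (sSup S) hε)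
    have hle := le_csSup hbd hs
    refine ⟨s, ⟨hs.1.1, hle⟩, hs.2, ?_⟩
    rw [hγ s hs.1 _ ⟨ht0, htl⟩, abs_of_nonpos (by linarith)]
    linarith
  · intro s hs hsA
    have := le_csSup hbd (show s ∈ S from ⟨⟨by linarith [hs.1], hs.2⟩, hsA⟩)
    linarith [hs.1]

/-- Two complete real trees all of whose points have the same valence are isometric. -/
theorem nonempty_isometryEquiv [CompleteSpace T] [CompleteSpace T'] (hT : IsRTree T)
    (hT' : IsRTree T') (hE : ∀ (x : T) (y : T'), Nonempty (Dir x ≃ Dir y))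
    (o : T) (o' : T') : Nonempty (T ≃ᵢ T') := by
  obtain ⟨R, hoR, hmax⟩ := zorn_subset_nonempty {R : Set (Match T T') | IsPartial R}
    (fun c hc hchain _ => ⟨⋃₀ c, isPartial_sUnion (fun R hR => hc hR) hchain,
      fun R hR => Set.subset_sUnion_of_mem hR⟩)
    {⟨o, o', (hE o o').some⟩} (isPartial_singleton _)
  have hR : IsPartial R := hmax.prop
  have hmaxN : ∀ N, IsPartial (R ∪ N) → N ⊆ R := fun N hN =>
    Set.subset_union_right.trans (hmax.le_of_ge hN Set.subset_union_left)
  have hdom : ∀ x, ∃ p ∈ R, p.src = x := by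
    intro x
    by_contra hx
    obtain ⟨γ, h0, h1, hγ⟩ := hT.1 o x
    obtain ⟨t, ht, hcl, hlast⟩ := exists_last dist_nonneg hγ
      (A := {y | ∃ p ∈ R, p.src = y}) (by rw [h0]; exact ⟨_, hoR rfl, rfl⟩)
    by_cases hA : ∃ p ∈ R, p.src = γ t
    · obtain ⟨m, hm, hmt⟩ := hA
      have hxm : x ≠ m.src := fun e => hx ⟨m, hm, e.symm⟩
      have hmx : dist m.src x = dist o x - t := by
        have := hγ t ht (dist o x) ⟨dist_nonneg, le_rfl⟩
        rwa [h1, ← hmt, abs_of_nonpos (by linarith [ht.2]), neg_sub] at this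
      obtain ⟨N, ⟨n, hn⟩, hNR, hN⟩ := hR.extend_segment hT hT' hE hm hxm (by
        intro z hz hzm p hp hpz
        have hpos := dist_pos.2 hzm
        rw [dist_comm] at hpos
        have hle : t + dist m.src z ≤ dist o x := by
          linarith [dist_nonneg (x := z) (y := x)]
        have hmem : t + dist m.src z ∈ Set.Icc 0 (dist o x) := ⟨by linarith [ht.1], hle⟩
        have e1 := hγ t ht _ hmem
        have e2 := hγ _ hmem (dist o x) ⟨dist_nonneg, le_rfl⟩
        rw [abs_of_nonpos (by linarith), ← hmt] at e1
        rw [abs_of_nonpos (by linarith), h1] at e2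
        have e3 := dist_of_between hT hz (show dist m.src (γ (t + dist m.src z)) +
          dist (γ (t + dist m.src z)) x = dist m.src x by linarith)
        rw [e1, show dist m.src z - -(t - (t + dist m.src z)) = 0 by ring, abs_zero,
          dist_eq_zero] at e3
        exact hlast _ ⟨by linarith, hle⟩ ⟨p, hp, hpz.trans e3⟩)
      exact hNR n hn (hmaxN N hN hn)
    · obtain ⟨m, hm, hm'⟩ := hR.extend_limit hT hT' hE (y := γ t)
        (fun p hp e => hA ⟨p, hp, e⟩) (by
          intro ε hε
          obtain ⟨s, -, ⟨p, hp, hps⟩, hs⟩ := hcl ε hε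
          exact ⟨p, hp, by rwa [hps]⟩)
      exact hA ⟨m, hmaxN {m} hm' rfl, hm⟩
  choose p hpR hp using hdom
  have hiso : Isometry fun x => (p x).tgt := Isometry.of_dist_eq fun x y => by
    rw [← (hR.compat _ (hpR x) _ (hpR y)).dist_eq, hp, hp]
  have hclosed : IsClosed (Set.range fun x => (p x).tgt) :=
    hiso.isClosedEmbedding.isClosed_range
  have hsurj : Function.Surjective fun x => (p x).tgt := by
    intro x'
    by_contra hx
    change x' ∉ Set.range fun x => (p x).tgt at hx
    obtain ⟨γ, h0, h1, hγ⟩ := hT'.1 (p o).tgt x'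
    obtain ⟨t, ht, hcl, hlast⟩ := exists_last dist_nonneg hγ
      (A := Set.range fun x => (p x).tgt) (by rw [h0]; exact ⟨o, rfl⟩)
    obtain ⟨y, hy⟩ : γ t ∈ Set.range fun x => (p x).tgt := by
      refine hclosed.closure_subset (Metric.mem_closure_iff.2 fun ε hε => ?_)
      obtain ⟨s, -, hs, h⟩ := hcl ε hε
      exact ⟨γ s, hs, by rwa [dist_comm]⟩
    change (p y).tgt = γ t at hy
    have hxy : x' ≠ (p y).tgt := fun e => hx ⟨y, e.symm⟩
    obtain ⟨z, hz, hzd⟩ := exists_dir ((p y).equiv.symm (dir _ x' hxy))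
    have hz1 : (p z).src ≠ (p y).src := by rw [hp z]; exact hz
    have hz2 : (p z).tgt ≠ (p y).tgt := by
      intro e
      apply hz1
      rw [← dist_eq_zero, (hR.compat _ (hpR z) _ (hpR y)).dist_eq, e, dist_self]
    have hdir : dir (p y).tgt (p z).tgt hz2 = dir _ x' hxy := by
      rw [← (hR.compat _ (hpR y) _ (hpR z)).dir_eq hz1 hz2]
      have : dir (p y).src (p z).src hz1 = dir (p y).src z hz := by simp only [hp z]
      rw [this, hzd, Equiv.apply_symm_apply]
    rw [dir_eq_iff hT'] at hdir
    set b := (p y).tgt with hb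
    set c := (p z).tgt with hc
    set s := (dist c b + dist b x' - dist c x') / 2 with hs
    have hs0 : 0 < s := by rw [hs]; linarith
    have hbx : dist b x' = dist (p o).tgt x' - t := by
      have := hγ t ht (dist (p o).tgt x') ⟨dist_nonneg, le_rfl⟩
      rwa [h1, ← hy, abs_of_nonpos (by linarith [ht.2]), neg_sub] at this
    have hsx : s ≤ dist b x' := by
      have := dist_triangle c x' b
      rw [dist_comm x' b] at this
      rw [hs]; linarith
    have hsc : s ≤ dist b c := by
      have := dist_triangle b c x'
      rw [dist_comm b c] at this ⊢
      rw [hs]; linarith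
    -- a point of the range at distance `s` from `b`, towards `c`
    have hbc : dist b c = dist y z := by
      rw [hb, hc, ← (hR.compat _ (hpR y) _ (hpR z)).dist_eq, hp, hp]
    obtain ⟨δ, d0, d1, hδ⟩ := hT.1 y z
    have hsm : s ∈ Set.Icc 0 (dist y z) := ⟨hs0.le, hbc ▸ hsc⟩
    have f1 := hδ 0 ⟨le_rfl, dist_nonneg⟩ s hsm
    have f2 := hδ s hsm (dist y z) ⟨dist_nonneg, le_rfl⟩
    rw [d0, zero_sub, abs_neg, abs_of_pos hs0] at f1
    rw [d1, abs_of_nonpos (by linarith [hsm.2])] at f2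
    set w := (p (δ s)).tgt with hw
    have w1 : dist b w = s := by rw [← f1]; exact hiso.dist_eq y (δ s)
    have w2 : dist w c = dist b c - s := by
      rw [hbc, show dist w c = dist (δ s) z from hiso.dist_eq (δ s) z, f2]; ring
    have hmem : t + s ∈ Set.Icc 0 (dist (p o).tgt x') := ⟨by linarith [ht.1], by linarith⟩
    have e1 := hγ t ht _ hmem
    have e2 := hγ _ hmem (dist (p o).tgt x') ⟨dist_nonneg, le_rfl⟩
    rw [abs_of_nonpos (by linarith), ← hy] at e1
    rw [abs_of_nonpos (by linarith [hmem.2]), h1] at e2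
    have w3 : dist b w + dist w x' = dist b x' := by
      refine le_antisymm ?_ (dist_triangle _ _ _)
      have c1 := dist_comm b c
      have c2 := dist_comm c w
      have c3 := dist_comm c x'
      have c4 := dist_comm w x'
      rcases four_point hT' b c x' w with h | h
      · linarith
      · linarith
    have e3 := dist_of_between hT' w3 (show dist b (γ (t + s)) + dist (γ (t + s)) x' = dist b x' by
      linarith)
    rw [e1, w1, show s - -(t - (t + s)) = 0 by ring, abs_zero, dist_eq_zero] at e3
    exact hlast (t + s) ⟨by linarith, by linarith⟩ ⟨δ s, e3⟩
  exact ⟨IsometryEquiv.mk (Equiv.ofBijective _ ⟨hiso.injective, hsurj⟩) hiso⟩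

end RTree

/-- A set with an action of `ℝ` and a fixed-point free involution reversing the action. -/
class FlowSpace (X : Type) extends AddAction ℝ X where
  /-- the reversing involution -/
  rev : X → X
  rev_rev : ∀ x, rev (rev x) = x
  rev_ne : ∀ x, rev x ≠ x
  rev_vadd : ∀ (r : ℝ) (x : X), rev (r +ᵥ x) = -r +ᵥ rev x

theorem FlowSpace.rev_ne_vadd {X : Type} [FlowSpace X] (x : X) (r : ℝ) : rev x ≠ r +ᵥ x := by
  intro h
  refine rev_ne ((r / 2) +ᵥ x) ?_
  rw [rev_vadd, h, vadd_vadd]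
  congr 1; ring

namespace FlowWord

open MeasureTheory FlowSpace

theorem ae_add {P : ℝ → Prop} (h : ∀ᵐ t, P t) (a : ℝ) : ∀ᵐ t, P (t + a) :=
  (measurePreserving_add_right volume a).quasiMeasurePreserving.ae h

theorem ae_sub_left {P : ℝ → Prop} (h : ∀ᵐ t, P t) (a : ℝ) : ∀ᵐ t, P (a - t) :=
  (Measure.measurePreserving_sub_left volume a).quasiMeasurePreserving.ae h

theorem exists_of_ae {P : ℝ → Prop} (h : ∀ᵐ t, P t) {a b : ℝ} (hab : a < b) :
    ∃ t, a < t ∧ t < b ∧ P t := by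
  by_contra! hP
  have h2 : ∀ᵐ t : ℝ, t ∉ Set.Ioo a b := by
    filter_upwards [h] with t ht hm using hP t hm.1 hm.2 ht
  have h3 : volume (Set.Ioo a b) = 0 := by
    have h4 := ae_iff.1 h2
    simp only [not_not] at h4
    exact h4
  rw [Real.volume_Ioo, ENNReal.ofReal_eq_zero] at h3
  linarith

theorem ae_ne (a : ℝ) : ∀ᵐ t : ℝ, t ≠ a := by
  rw [ae_iff]
  simp

variable {X : Type}

/-- The functions `f` and `g` agree almost everywhere on `(0, k)`. -/
def Agree (f g : ℝ → X) (k : ℝ) : Prop := ∀ᵐ t : ℝ, 0 < t → t < k → f t = g t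

theorem Agree.symm {f g : ℝ → X} {k : ℝ} (h : Agree f g k) : Agree g f k := by
  filter_upwards [h] with t h h0 hk using (h h0 hk).symm

theorem Agree.trans {f g h : ℝ → X} {k : ℝ} (h1 : Agree f g k) (h2 : Agree g h k) :
    Agree f h k := by
  filter_upwards [h1, h2] with t h1 h2 h0 hk using (h1 h0 hk).trans (h2 h0 hk)

theorem Agree.mono {f g : ℝ → X} {k l : ℝ} (h : Agree f g k) (hl : l ≤ k) : Agree f g l := by
  filter_upwards [h] with t h h0 hk using h h0 (hk.trans_le hl)

theorem Agree.refl (f : ℝ → X) (k : ℝ) : Agree f f k := .of_forall fun _ _ _ => rfl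

theorem agree_of_forall_lt {f g : ℝ → X} {k : ℝ} (h : ∀ l < k, Agree f g l) : Agree f g k := by
  have : ∀ᵐ t : ℝ, ∀ n : ℕ, 0 < t → t < k - 1 / ((n : ℝ) + 1) → f t = g t :=
    ae_all_iff.2 fun n => h _ (sub_lt_self _ (by positivity))
  filter_upwards [this] with t ht h0 hk
  obtain ⟨n, hn⟩ := exists_nat_one_div_lt (sub_pos.2 hk)
  exact ht n h0 (by linarith)

variable [FlowSpace X]

/-- Near `t`, the function `f` follows an orbit of the flow. -/
def GoodAt (f : ℝ → X) (t : ℝ) : Prop :=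
  ∃ x : X, ∃ ε > 0, ∀ᵐ s : ℝ, |s - t| < ε → f s = s +ᵥ x

/-- The function `f` does not backtrack at `t`. -/
def ReducedAt (f : ℝ → X) (t : ℝ) : Prop :=
  ∀ ε > 0, ¬ ∀ᵐ s : ℝ, 0 < s → s < ε → f (t + s) = rev (f (t - s))

/-- Near `t`, the functions `f` and `g` agree almost everywhere. -/
def EqNear (f g : ℝ → X) (t : ℝ) : Prop :=
  ∃ δ > 0, ∀ᵐ s : ℝ, |s - t| < δ → f s = g s

theorem GoodAt.congr {f g : ℝ → X} {t : ℝ} (h : GoodAt f t) (hfg : EqNear f g t) :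
    GoodAt g t := by
  obtain ⟨x, ε, hε, hx⟩ := h
  obtain ⟨δ, hδ, hd⟩ := hfg
  refine ⟨x, min ε δ, lt_min hε hδ, ?_⟩
  filter_upwards [hx, hd] with s h1 h2 hs
  rw [← h2 (hs.trans_le (min_le_right _ _)), h1 (hs.trans_le (min_le_left _ _))]

theorem GoodAt.shift {f : ℝ → X} {t : ℝ} (a : ℝ) (h : GoodAt f (t + a)) :
    GoodAt (fun s => f (s + a)) t := by
  obtain ⟨x, ε, hε, hx⟩ := h
  refine ⟨a +ᵥ x, ε, hε, ?_⟩
  filter_upwards [ae_add hx a] with s h1 hs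
  rw [h1 (by rwa [add_sub_add_right_eq_sub]), vadd_vadd]

theorem GoodAt.reflect {f : ℝ → X} {t : ℝ} (a : ℝ) (h : GoodAt f (a - t)) :
    GoodAt (fun s => rev (f (a - s))) t := by
  obtain ⟨x, ε, hε, hx⟩ := h
  refine ⟨-a +ᵥ rev x, ε, hε, ?_⟩
  filter_upwards [ae_sub_left hx a] with s h1 hs
  rw [h1 (by rwa [sub_sub_sub_cancel_left, abs_sub_comm]), rev_vadd, vadd_vadd]
  congr 1; ring

theorem ReducedAt.congr {f g : ℝ → X} {t : ℝ} (h : ReducedAt f t) (hfg : EqNear f g t) :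
    ReducedAt g t := by
  obtain ⟨δ, hδ, hd⟩ := hfg
  intro ε hε hg
  refine h (min ε δ) (lt_min hε hδ) ?_
  have h1 := ae_add hd t
  have h2 := ae_sub_left hd t
  filter_upwards [hg, h1, h2] with s h3 h4 h5 h0 hs
  rw [add_comm t s, h4, h5, ← h3 h0 (hs.trans_le (min_le_left _ _)), add_comm]
  · rw [sub_sub_cancel_left, abs_neg, abs_of_pos h0]
    exact hs.trans_le (min_le_right _ _)
  · rw [add_sub_cancel_right, abs_of_pos h0]
    exact hs.trans_le (min_le_right _ _)

theorem ReducedAt.shift {f : ℝ → X} {t : ℝ} (a : ℝ) (h : ReducedAt f (t + a)) :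
    ReducedAt (fun s => f (s + a)) t := by
  intro ε hε hg
  refine h ε hε ?_
  filter_upwards [hg] with s h1 h0 hs
  rw [show t + a + s = t + s + a by ring, show t + a - s = t - s + a by ring]
  exact h1 h0 hs

theorem ReducedAt.reflect {f : ℝ → X} {t : ℝ} (a : ℝ) (h : ReducedAt f (a - t)) :
    ReducedAt (fun s => rev (f (a - s))) t := by
  intro ε hε hg
  refine h ε hε ?_
  filter_upwards [hg] with s h1 h0 hs
  have h2 := h1 h0 hs
  rw [show a - t + s = a - (t - s) by ring, show a - t - s = a - (t + s) by ring, h2, rev_rev]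

theorem reducedAt_of_goodAt {f : ℝ → X} {t : ℝ} (h : GoodAt f t) : ReducedAt f t := by
  obtain ⟨x, δ, hδ, hd⟩ := h
  intro ε hε hg
  have h1 := ae_add hd t
  have h2 := ae_sub_left hd t
  obtain ⟨s, hs0, hs1, h3, h4, h5⟩ := exists_of_ae (hg.and (h1.and h2)) (lt_min hε hδ)
  have e1 := h3 hs0 (hs1.trans_le (min_le_left _ _))
  have hs2 := hs1.trans_le (min_le_right _ _)
  rw [add_comm, h4 (by rwa [add_sub_cancel_right, abs_of_pos hs0]),
    h5 (by rwa [sub_sub_cancel_left, abs_neg, abs_of_pos hs0]), rev_vadd, neg_sub, sub_eq_add_neg,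
    add_vadd, add_vadd] at e1
  have e2 := vadd_left_cancel _ e1
  have : -t +ᵥ rev x = rev (t +ᵥ x) := (rev_vadd _ _).symm
  rw [this] at e2
  exact rev_ne _ e2.symm

variable (X) in
/-- A reduced path of finite length, given by its labels at almost every time. -/
structure Word where
  len : ℝ
  len_nonneg : 0 ≤ len
  fn : ℝ → X
  good : ∀ᵐ t : ℝ, 0 < t → t < len → GoodAt fn t
  red : ∀ t, 0 < t → t < len → ReducedAt fn t

/-- The length of the largest common initial part of two words. -/
def com (p q : Word X) : ℝ := sSup {k | 0 ≤ k ∧ k ≤ p.len ∧ k ≤ q.len ∧ Agree p.fn q.fn k}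

theorem com_set_nonempty (p q : Word X) :
    {k | 0 ≤ k ∧ k ≤ p.len ∧ k ≤ q.len ∧ Agree p.fn q.fn k}.Nonempty :=
  ⟨0, le_rfl, p.len_nonneg, q.len_nonneg, .of_forall fun _ h0 h1 => (h0.not_gt h1).elim⟩

theorem le_com {p q : Word X} {k : ℝ} (h0 : 0 ≤ k) (hp : k ≤ p.len) (hq : k ≤ q.len)
    (h : Agree p.fn q.fn k) : k ≤ com p q :=
  le_csSup ⟨p.len, fun _ h => h.2.1⟩ ⟨h0, hp, hq, h⟩

theorem com_nonneg (p q : Word X) : 0 ≤ com p q :=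
  le_com le_rfl p.len_nonneg q.len_nonneg (.of_forall fun _ h0 h1 => (h0.not_gt h1).elim)

theorem com_le_left (p q : Word X) : com p q ≤ p.len :=
  csSup_le (com_set_nonempty p q) fun _ h => h.2.1

theorem com_le_right (p q : Word X) : com p q ≤ q.len :=
  csSup_le (com_set_nonempty p q) fun _ h => h.2.2.1

theorem agree_com (p q : Word X) : Agree p.fn q.fn (com p q) := by
  refine agree_of_forall_lt fun l hl => ?_
  obtain ⟨k, hk, hlk⟩ := exists_lt_of_lt_csSup (com_set_nonempty p q) hl
  exact hk.2.2.2.mono hlk.le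

theorem com_comm (p q : Word X) : com p q = com q p :=
  le_antisymm
    (le_com (com_nonneg _ _) (com_le_right _ _) (com_le_left _ _) (agree_com _ _).symm)
    (le_com (com_nonneg _ _) (com_le_right _ _) (com_le_left _ _) (agree_com _ _).symm)

theorem com_self (p : Word X) : com p p = p.len :=
  le_antisymm (com_le_left _ _) (le_com p.len_nonneg le_rfl le_rfl (.refl _ _))

theorem min_com_le (p q r : Word X) : min (com p q) (com q r) ≤ com p r := by
  refine le_com (le_min (com_nonneg _ _) (com_nonneg _ _))
    ((min_le_left _ _).trans (com_le_left _ _)) ((min_le_right _ _).trans (com_le_right _ _)) ?_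
  exact ((agree_com p q).mono (min_le_left _ _)).trans ((agree_com q r).mono (min_le_right _ _))

/-- Equality of words almost everywhere. -/
instance wordSetoid : Setoid (Word X) where
  r p q := p.len = q.len ∧ Agree p.fn q.fn p.len
  iseqv := ⟨fun _ => ⟨rfl, .refl _ _⟩, fun h => ⟨h.1.symm, h.1 ▸ h.2.symm⟩,
    fun h1 h2 => ⟨h1.1.trans h2.1, h1.2.trans (h1.1 ▸ h2.2)⟩⟩

/-- The function labelling the reduced path obtained by following `f` backwards from time `a` to
time `k`, and then following `g` from time `k`. -/
def tripod (a k : ℝ) (f g : ℝ → X) (t : ℝ) : X :=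
  if t < a - k then rev (f (a - t)) else g (t - a + 2 * k)

theorem eqNear_tripod_left {a k : ℝ} {f g : ℝ → X} {t : ℝ} (ht : t < a - k) :
    EqNear (fun s => rev (f (a - s))) (tripod a k f g) t := by
  refine ⟨a - k - t, by linarith, .of_forall fun s hs => ?_⟩
  rw [tripod, if_pos (by linarith [(abs_lt.1 hs).2])]

theorem eqNear_tripod_right {a k : ℝ} {f g : ℝ → X} {t : ℝ} (ht : a - k < t) :
    EqNear (fun s => g (s + (-a + 2 * k))) (tripod a k f g) t := by
  refine ⟨t - (a - k), by linarith, .of_forall fun s hs => ?_⟩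
  rw [tripod, if_neg (by linarith [(abs_lt.1 hs).1])]
  ring_nf

/-- The reduced path from the end of `p` to the end of `q`. -/
def ldiv (p q : Word X) : Word X where
  len := p.len + q.len - 2 * com p q
  len_nonneg := by linarith [com_le_left p q, com_le_right p q]
  fn := tripod p.len (com p q) p.fn q.fn
  good := by
    have hk := com_nonneg p q
    filter_upwards [ae_sub_left p.good p.len, ae_add q.good (-p.len + 2 * com p q),
      ae_ne (p.len - com p q)] with t h1 h2 h3 h0 ht
    rcases h3.lt_or_gt with h | h
    · exact ((h1 (by linarith) (by linarith)).reflect _).congr (eqNear_tripod_left h)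
    · exact ((h2 (by linarith) (by linarith)).shift _).congr (eqNear_tripod_right h)
  red := by
    have hk := com_nonneg p q
    intro t h0 ht
    rcases lt_trichotomy t (p.len - com p q) with h | h | h
    · exact ((p.red _ (by linarith) (by linarith)).reflect _).congr (eqNear_tripod_left h)
    · subst h
      intro ε hε hred
      have hδ : 0 < min ε (min (p.len - com p q) (q.len - com p q)) :=
        lt_min hε (lt_min (by linarith) (by linarith))
      set δ := min ε (min (p.len - com p q) (q.len - com p q)) with hδdef
      have hδ1 : δ ≤ ε := min_le_left _ _
      have hδ2 : δ ≤ p.len - com p q := (min_le_right _ _).trans (min_le_left _ _)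
      have hδ3 : δ ≤ q.len - com p q := (min_le_right _ _).trans (min_le_right _ _)
      have : com p q + δ ≤ com p q := by
        refine le_com (by linarith) (by linarith) (by linarith) ?_
        filter_upwards [agree_com p q, ae_add hred (-com p q), ae_ne (com p q)]
          with t h1 h2 h3 h4 h5
        rcases h3.lt_or_gt with h | h
        · exact h1 h4 h
        · have := h2 (by linarith) (by linarith)
          rw [tripod, tripod, if_neg (by linarith), if_pos (by linarith), rev_rev] at this
          rw [show p.len - (p.len - com p q - (t + -com p q)) = t by ring,
            show p.len - com p q + (t + -com p q) - p.len + 2 * com p q = t by ring] at this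
          exact this.symm
      linarith
    · exact ((q.red _ (by linarith) (by linarith)).shift _).congr (eqNear_tripod_right h)

/-- The word `w` is the reduced path from the end of `p` to the end of `q`, where these words
share an initial part of length `k`. -/
structure IsDiv (p q w : Word X) (k : ℝ) : Prop where
  nonneg : 0 ≤ k
  le_left : k ≤ p.len
  le_right : k ≤ q.len
  agree : Agree p.fn q.fn k
  len_eq : w.len = p.len + q.len - 2 * k
  left : ∀ᵐ t : ℝ, 0 < t → t < p.len - k → w.fn t = rev (p.fn (p.len - t))
  right : ∀ᵐ t : ℝ, p.len - k < t → t < w.len → w.fn t = q.fn (t - p.len + 2 * k)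

theorem isDiv_ldiv (p q : Word X) : IsDiv p q (ldiv p q) (com p q) where
  nonneg := com_nonneg p q
  le_left := com_le_left p q
  le_right := com_le_right p q
  agree := agree_com p q
  len_eq := rfl
  left := .of_forall fun _ _ h => if_pos h
  right := .of_forall fun _ h _ => if_neg h.not_gt

theorem IsDiv.congr {p q w w' : Word X} {k : ℝ} (h : IsDiv p q w k) (hw : w ≈ w') :
    IsDiv p q w' k where
  nonneg := h.nonneg
  le_left := h.le_left
  le_right := h.le_right
  agree := h.agree
  len_eq := hw.1 ▸ h.len_eq
  left := by
    have h1 := h.len_eq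
    have h2 := h.le_right
    have h3 := h.nonneg
    filter_upwards [h.left, hw.2] with t h4 h5 h0 ht
    rw [← h5 h0 (by linarith), h4 h0 ht]
  right := by
    have h1 := hw.1
    have h2 := h.le_left
    filter_upwards [h.right, hw.2] with t h4 h5 h0 ht
    rw [← h5 (by linarith) (by linarith), h4 h0 (by linarith)]

theorem IsDiv.equiv {p q w w' : Word X} {k : ℝ} (h : IsDiv p q w k) (h' : IsDiv p q w' k) :
    w ≈ w' := by
  have e : w.len = w'.len := h.len_eq.trans h'.len_eq.symm
  refine ⟨e, ?_⟩
  filter_upwards [h.left, h'.left, h.right, h'.right, ae_ne (p.len - k)] with t h1 h2 h3 h4 h5 h6 h7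
  rcases h5.lt_or_gt with h | h
  · rw [h1 h6 h, h2 h6 h]
  · rw [h3 h h7, h4 h (by linarith)]

theorem IsDiv.com_eq {p q w : Word X} {k : ℝ} (h : IsDiv p q w k) : com p q = k := by
  refine le_antisymm (le_of_not_gt fun hk => ?_) (le_com h.nonneg h.le_left h.le_right h.agree)
  have h1 := com_le_left p q
  have h2 := com_le_right p q
  have h3 := h.len_eq
  have h4 := h.nonneg
  refine w.red (p.len - k) (by linarith) (by linarith) (com p q - k) (by linarith) ?_
  filter_upwards [ae_add h.right (p.len - k), ae_sub_left h.left (p.len - k),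
    ae_add (agree_com p q) k] with s h5 h6 h7 h8 h9
  rw [add_comm (p.len - k) s, h5 (by linarith) (by linarith), h6 (by linarith) (by linarith),
    rev_rev, show s + (p.len - k) - p.len + 2 * k = s + k by ring,
    show p.len - (p.len - k - s) = s + k by ring, h7 (by linarith) (by linarith)]

/-- Left translation by the inverse of `p` preserves quotients. -/
theorem IsDiv.isDiv {p q r u v w : Word X} {α β δ : ℝ} (hu : IsDiv p q u α) (hv : IsDiv p r v β)
    (hw : IsDiv q r w δ) : IsDiv u v w (p.len - α - β + δ) := by
  have hα := hu.com_eq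
  have hβ := hv.com_eq
  have hδ := hw.com_eq
  have m1 := min_com_le q p r
  have m2 := min_com_le p q r
  have m3 := min_com_le p r q
  rw [com_comm q p] at m1
  rw [com_comm r q] at m3
  rw [hα, hβ, hδ, min_le_iff] at m1 m2 m3
  have cases3 : (α < β ∧ δ = α) ∨ (β < α ∧ δ = β) ∨ (β = α ∧ α ≤ δ) := by
    rcases lt_trichotomy α β with h | h | h
    · refine Or.inl ⟨h, le_antisymm ?_ ?_⟩
      · rcases m3 with h | h <;> rcases m2 with h' | h' <;> linarith
      · rcases m1 with h | h <;> linarith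
    · refine Or.inr (Or.inr ⟨h.symm, ?_⟩)
      rcases m1 with h | h <;> linarith
    · refine Or.inr (Or.inl ⟨h, le_antisymm ?_ ?_⟩)
      · rcases m2 with h | h <;> rcases m3 with h' | h' <;> linarith
      · rcases m1 with h | h <;> linarith
  have a0 := hu.nonneg
  have a1 := hu.le_left
  have a2 := hu.le_right
  have a3 := hu.len_eq
  have b0 := hv.nonneg
  have b1 := hv.le_left
  have b2 := hv.le_right
  have b3 := hv.len_eq
  have c0 := hw.nonneg
  have c1 := hw.le_left
  have c2 := hw.le_right
  have c3 := hw.len_eq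
  refine ⟨?_, ?_, ?_, ?_, by linarith, ?_, ?_⟩
  · rcases cases3 with ⟨h, h'⟩ | ⟨h, h'⟩ | ⟨h, h'⟩ <;> linarith
  · rcases cases3 with ⟨h, h'⟩ | ⟨h, h'⟩ | ⟨h, h'⟩ <;> linarith
  · rcases cases3 with ⟨h, h'⟩ | ⟨h, h'⟩ | ⟨h, h'⟩ <;> linarith
  · filter_upwards [hu.left, hv.left, hu.right, hv.right, ae_add hw.agree (-p.len + 2 * α),
      ae_ne (p.len - α)] with t h1 h2 h3 h4 h5 h6 h0 ht
    rcases cases3 with ⟨h, h'⟩ | ⟨h, h'⟩ | ⟨h, h'⟩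
    · rw [h1 h0 (by linarith), h2 h0 (by linarith)]
    · rw [h1 h0 (by linarith), h2 h0 (by linarith)]
    · rcases h6.lt_or_gt with h7 | h7
      · rw [h1 h0 (by linarith), h2 h0 (by linarith)]
      · rw [h3 (by linarith) (by linarith), h4 (by linarith) (by linarith), h,
          show t - p.len + 2 * α = t + (-p.len + 2 * α) by ring]
        exact h5 (by linarith) (by linarith)
  · filter_upwards [hw.left, hw.right, ae_sub_left hu.left u.len, ae_sub_left hu.right u.len,
      ae_add hv.agree (2 * α - q.len), ae_ne (q.len - α)] with t h1 h2 h3 h4 h5 h6 h0 ht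
    have hlast : t < q.len - α → t < q.len - δ → w.fn t = rev (u.fn (u.len - t)) := by
      intro h7 h8
      rw [h1 h0 h8, h4 (by linarith) (by linarith)]
      congr 2; linarith
    rcases cases3 with ⟨h, h'⟩ | ⟨h, h'⟩ | ⟨h, h'⟩
    · rcases h6.lt_or_gt with h7 | h7
      · exact hlast h7 (by linarith)
      · rw [h2 (by linarith) (by linarith), h3 (by linarith) (by linarith), rev_rev, h',
          show p.len - (u.len - t) = t + (2 * α - q.len) by linarith,
          h5 (by linarith) (by linarith)]
        congr 1; ring
    · exact hlast (by linarith) (by linarith)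
    · exact hlast (by linarith) (by linarith)
  · have e : v.len - w.len = p.len - q.len - 2 * β + 2 * δ := by linarith
    filter_upwards [hw.left, hw.right, ae_add hv.left (v.len - w.len),
      ae_add hv.right (v.len - w.len), ae_add hu.agree (2 * δ - q.len), ae_ne (q.len - δ),
      ae_sub_left hu.agree q.len]
      with t h1 h2 h3 h4 h5 h6 h7 h0 ht
    have e1 : t - u.len + 2 * (p.len - α - β + δ) = t + (v.len - w.len) := by linarith
    rw [e1]
    rcases cases3 with ⟨h, h'⟩ | ⟨h, h'⟩ | ⟨h, h'⟩
    · rw [h2 (by linarith) ht, h4 (by linarith) (by linarith)]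
      congr 1; linarith
    · rcases h6.lt_or_gt with h8 | h8
      · rw [h1 (by linarith) h8, h3 (by linarith) (by linarith), ← h7 (by linarith) (by linarith)]
        congr 2; linarith
      · rw [h2 (by linarith) ht, h4 (by linarith) (by linarith)]
        congr 1; linarith
    · rw [h2 (by linarith) ht, h4 (by linarith) (by linarith)]
      congr 1; linarith

end FlowWord

namespace FlowWord

open MeasureTheory FlowSpace

variable {X : Type} [FlowSpace X]

theorem IsDiv.congr_arg {p q p' q' w : Word X} {k : ℝ} (h : IsDiv p q w k) (hp : p ≈ p')
    (hq : q ≈ q') : IsDiv p' q' w k where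
  nonneg := h.nonneg
  le_left := hp.1 ▸ h.le_left
  le_right := hq.1 ▸ h.le_right
  agree := ((hp.2.mono h.le_left).symm.trans h.agree).trans (hq.2.mono h.le_right)
  len_eq := by rw [← hp.1, ← hq.1, h.len_eq]
  left := by
    have h2 := h.nonneg
    filter_upwards [h.left, ae_sub_left hp.2 p.len] with t h4 h5 h0 ht
    rw [← hp.1] at ht ⊢
    rw [← h5 (by linarith) (by linarith), h4 h0 (by linarith)]
  right := by
    have h1 := h.len_eq
    have h2 := h.nonneg
    filter_upwards [h.right, ae_add hq.2 (-p.len + 2 * k)] with t h4 h5 h0 ht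
    rw [← hp.1] at h0 ⊢
    have e : t - p.len + 2 * k = t + (-p.len + 2 * k) := by ring
    rw [h4 h0 ht, e, h5 (by linarith) (by linarith)]

theorem com_congr {p q p' q' : Word X} (hp : p ≈ p') (hq : q ≈ q') : com p q = com p' q' :=
  ((isDiv_ldiv p q).congr_arg hp hq).com_eq.symm

theorem ldiv_congr {p q p' q' : Word X} (hp : p ≈ p') (hq : q ≈ q') :
    ldiv p q ≈ ldiv p' q' := by
  have h := (isDiv_ldiv p q).congr_arg hp hq
  rw [← h.com_eq] at h
  exact h.equiv (isDiv_ldiv p' q')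

theorem goodAt_orbit (x : X) (t : ℝ) : GoodAt (fun s => s +ᵥ x) t :=
  ⟨x, 1, one_pos, .of_forall fun _ _ => rfl⟩

/-- The word of length `L` following the orbit of `x`. -/
def orbitWord (x : X) (L : ℝ) (hL : 0 ≤ L) : Word X where
  len := L
  len_nonneg := hL
  fn t := t +ᵥ x
  good := .of_forall fun t _ _ => goodAt_orbit x t
  red t _ _ := reducedAt_of_goodAt (goodAt_orbit x t)

/-- The initial part of length `t` of a word. -/
def Word.take (p : Word X) (t : ℝ) (h0 : 0 ≤ t) (ht : t ≤ p.len) : Word X where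
  len := t
  len_nonneg := h0
  fn := p.fn
  good := by filter_upwards [p.good] with s h h1 h2 using h h1 (h2.trans_le ht)
  red s h1 h2 := p.red s h1 (h2.trans_le ht)

end FlowWord

open FlowWord in
/-- The group of reduced paths in a flow space, up to equality almost everywhere. -/
def PathGroup (X : Type) [FlowSpace X] : Type := Quotient (wordSetoid (X := X))

namespace PathGroup

open MeasureTheory FlowSpace FlowWord

variable {X : Type} [FlowSpace X]

/-- The element represented by a word. -/
def mk (p : Word X) : PathGroup X := Quotient.mk _ p

theorem mk_surjective : Function.Surjective (mk : Word X → PathGroup X) := Quotient.mk_surjective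

theorem mk_eq_mk {p q : Word X} : mk p = mk q ↔ p ≈ q := Quotient.eq

/-- The length of an element. -/
def len : PathGroup X → ℝ := Quotient.lift Word.len fun _ _ h => h.1

/-- The length of the largest common initial part. -/
def com : PathGroup X → PathGroup X → ℝ :=
  Quotient.lift₂ FlowWord.com fun _ _ _ _ h1 h2 => com_congr h1 h2

/-- Left division. -/
def ldiv : PathGroup X → PathGroup X → PathGroup X :=
  Quotient.map₂ FlowWord.ldiv fun _ _ h1 _ _ h2 => ldiv_congr h1 h2

@[simp] theorem len_mk (p : Word X) : len (mk p) = p.len := rfl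
@[simp] theorem com_mk (p q : Word X) : com (mk p) (mk q) = FlowWord.com p q := rfl
theorem ldiv_mk (p q : Word X) : ldiv (mk p) (mk q) = mk (FlowWord.ldiv p q) := rfl

theorem len_nonneg (p : PathGroup X) : 0 ≤ len p := Quotient.inductionOn p Word.len_nonneg

theorem com_nonneg (p q : PathGroup X) : 0 ≤ com p q :=
  Quotient.inductionOn₂ p q FlowWord.com_nonneg

theorem com_le_left (p q : PathGroup X) : com p q ≤ len p :=
  Quotient.inductionOn₂ p q FlowWord.com_le_left

theorem com_le_right (p q : PathGroup X) : com p q ≤ len q :=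
  Quotient.inductionOn₂ p q FlowWord.com_le_right

theorem com_comm (p q : PathGroup X) : com p q = com q p :=
  Quotient.inductionOn₂ p q FlowWord.com_comm

theorem com_self (p : PathGroup X) : com p p = len p :=
  Quotient.inductionOn p FlowWord.com_self

theorem min_com_le (p q r : PathGroup X) : min (com p q) (com q r) ≤ com p r :=
  Quotient.inductionOn₃ p q r FlowWord.min_com_le

theorem eq_of_com {p q : PathGroup X} (h1 : com p q = len p) (h2 : len p = len q) : p = q := by
  induction p, q using Quotient.inductionOn₂ with | _ p q
  refine Quotient.sound ⟨h2, ?_⟩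
  rw [← show FlowWord.com p q = p.len from h1]
  exact agree_com p q

theorem exists_take (p : PathGroup X) {t : ℝ} (h0 : 0 ≤ t) (ht : t ≤ len p) :
    ∃ u, len u = t ∧ com u p = t := by
  induction p using Quotient.inductionOn with | _ p
  refine ⟨mk (p.take t h0 ht), rfl, le_antisymm (FlowWord.com_le_left _ _) ?_⟩
  exact le_com h0 le_rfl ht (.refl _ _)

theorem len_ldiv (p q : PathGroup X) : len (ldiv p q) = len p + len q - 2 * com p q :=
  Quotient.inductionOn₂ p q fun _ _ => rfl

theorem ldiv_ldiv_ldiv (p q r : PathGroup X) : ldiv (ldiv p q) (ldiv p r) = ldiv q r := by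
  induction p, q, r using Quotient.inductionOn₃ with | _ p q r
  have h := (isDiv_ldiv p q).isDiv (isDiv_ldiv p r) (isDiv_ldiv q r)
  rw [← h.com_eq] at h
  exact Quotient.sound ((isDiv_ldiv _ _).equiv h)

theorem com_ldiv_ldiv (p q r : PathGroup X) :
    com (ldiv p q) (ldiv p r) = len p - com p q - com p r + com q r := by
  induction p, q, r using Quotient.inductionOn₃ with | _ p q r
  exact ((isDiv_ldiv p q).isDiv (isDiv_ldiv p r) (isDiv_ldiv q r)).com_eq

theorem agree_of_com {p q : Word X} {k : ℝ} (h : com (mk p) (mk q) = k) : Agree p.fn q.fn k :=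
  h ▸ agree_com p q

variable [Nonempty X]

instance : One (PathGroup X) := ⟨mk (orbitWord (Classical.arbitrary X) 0 le_rfl)⟩

@[simp] theorem len_one : len (1 : PathGroup X) = 0 := rfl

@[simp] theorem com_one_left (p : PathGroup X) : com 1 p = 0 :=
  le_antisymm (com_le_left 1 p) (com_nonneg _ _)

@[simp] theorem com_one_right (p : PathGroup X) : com p 1 = 0 :=
  le_antisymm (com_le_right p 1) (com_nonneg _ _)

theorem len_eq_zero {p : PathGroup X} : len p = 0 ↔ p = 1 :=
  ⟨fun h => eq_of_com (by rw [com_one_right, h]) h, fun h => by rw [h, len_one]⟩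

theorem len_pos {p : PathGroup X} (h : p ≠ 1) : 0 < len p :=
  (len_nonneg p).lt_of_ne' (mt len_eq_zero.1 h)

theorem one_ldiv (p : PathGroup X) : ldiv 1 p = p := by
  induction p using Quotient.inductionOn with | _ p
  have h := isDiv_ldiv (orbitWord (Classical.arbitrary X) 0 le_rfl) p
  have hc : FlowWord.com (orbitWord (Classical.arbitrary X) 0 le_rfl) p = 0 :=
    com_one_left (Quotient.mk _ p)
  have h1 := h.len_eq
  have h2 := h.right
  simp only [hc, show (orbitWord (Classical.arbitrary X) 0 le_rfl).len = 0 from rfl, mul_zero,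
    sub_zero, zero_add, add_zero] at h1 h2
  exact Quotient.sound ⟨h1, h2⟩

theorem ldiv_self (p : PathGroup X) : ldiv p p = 1 :=
  len_eq_zero.1 (by rw [len_ldiv, com_self]; ring)

theorem ldiv_one_ldiv (p q : PathGroup X) : ldiv (ldiv p 1) (ldiv p q) = q := by
  rw [ldiv_ldiv_ldiv, one_ldiv]

theorem ldiv_one_one (p : PathGroup X) : ldiv (ldiv p 1) 1 = p := by
  have h := ldiv_one_ldiv p p
  rwa [ldiv_self] at h

theorem ldiv_ldiv_one (p q : PathGroup X) : ldiv p (ldiv (ldiv p 1) q) = q := by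
  have h := ldiv_one_ldiv (ldiv p 1) q
  rwa [ldiv_one_one] at h

instance : Group (PathGroup X) where
  mul p q := ldiv (ldiv p 1) q
  inv p := ldiv p 1
  mul_assoc a b c := by
    change ldiv (ldiv (ldiv (ldiv a 1) b) 1) c = ldiv (ldiv a 1) (ldiv (ldiv b 1) c)
    rw [← ldiv_one_ldiv (ldiv (ldiv a 1) b) (ldiv (ldiv a 1) (ldiv (ldiv b 1) c)),
      ldiv_ldiv_ldiv (ldiv a 1) b, ldiv_ldiv_one]
  one_mul p := by
    change ldiv (ldiv 1 1) p = p
    rw [one_ldiv, one_ldiv]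
  mul_one p := ldiv_one_one p
  inv_mul_cancel p := by
    change ldiv (ldiv (ldiv p 1) 1) p = 1
    rw [ldiv_one_one, ldiv_self]

theorem inv_mul_eq_ldiv (p q : PathGroup X) : p⁻¹ * q = ldiv p q := by
  change ldiv (ldiv (ldiv p 1) 1) q = _
  rw [ldiv_one_one]

theorem len_inv_mul (p q : PathGroup X) : len (p⁻¹ * q) = len p + len q - 2 * com p q := by
  rw [inv_mul_eq_ldiv, len_ldiv]

theorem com_inv_mul (p q r : PathGroup X) :
    com (p⁻¹ * q) (p⁻¹ * r) = len p - com p q - com p r + com q r := by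
  rw [inv_mul_eq_ldiv, inv_mul_eq_ldiv, com_ldiv_ldiv]

@[simp] theorem len_inv (p : PathGroup X) : len p⁻¹ = len p := by
  simpa using len_inv_mul p 1

theorem len_mul (p q : PathGroup X) : len (p * q) = len p + len q - 2 * com p⁻¹ q := by
  simpa using len_inv_mul p⁻¹ q

theorem com_mul_left (p q : PathGroup X) : com (p * q) p = len p - com p⁻¹ q := by
  simpa using com_inv_mul p⁻¹ q 1

theorem fn_mul {p q w : Word X} (h : mk p * mk q = mk w) (hc : com (mk p)⁻¹ (mk q) = 0) :
    ∀ᵐ t, 0 < t → t < q.len → w.fn (t + p.len) = q.fn t := by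
  obtain ⟨p', hp'⟩ := mk_surjective (mk p)⁻¹
  have hl : p'.len = p.len := by
    rw [← len_mk, hp', len_inv, len_mk]
  rw [← hp', com_mk] at hc
  rw [← inv_inv (mk p), ← hp', inv_mul_eq_ldiv, ldiv_mk, mk_eq_mk] at h
  have h1 := (isDiv_ldiv p' q).congr h
  have h2 := h1.len_eq
  filter_upwards [ae_add h1.right p.len] with t h3 h4 h5
  rw [h3 (by linarith) (by linarith), hl, hc]
  congr 1; ring

end PathGroup

namespace PathGroup

open MeasureTheory FlowSpace FlowWord Filter Topology

variable {X : Type} [FlowSpace X]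

instance : MetricSpace (PathGroup X) where
  dist p q := len p + len q - 2 * com p q
  dist_self p := by rw [com_self]; ring
  dist_comm p q := by rw [com_comm]; ring
  dist_triangle p q r := by
    have h1 := com_le_left q r
    have h2 := com_le_right p q
    rcases min_le_iff.1 (min_com_le p q r) with h | h <;> linarith
  eq_of_dist_eq_zero {p q} h := by
    have h1 := com_le_left p q
    have h2 := com_le_right p q
    change len p + len q - 2 * com p q = 0 at h
    exact eq_of_com (by linarith) (by linarith)

theorem dist_def (p q : PathGroup X) : dist p q = len p + len q - 2 * com p q := rfl

theorem abs_len_sub_len_le (p q : PathGroup X) : |len p - len q| ≤ dist p q := by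
  have h1 := com_le_left p q
  have h2 := com_le_right p q
  rw [dist_def, abs_le]
  constructor <;> linarith

theorem exists_word_of_control {L : ℝ} (v : ℕ → Word X) (h0 : 0 ≤ L)
    (hv : ∀ k j : ℕ, k ≤ j → L - 1 / ((k : ℝ) + 1) < FlowWord.com (v k) (v j)) :
    ∃ w : Word X, w.len = L ∧ ∀ k, Agree w.fn (v k).fn (L - 1 / ((k : ℝ) + 1)) := by
  have hlen (k : ℕ) : L - 1 / ((k : ℝ) + 1) < (v k).len :=
    (hv k k le_rfl).trans_le (FlowWord.com_le_left _ _)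
  set f : ℝ → X := fun t => (v ⌊1 / (L - t)⌋₊).fn t with hf
  have hfv (k : ℕ) : Agree f (v k).fn (L - 1 / ((k : ℝ) + 1)) := by
    have h1 : ∀ᵐ t : ℝ, ∀ i : ℕ, i ≤ k → 0 < t → t < L - 1 / ((i : ℝ) + 1) →
        (v i).fn t = (v k).fn t := by
      refine ae_all_iff.2 fun i => ?_
      by_cases hik : i ≤ k
      · filter_upwards [(agree_com (v i) (v k)).mono (hv i k hik).le] with t ht _ using ht
      · exact .of_forall fun t h => (hik h).elim
    filter_upwards [h1] with t ht h2 h3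
    have h4 : 0 < L - t := by
      have : 0 < 1 / ((k : ℝ) + 1) := by positivity
      linarith
    refine ht _ ?_ h2 ?_
    · refine Nat.lt_succ_iff.1 ((Nat.floor_lt (by positivity)).2 ?_)
      rw [div_lt_iff₀ h4]
      have h5 : 1 / ((k : ℝ) + 1) < L - t := by linarith
      rw [div_lt_iff₀ (by positivity)] at h5
      push_cast
      linarith
    · have h5 := Nat.lt_floor_add_one (1 / (L - t))
      rw [div_lt_iff₀ h4] at h5
      have h6 : 1 / ((⌊1 / (L - t)⌋₊ : ℝ) + 1) < L - t := by
        rw [div_lt_iff₀ (by positivity)]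
        linarith
      linarith
  have hnear : ∀ t, 0 < t → t < L → ∃ k, t < (v k).len ∧ EqNear (v k).fn f t := by
    intro t ht0 htL
    obtain ⟨k, hk⟩ := exists_nat_one_div_lt (sub_pos.2 htL)
    refine ⟨k, by linarith [hlen k], min t (L - 1 / ((k : ℝ) + 1) - t),
      lt_min ht0 (by linarith), ?_⟩
    filter_upwards [hfv k] with s hs h
    have h1 := abs_lt.1 (h.trans_le (min_le_left _ _))
    have h2 := abs_lt.1 (h.trans_le (min_le_right _ _))
    exact (hs (by linarith) (by linarith)).symm
  refine ⟨⟨L, h0, f, ?_, ?_⟩, rfl, hfv⟩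
  · filter_upwards [ae_all_iff.2 fun k => (v k).good] with t ht h1 h2
    obtain ⟨k, hk, hn⟩ := hnear t h1 h2
    exact (ht k h1 hk).congr hn
  · intro t h1 h2
    obtain ⟨k, hk, hn⟩ := hnear t h1 h2
    exact ((v k).red t h1 hk).congr hn

instance : CompleteSpace (PathGroup X) := by
  refine Metric.complete_of_convergent_controlled_sequences (fun n : ℕ => 1 / (2 * ((n : ℝ) + 1)))
    (fun n => by positivity) fun u hu => ?_
  have hB : Tendsto (fun n : ℕ => 1 / (2 * ((n : ℝ) + 1))) atTop (𝓝 0) := by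
    have := (tendsto_one_div_add_atTop_nhds_zero_nat (𝕜 := ℝ)).const_mul (1 / 2)
    rw [mul_zero] at this
    refine this.congr fun n => ?_
    field_simp
  have hlen : ∀ N n m : ℕ, N ≤ n → N ≤ m → |len (u n) - len (u m)| < 1 / (2 * ((N : ℝ) + 1)) :=
    fun N n m h1 h2 => (abs_len_sub_len_le _ _).trans_lt (hu N n m h1 h2)
  obtain ⟨L, hL⟩ := cauchySeq_tendsto_of_complete
    (cauchySeq_of_le_tendsto_0 (s := fun n => len (u n)) _
      (fun n m N h1 h2 => (hlen N n m h1 h2).le) hB)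
  have hlL : ∀ N n : ℕ, N ≤ n → |len (u n) - L| ≤ 1 / (2 * ((N : ℝ) + 1)) := by
    intro N n hn
    refine le_of_tendsto (hL.const_sub (len (u n))).abs ?_
    filter_upwards [eventually_ge_atTop N] with m hm using (hlen N n m hn hm).le
  choose v hv using fun n => mk_surjective (u n)
  have hhalf (N : ℕ) : 1 / ((N : ℝ) + 1) = 2 * (1 / (2 * ((N : ℝ) + 1))) := by field_simp
  have hpos (N : ℕ) : 0 < 1 / (2 * ((N : ℝ) + 1)) := by positivity
  obtain ⟨w, hw1, hw2⟩ := exists_word_of_control (L := L) v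
    (ge_of_tendsto' hL fun n => len_nonneg _) (by
      intro k j hkj
      have h1 := abs_le.1 (hlL k k le_rfl)
      have h2 := abs_le.1 (hlL k j hkj)
      have h3 := hu k k j le_rfl hkj
      rw [dist_def, ← hv, ← hv, com_mk] at h3
      rw [← hv] at h1 h2
      rw [hhalf]
      linarith [hpos k])
  refine ⟨mk w, tendsto_iff_dist_tendsto_zero.2 ?_⟩
  have hb := (hB.const_mul 5)
  rw [mul_zero] at hb
  refine squeeze_zero (fun _ => dist_nonneg) (fun n => ?_) hb
  have h1 := abs_le.1 (hlL n n le_rfl)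
  have h2 : L - 1 / ((n : ℝ) + 1) ≤ com (u n) (mk w) := by
    by_cases h0 : 0 ≤ L - 1 / ((n : ℝ) + 1)
    · rw [← hv, com_mk]
      refine le_com h0 ?_ ?_ (hw2 n).symm
      · rw [← hv, len_mk] at h1
        rw [hhalf]
        linarith [hpos n]
      · rw [hw1]
        linarith [hpos n, hhalf n]
    · linarith [com_nonneg (u n) (mk w)]
  rw [dist_def, len_mk, hw1]
  rw [hhalf] at h2
  linarith [hpos n]

theorem com_eq_of_com_eq_len {u v p : PathGroup X} (hu : com u p = len u) (hv : com v p = len v)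
    (h : len u ≤ len v) : com u v = len u := by
  refine le_antisymm (com_le_left _ _) ?_
  have := min_com_le u p v
  rwa [hu, com_comm p v, hv, min_eq_left h] at this

theorem dist_of_com_eq_len {u v p : PathGroup X} (hu : com u p = len u) (hv : com v p = len v) :
    dist u v = |len u - len v| := by
  rw [dist_def]
  rcases le_total (len u) (len v) with h | h
  · rw [com_eq_of_com_eq_len hu hv h, abs_of_nonpos (by linarith)]
    ring
  · rw [com_comm, com_eq_of_com_eq_len hv hu h, abs_of_nonneg (by linarith)]
    ring

variable [Nonempty X]

theorem dist_eq_len (p q : PathGroup X) : dist p q = len (p⁻¹ * q) := (len_inv_mul p q).symm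

@[simp] theorem dist_mul_left' (p q r : PathGroup X) : dist (p * q) (p * r) = dist q r := by
  rw [dist_eq_len, dist_eq_len]
  congr 1
  group

theorem isRTree : IsRTree (PathGroup X) := by
  refine ⟨fun x y => ?_, fun p x y z => ?_⟩
  · have h (t : ℝ) : ∃ u : PathGroup X, t ∈ Set.Icc 0 (dist x y) →
        len u = t ∧ com u (x⁻¹ * y) = t := by
      by_cases ht : t ∈ Set.Icc 0 (dist x y)
      · obtain ⟨u, hu⟩ := exists_take (x⁻¹ * y) ht.1 (dist_eq_len x y ▸ ht.2)
        exact ⟨u, fun _ => hu⟩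
      · exact ⟨1, fun h => (ht h).elim⟩
    choose u hu using h
    refine ⟨fun t => x * u t, ?_, ?_, fun s hs t ht => ?_⟩
    · change x * u 0 = x
      rw [len_eq_zero.1 (hu 0 ⟨le_rfl, dist_nonneg⟩).1, mul_one]
    · obtain ⟨h1, h2⟩ := hu _ ⟨dist_nonneg, le_rfl⟩
      change x * u (dist x y) = y
      rw [eq_of_com (h2.trans h1.symm) (h1.trans (dist_eq_len x y)), mul_inv_cancel_left]
    · obtain ⟨h1, h2⟩ := hu s hs
      obtain ⟨h3, h4⟩ := hu t ht
      rw [dist_mul_left', dist_of_com_eq_len (h2.trans h1.symm) (h4.trans h3.symm), h1, h3]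
  · have h := min_com_le (p⁻¹ * x) (p⁻¹ * z) (p⁻¹ * y)
    simp only [com_inv_mul] at h
    simp only [dist_def]
    rw [com_comm x p, com_comm y p, com_comm z p]
    convert h using 1
    · congr 1 <;> ring
    · ring

end PathGroup

namespace PathGroup

open MeasureTheory FlowSpace FlowWord Filter Topology

variable {X : Type} [FlowSpace X]

open Classical in
/-- The orbit followed by a function on an interval with rational end points, if any. -/
def orbitData (f : ℝ → X) (i : ℚ × ℚ) : Option X :=
  if h : ∃ x : X, ∀ᵐ s : ℝ, i.1 < s → s < i.2 → f s = s +ᵥ x then some h.choose else none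

theorem ae_of_orbitData_eq_some {f : ℝ → X} {i : ℚ × ℚ} {x : X} (h : orbitData f i = some x) :
    ∀ᵐ s : ℝ, i.1 < s → s < i.2 → f s = s +ᵥ x := by
  rw [orbitData] at h
  split_ifs at h with hx
  rw [← Option.some.inj h]
  exact hx.choose_spec

theorem exists_orbitData {f : ℝ → X} {t : ℝ} (h : GoodAt f t) :
    ∃ i : ℚ × ℚ, i.1 < t ∧ t < i.2 ∧ (orbitData f i).isSome := by
  obtain ⟨x, ε, hε, hx⟩ := h
  obtain ⟨a, ha, ha'⟩ := exists_rat_btwn (sub_lt_self t hε)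
  obtain ⟨b, hb, hb'⟩ := exists_rat_btwn (lt_add_of_pos_right t hε)
  refine ⟨(a, b), ha', hb, ?_⟩
  have : ∃ x : X, ∀ᵐ s : ℝ, a < s → s < b → f s = s +ᵥ x := by
    refine ⟨x, ?_⟩
    filter_upwards [hx] with s hs h1 h2
    exact hs (abs_lt.2 ⟨by linarith, by linarith⟩)
  rw [orbitData, dif_pos this, Option.isSome_some]

theorem mk_le_continuum (hX : #X ≤ continuum) : #(PathGroup X) ≤ continuum := by
  have hinj : Function.Injective fun p : PathGroup X =>
      ((Quotient.out p).len, orbitData (Quotient.out p).fn) := by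
    intro p q h
    obtain ⟨h1, h2⟩ := Prod.mk.inj h
    rw [← Quotient.out_eq p, ← Quotient.out_eq q]
    refine Quotient.sound ⟨h1, ?_⟩
    have h3 : ∀ᵐ t : ℝ, ∀ i : ℚ × ℚ, (orbitData (Quotient.out p).fn i).isSome →
        i.1 < t → t < i.2 → (Quotient.out p).fn t = (Quotient.out q).fn t := by
      refine ae_all_iff.2 fun i => ?_
      by_cases hi : (orbitData (Quotient.out p).fn i).isSome
      · obtain ⟨x, hx⟩ := Option.isSome_iff_exists.1 hi
        filter_upwards [ae_of_orbitData_eq_some hx, ae_of_orbitData_eq_some (h2 ▸ hx)]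
          with t h4 h5 _ h6 h7
        rw [h4 h6 h7, h5 h6 h7]
      · exact .of_forall fun _ h => (hi h).elim
    filter_upwards [h3, (Quotient.out p).good] with t h4 h5 h6 h7
    obtain ⟨i, hi1, hi2, hi3⟩ := exists_orbitData (h5 h6 h7)
    exact h4 i hi3 hi1 hi2
  refine (Cardinal.mk_le_of_injective hinj).trans ?_
  have h1 : #(Option X) ≤ continuum := by
    rw [Cardinal.mk_option]
    exact (add_le_add hX (one_le_aleph0.trans aleph0_le_continuum)).trans_eq (continuum_add_self)
  rw [Cardinal.mk_prod, Cardinal.lift_id, Cardinal.lift_id, Cardinal.mk_real]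
  have h2 : #(ℚ × ℚ → Option X) ≤ continuum := by
    rw [← Cardinal.power_def, Cardinal.mk_eq_aleph0 (ℚ × ℚ), ← continuum_power_aleph0]
    exact Cardinal.power_le_power_right h1
  exact (mul_le_mul' le_rfl h2).trans_eq continuum_mul_self

theorem com_orbitWord {x y : X} (h : x ≠ y) {L M : ℝ} (hL : 0 ≤ L) (hM : 0 ≤ M) :
    com (mk (orbitWord x L hL)) (mk (orbitWord y M hM)) = 0 := by
  refine le_antisymm (le_of_not_gt fun hc => h ?_) (com_nonneg _ _)
  obtain ⟨t, h0, h1, h2⟩ := exists_of_ae (agree_com (orbitWord x L hL) (orbitWord y M hM)) hc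
  exact vadd_left_cancel _ (h2 h0 h1)

variable [Nonempty X]

theorem valence_eq (hX : #X = continuum) (p : PathGroup X) :
    valence (PathGroup X) p = continuum := by
  refine le_antisymm ?_ ?_
  · refine (Cardinal.mk_le_of_surjective (f := ConnectedComponents.mk)
      ConnectedComponents.surjective_coe).trans ?_
    exact (Cardinal.mk_subtype_le _).trans (mk_le_continuum hX.le)
  · rw [← hX]
    have hd (x : X) : dist (p * mk (orbitWord x 1 zero_le_one)) p = 1 := by
      conv_lhs => rw [← mul_one p, mul_assoc, one_mul, dist_mul_left']
      rw [dist_def, com_one_right, len_one, len_mk]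
      norm_num [orbitWord]
    have hne (x : X) : p * mk (orbitWord x 1 zero_le_one) ≠ p := by
      intro h
      have := hd x
      rw [h, dist_self] at this
      exact zero_ne_one this
    refine Cardinal.mk_le_of_injective (f := fun x : X => RTree.dir p _ (hne x)) fun x y h => ?_
    by_contra hxy
    refine (RTree.dir_ne_iff isRTree (hne x) (hne y)).2 ?_ h
    rw [hd, dist_comm p, hd, dist_mul_left', dist_def, com_orbitWord hxy, len_mk, len_mk]
    norm_num [orbitWord]

end PathGroup

namespace PathGroup

open MeasureTheory FlowSpace FlowWord

variable {X : Type} [FlowSpace X] [Nonempty X]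

theorem two_mul_com_inv_lt {h : PathGroup X} (hh : h ≠ 1) : 2 * com h h⁻¹ < len h := by
  by_contra! ha
  have h0 := len_nonneg h
  obtain ⟨M, hM1, hM2⟩ := exists_take h (t := len h / 2) (by linarith) (by linarith)
  have h1 : com M h⁻¹ = len h / 2 := by
    refine le_antisymm ((com_le_left _ _).trans_eq hM1) ?_
    rcases min_le_iff.1 (min_com_le M h h⁻¹) with h | h <;> linarith
  have h2 : len (h * M) = len h / 2 := by
    rw [len_mul, com_comm, h1, hM1]
    ring
  have h3 : com (h * M) h = len h / 2 := by
    rw [com_mul_left, com_comm, h1]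
    ring
  have h4 : com (h * M) M = len h / 2 := by
    refine le_antisymm ((com_le_left _ _).trans_eq h2) ?_
    rw [com_comm] at hM2
    rcases min_le_iff.1 (min_com_le (h * M) h M) with h | h <;> linarith
  exact hh (mul_eq_right.1 (eq_of_com (h4.trans h2.symm) (h2.trans hM1.symm)))

theorem com_inv_le_of_le_com {h g : PathGroup X} (hh : h ≠ 1)
    (hg : len h - com h h⁻¹ ≤ com h g) : com h⁻¹ g ≤ com h h⁻¹ := by
  have h1 := two_mul_com_inv_lt hh
  have h2 := min_com_le h g h⁻¹
  rw [com_comm g] at h2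
  rcases min_le_iff.1 h2 with h | h <;> linarith

theorem le_com_pow {h : PathGroup X} (hh : h ≠ 1) (m : ℕ) :
    len h - com h h⁻¹ ≤ com h (h ^ (m + 1)) := by
  induction m with
  | zero =>
    rw [zero_add, pow_one, com_self]
    linarith [com_nonneg h h⁻¹]
  | succ m ih =>
    rw [pow_succ', com_comm h (h * _), com_mul_left]
    linarith [com_inv_le_of_le_com hh ih]

theorem com_inv_le_com_pow (h : PathGroup X) (m : ℕ) :
    com h h⁻¹ ≤ com (h ^ (m + 1)) (h ^ (m + 1))⁻¹ := by
  by_cases hh : h = 1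
  · simp [hh]
  have h1 := two_mul_com_inv_lt hh
  have h2 := le_com_pow hh m
  have h3 := le_com_pow (inv_ne_one.2 hh) m
  rw [len_inv, inv_inv, com_comm h⁻¹, inv_pow] at h3
  have h4 := min_com_le (h ^ (m + 1)) h h⁻¹
  rw [com_comm _ h] at h4
  have h5 := min_com_le (h ^ (m + 1)) h⁻¹ (h ^ (m + 1))⁻¹
  rcases min_le_iff.1 h4 with h | h <;> rcases min_le_iff.1 h5 with h' | h' <;> linarith

theorem com_inv_pow {h : PathGroup X} (hc : com h h⁻¹ = 0) (m : ℕ) : com h⁻¹ (h ^ m) = 0 := by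
  refine le_antisymm ?_ (com_nonneg _ _)
  by_cases hh : h = 1
  · simp [hh]
  rcases m with _ | m
  · simp
  · exact (com_inv_le_of_le_com hh (le_com_pow hh m)).trans_eq hc

theorem len_pow {h : PathGroup X} (hc : com h h⁻¹ = 0) (m : ℕ) : len (h ^ m) = m * len h := by
  induction m with
  | zero => simp
  | succ m ih =>
    rw [pow_succ', len_mul, ih, com_inv_pow hc]
    push_cast
    ring

theorem periodic_of_pow_eq {h : PathGroup X} {w : Word X} {m : ℕ} (hm : h ^ (m + 1) = mk w)
    (hc : com h h⁻¹ = 0) :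
    ∀ᵐ t, 0 < t → t < w.len - len h → w.fn (t + len h) = w.fn t := by
  obtain ⟨p, rfl⟩ := mk_surjective h
  obtain ⟨q, hq⟩ := mk_surjective (mk p ^ m)
  have h1 : mk p * mk q = mk w := by rw [hq, ← pow_succ', hm]
  have h2 := fn_mul h1 (hq ▸ com_inv_pow hc m)
  have h3 : com (mk w) (mk q) = q.len := by
    rw [← hm, pow_succ, hq, com_mul_left, ← inv_pow, com_comm, ← hq, len_mk]
    have h4 := com_inv_pow (h := (mk p)⁻¹) (by rwa [inv_inv, com_comm]) m
    rw [inv_inv] at h4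
    rw [h4, sub_zero]
  have h5 : w.len = q.len + p.len := by
    have e1 := len_pow hc m
    have e2 := len_pow hc (m + 1)
    rw [← hq, len_mk, len_mk] at e1
    rw [hm, len_mk, len_mk] at e2
    push_cast at e2
    linarith
  filter_upwards [h2, agree_of_com h3] with t h6 h7 h8 h9
  rw [len_mk] at h9 ⊢
  rw [h6 h8 (by linarith), h7 h8 (by linarith)]

theorem exists_conj_com_eq_zero {g : PathGroup X} (hg : g ≠ 1) :
    ∃ u : PathGroup X, com (u⁻¹ * g * u) (u⁻¹ * g * u)⁻¹ = 0 := by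
  have h1 := two_mul_com_inv_lt hg
  have h0 := com_nonneg g g⁻¹
  obtain ⟨u, hu1, hu2⟩ := exists_take g (com_nonneg g g⁻¹) (com_le_left _ _)
  refine ⟨u, ?_⟩
  set m := com g g⁻¹ with hm
  have hu3 : com u g⁻¹ = m := by
    refine le_antisymm ((com_le_left _ _).trans_eq hu1) ?_
    rcases min_le_iff.1 (min_com_le u g g⁻¹) with h | h <;> linarith
  have h2 : com (g * u) g = len g - m := by rw [com_mul_left, com_comm, hu3]
  have h3 : com (g⁻¹ * u) g⁻¹ = len g - m := by rw [com_mul_left, inv_inv, com_comm, hu2, len_inv]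
  have h4 : com u (g * u) = m := by
    refine le_antisymm ((com_le_left _ _).trans_eq hu1) ?_
    have := min_com_le u g (g * u)
    rw [com_comm g, h2, hu2] at this
    rcases min_le_iff.1 this with h | h <;> linarith
  have h5 : com u (g⁻¹ * u) = m := by
    refine le_antisymm ((com_le_left _ _).trans_eq hu1) ?_
    have := min_com_le u g⁻¹ (g⁻¹ * u)
    rw [com_comm g⁻¹, h3, hu3] at this
    rcases min_le_iff.1 this with h | h <;> linarith
  have h6 : com (g * u) (g⁻¹ * u) = m := by
    refine le_antisymm ?_ ?_
    · have e1 := min_com_le g (g * u) (g⁻¹ * u)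
      have e2 := min_com_le g (g⁻¹ * u) g⁻¹
      rw [com_comm g, h2] at e1
      rw [h3, ← hm] at e2
      rcases min_le_iff.1 e1 with h | h <;> rcases min_le_iff.1 e2 with h' | h' <;> linarith
    · have := min_com_le (g * u) u (g⁻¹ * u)
      rwa [com_comm _ u, h4, h5, min_self] at this
  have e : (u⁻¹ * g * u)⁻¹ = u⁻¹ * (g⁻¹ * u) := by group
  rw [e, mul_assoc, com_inv_mul, h4, h5, h6, hu1]
  ring

theorem mk_of_isDiv {p q w : Word X} {k : ℝ} (h : IsDiv p q w k) :
    (mk p)⁻¹ * mk q = mk w := by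
  have h1 := isDiv_ldiv p q
  rw [h.com_eq] at h1
  rw [inv_mul_eq_ldiv, ldiv_mk]
  exact mk_eq_mk.2 (h1.equiv h)

theorem inv_orbitWord (x : X) {L : ℝ} (hL : 0 ≤ L) :
    (mk (orbitWord x L hL))⁻¹ = mk (orbitWord (-L +ᵥ rev x) L hL) := by
  rw [← mul_one (mk _)⁻¹]
  refine mk_of_isDiv (p := orbitWord x L hL)
    (q := orbitWord (Classical.arbitrary X) 0 le_rfl) (k := 0) ⟨le_rfl, hL, le_rfl,
    .of_forall fun t h0 h1 => (h0.not_gt h1).elim, ?_, .of_forall fun t h0 h1 => ?_,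
    .of_forall fun t h0 h1 => ?_⟩
  · simp [orbitWord]
  · simp only [orbitWord]
    rw [rev_vadd, vadd_vadd]
    congr 1; ring
  · simp only [orbitWord, sub_zero] at h0 h1
    exact (h0.not_gt h1).elim

theorem com_inv_orbitWord (x : X) {L : ℝ} (hL : 0 ≤ L) :
    com (mk (orbitWord x L hL)) (mk (orbitWord x L hL))⁻¹ = 0 := by
  rw [inv_orbitWord]
  refine com_orbitWord (fun h => rev_ne_vadd x L ?_) hL hL
  nth_rw 2 [h]
  rw [vadd_vadd, add_neg_cancel, zero_vadd]

theorem orbitWord_mul {x : X} {L M : ℝ} (hL : 0 ≤ L) (hM : 0 ≤ M) (hx : L +ᵥ x = x) :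
    mk (orbitWord x L hL) * mk (orbitWord x M hM) =
      mk (orbitWord x (L + M) (add_nonneg hL hM)) := by
  rw [← inv_inv (mk (orbitWord x L hL)), inv_orbitWord]
  refine mk_of_isDiv (k := 0) ⟨le_rfl, hL, hM,
    .of_forall fun t h0 h1 => (h0.not_gt h1).elim, ?_, .of_forall fun t h0 h1 => ?_,
    .of_forall fun t h0 h1 => ?_⟩
  · simp [orbitWord]
  · simp only [orbitWord]
    rw [rev_vadd, rev_vadd, rev_rev, vadd_vadd]
    congr 1; ring
  · simp only [orbitWord]
    nth_rw 2 [← hx]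
    rw [vadd_vadd]
    congr 1; ring

theorem orbitWord_pow {x : X} {L : ℝ} (hL : 0 ≤ L) (hx : L +ᵥ x = x) (m : ℕ) :
    mk (orbitWord x L hL) ^ m = mk (orbitWord x (m * L) (by positivity)) := by
  induction m with
  | zero =>
    rw [pow_zero]
    exact (len_eq_zero.1 (by simp [orbitWord])).symm
  | succ m ih =>
    rw [pow_succ', ih, orbitWord_mul hL _ hx]
    congr 2
    push_cast
    ring

end PathGroup

/-- The primes `p` such that `g` has `p ^ n`-th roots for all `n`. -/
def rootPrimes {G : Type} [Group G] (g : G) : Set Nat.Primes :=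
  {p | ∀ n : ℕ, ∃ h : G, h ^ ((p : ℕ) ^ n) = g}

theorem rootPrimes_map {G H : Type} [Group G] [Group H] (e : G ≃* H) (g : G) :
    rootPrimes (e g) = rootPrimes g := by
  ext p
  refine forall_congr' fun n => ⟨fun ⟨h, hh⟩ => ⟨e.symm h, ?_⟩, fun ⟨h, hh⟩ => ⟨e h, ?_⟩⟩
  · rw [← map_pow, hh, e.symm_apply_apply]
  · rw [← map_pow, hh]

namespace PathGroup

open MeasureTheory FlowSpace FlowWord

variable {X : Type} [FlowSpace X]

theorem vadd_eq_of_div {x : X} {L : ℝ} {p : ℕ} (hp : p ≠ 0) {n k : ℕ} (hnk : n ≤ k)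
    (h : (L / (p : ℝ) ^ k) +ᵥ x = x) : (L / (p : ℝ) ^ n) +ᵥ x = x := by
  have h1 : (p ^ (k - n)) • (L / (p : ℝ) ^ k) ∈ AddAction.stabilizer ℝ x :=
    AddSubgroup.nsmul_mem _ h _
  have hp' : (p : ℝ) ≠ 0 := Nat.cast_ne_zero.2 hp
  have h2 : (p ^ (k - n)) • (L / (p : ℝ) ^ k) = L / (p : ℝ) ^ n := by
    obtain ⟨j, rfl⟩ := Nat.exists_eq_add_of_le hnk
    rw [nsmul_eq_mul, Nat.add_sub_cancel_left, pow_add]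
    push_cast
    field_simp
  rwa [h2] at h1

/-- A function with small period which follows an orbit somewhere does so everywhere. -/
theorem agree_orbit_of_periodic {f : ℝ → X} {x : X} {L τ a b : ℝ} (h0 : 0 ≤ a) (hb : b ≤ L)
    (hτ : 0 < τ) (hab : τ < b - a) (hf : ∀ᵐ t, a < t → t < b → f t = t +ᵥ x)
    (hper : ∀ᵐ t, 0 < t → t < L - τ → f (t + τ) = f t) :
    τ +ᵥ x = x ∧ Agree f (fun t => t +ᵥ x) L := by
  have hx : τ +ᵥ x = x := by
    obtain ⟨t, h1, h2, h3, h4, h5⟩ := exists_of_ae (hf.and ((ae_add hf τ).and hper))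
      (show a < b - τ by linarith)
    have h6 := h5 (by linarith) (by linarith)
    rw [h3 h1 (by linarith), h4 (by linarith) (by linarith), add_vadd] at h6
    exact vadd_left_cancel _ h6
  refine ⟨hx, ?_⟩
  have hup (j : ℕ) : ∀ᵐ t, 0 < t → t < L → a < t + j * τ → t + j * τ < b → f t = t +ᵥ x := by
    induction j with
    | zero =>
      filter_upwards [hf] with t h _ _ h1 h2
      exact h (by simpa using h1) (by simpa using h2)
    | succ j ih =>
      filter_upwards [ae_add ih τ, hper] with t h1 h2 h3 h4 h5 h6
      push_cast at h5 h6
      have : 0 ≤ j * τ := by positivity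
      rw [← h2 h3 (by linarith), h1 (by linarith) (by linarith) (by linarith) (by linarith),
        add_vadd, hx]
  have hdown (j : ℕ) : ∀ᵐ t, 0 < t → t < L → a < t - j * τ → t - j * τ < b → f t = t +ᵥ x := by
    induction j with
    | zero =>
      filter_upwards [hf] with t h _ _ h1 h2
      exact h (by simpa using h1) (by simpa using h2)
    | succ j ih =>
      filter_upwards [ae_add ih (-τ), ae_add hper (-τ)] with t h1 h2 h3 h4 h5 h6
      push_cast at h5 h6
      have : 0 ≤ j * τ := by positivity
      have h7 := h2 (by linarith) (by linarith)
      rw [neg_add_cancel_right] at h7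
      rw [h7, h1 (by linarith) (by linarith) (by linarith) (by linarith)]
      nth_rw 1 [← hx]
      rw [vadd_vadd, neg_add_cancel_right]
  obtain ⟨c, hac, hcb⟩ := exists_between (show a < b - τ by linarith)
  filter_upwards [ae_all_iff.2 hup, ae_all_iff.2 hdown] with t h1 h2 h3 h4
  rcases le_total c t with h5 | h5
  · have h6 := Nat.floor_le (div_nonneg (sub_nonneg.2 h5) hτ.le)
    have h7 := Nat.lt_floor_add_one ((t - c) / τ)
    rw [le_div_iff₀ hτ] at h6
    rw [div_lt_iff₀ hτ] at h7
    exact h2 _ h3 h4 (by linarith) (by linarith)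
  · have h6 := Nat.floor_le (div_nonneg (show 0 ≤ c + τ - t by linarith) hτ.le)
    have h7 := Nat.lt_floor_add_one ((c + τ - t) / τ)
    rw [le_div_iff₀ hτ] at h6
    rw [div_lt_iff₀ hτ] at h7
    exact h1 _ h3 h4 (by linarith) (by linarith)

variable [Nonempty X]

theorem vadd_eq_of_pow_eq {x : X} {L : ℝ} (hL : 0 < L) (hx : L +ᵥ x = x) {h : PathGroup X}
    {m : ℕ} (hm : m ≠ 0) (hh : h ^ m = mk (orbitWord x L hL.le)) : (L / m) +ᵥ x = x := by
  obtain ⟨m, rfl⟩ := Nat.exists_eq_succ_of_ne_zero hm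
  rcases m.eq_zero_or_pos with rfl | hm'
  · simpa using hx
  have hc : com h h⁻¹ = 0 := by
    refine le_antisymm ((com_inv_le_com_pow h m).trans_eq ?_) (com_nonneg _ _)
    rw [hh, com_inv_orbitWord]
  have hl := len_pow hc (m + 1)
  rw [hh] at hl
  change L = _ at hl
  have hlen : len h = L / ((m + 1 : ℕ) : ℝ) := by
    rw [hl]; field_simp
  have hlt : len h < L := by
    rw [hlen]
    refine div_lt_self hL ?_
    norm_cast
    omega
  obtain ⟨t, h1, h2, h3⟩ := exists_of_ae (periodic_of_pow_eq hh hc) (sub_pos.2 hlt)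
  have h4 := h3 h1 h2
  simp only [orbitWord, add_vadd] at h4
  rw [← hlen]
  exact vadd_left_cancel _ h4

theorem rootPrimes_orbitWord {x : X} {L : ℝ} (hL : 0 < L) (hx : L +ᵥ x = x) :
    rootPrimes (mk (orbitWord x L hL.le)) =
      {p : Nat.Primes | ∀ n : ℕ, (L / ((p : ℕ) : ℝ) ^ n) +ᵥ x = x} := by
  ext p
  refine forall_congr' fun n => ⟨fun ⟨h, hh⟩ => ?_, fun h => ?_⟩
  · have := vadd_eq_of_pow_eq hL hx (pow_ne_zero _ p.2.ne_zero) hh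
    rwa [Nat.cast_pow] at this
  · refine ⟨mk (orbitWord x (L / ((p : ℕ) : ℝ) ^ n) (by positivity)), ?_⟩
    rw [orbitWord_pow _ h]
    have hp : ((p : ℕ) : ℝ) ≠ 0 := Nat.cast_ne_zero.2 p.2.ne_zero
    congr 2
    push_cast
    field_simp

theorem exists_orbitWord_of_com_eq_zero {g : PathGroup X} (hg : g ≠ 1) (hc : com g g⁻¹ = 0)
    {p : Nat.Primes} (hp : p ∈ rootPrimes g) :
    ∃ (x : X) (L : ℝ) (hL : 0 < L), L +ᵥ x = x ∧ g = mk (orbitWord x L hL.le) := by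
  obtain ⟨w, rfl⟩ := mk_surjective g
  have hL := len_pos hg
  rw [len_mk] at hL
  obtain ⟨t₀, h0, hL0, h1⟩ := exists_of_ae w.good hL
  obtain ⟨x, ε, hε, hx⟩ := h1 h0 hL0
  set δ := min ε (min t₀ (w.len - t₀)) with hδ
  have hδ0 : 0 < δ := lt_min hε (lt_min h0 (by linarith))
  have hδ1 : δ ≤ ε := min_le_left _ _
  have hδ2 : δ ≤ t₀ := (min_le_right _ _).trans (min_le_left _ _)
  have hδ3 : δ ≤ w.len - t₀ := (min_le_right _ _).trans (min_le_right _ _)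
  obtain ⟨n, hn⟩ : ∃ n : ℕ, w.len / ((p : ℕ) : ℝ) ^ n < δ := by
    obtain ⟨n, hn⟩ := pow_unbounded_of_one_lt (w.len / δ)
      (show (1 : ℝ) < ((p : ℕ) : ℝ) by exact_mod_cast p.2.one_lt)
    refine ⟨n, ?_⟩
    have : (0 : ℝ) < ((p : ℕ) : ℝ) := by exact_mod_cast p.2.pos
    rw [div_lt_iff₀ hδ0] at hn
    rw [div_lt_iff₀ (by positivity)]
    linarith
  obtain ⟨h, hh⟩ := hp n
  obtain ⟨m, hm⟩ := Nat.exists_eq_succ_of_ne_zero (pow_ne_zero n p.2.ne_zero)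
  rw [Nat.succ_eq_add_one] at hm
  rw [hm] at hh
  have hc' : com h h⁻¹ = 0 := by
    refine le_antisymm ((com_inv_le_com_pow h m).trans_eq ?_) (com_nonneg _ _)
    rw [hh, hc]
  have hl := len_pow hc' (m + 1)
  rw [hh, ← hm, len_mk] at hl
  have hp0 : (0 : ℝ) < ((p : ℕ) : ℝ) := by exact_mod_cast p.2.pos
  have hlen : len h = w.len / ((p : ℕ) : ℝ) ^ n := by
    rw [hl]
    push_cast
    field_simp
  have hl0 : 0 < len h := by
    rw [hlen]
    positivity
  obtain ⟨h2, h3⟩ := agree_orbit_of_periodic (f := w.fn) (x := x) (L := w.len) (τ := len h)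
    (a := t₀ - δ) (b := t₀ + δ) (by linarith) (by linarith) hl0 (by linarith) (by
      filter_upwards [hx] with t ht h4 h5
      exact ht (abs_lt.2 ⟨by linarith, by linarith⟩)) (periodic_of_pow_eq hh hc')
  refine ⟨x, w.len, hL, ?_, mk_eq_mk.2 ⟨rfl, h3⟩⟩
  have := vadd_eq_of_div (L := w.len) p.2.ne_zero n.zero_le (hlen ▸ h2)
  simpa using this

theorem exists_orbit_of_mem_rootPrimes {g : PathGroup X} (hg : g ≠ 1) {p : Nat.Primes}
    (hp : p ∈ rootPrimes g) : ∃ (x : X) (L : ℝ), 0 < L ∧ L +ᵥ x = x ∧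
      rootPrimes g = {p : Nat.Primes | ∀ n : ℕ, (L / ((p : ℕ) : ℝ) ^ n) +ᵥ x = x} := by
  obtain ⟨u, hu⟩ := exists_conj_com_eq_zero hg
  have e : MulAut.conj u⁻¹ g = u⁻¹ * g * u := by simp
  have hr := rootPrimes_map (MulAut.conj u⁻¹) g
  rw [e] at hr
  obtain ⟨x, L, hL, hx, h⟩ := exists_orbitWord_of_com_eq_zero (g := u⁻¹ * g * u)
    (fun h => hg ((map_eq_one_iff _ (MulAut.conj u⁻¹).injective).1 (e.trans h))) hu (hr ▸ hp)
  exact ⟨x, L, hL, hx, by rw [← hr, h, rootPrimes_orbitWord hL hx]⟩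

end PathGroup

/-- The subgroup `ℤ[1/P]` of `ℝ`. -/
def locInt (P : Set Nat.Primes) : AddSubgroup ℝ where
  carrier := {r | ∃ b : ℕ, b ≠ 0 ∧ (∀ p : Nat.Primes, (p : ℕ) ∣ b → p ∈ P) ∧ ∃ a : ℤ, r * b = a}
  zero_mem' := ⟨1, one_ne_zero, fun p h => (p.2.one_lt.ne' (Nat.dvd_one.1 h)).elim, 0, by simp⟩
  add_mem' := by
    rintro r s ⟨b, hb, hP, a, ha⟩ ⟨d, hd, hP', c, hc⟩
    refine ⟨b * d, mul_ne_zero hb hd, fun p h => ?_, a * d + c * b, ?_⟩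
    · exact ((p.2.dvd_mul).1 h).elim (hP p) (hP' p)
    · push_cast
      rw [← ha, ← hc]
      ring
  neg_mem' := by
    rintro r ⟨b, hb, hP, a, ha⟩
    exact ⟨b, hb, hP, -a, by rw [neg_mul, ha]; simp⟩

theorem one_mem_locInt (P : Set Nat.Primes) : (1 : ℝ) ∈ locInt P :=
  ⟨1, one_ne_zero, fun p h => (p.2.one_lt.ne' (Nat.dvd_one.1 h)).elim, 1, by simp⟩

theorem exists_int_of_mem_locInt_empty {r : ℝ} (h : r ∈ locInt ∅) : ∃ a : ℤ, r = a := by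
  obtain ⟨b, hb, hP, a, ha⟩ := h
  have h1 : b = 1 := by
    by_contra hb1
    obtain ⟨p, hp, hpb⟩ := Nat.exists_prime_and_dvd hb1
    exact hP ⟨p, hp⟩ hpb
  exact ⟨a, by simpa [h1] using ha⟩

theorem forall_div_mem_locInt {P : Set Nat.Primes} {L : ℝ} (hL : L ≠ 0) (h : L ∈ locInt P)
    (p : Nat.Primes) : (∀ n : ℕ, L / ((p : ℕ) : ℝ) ^ n ∈ locInt P) ↔ p ∈ P := by
  obtain ⟨b, hb, hP, a, ha⟩ := h
  have hp0 : ((p : ℕ) : ℝ) ≠ 0 := Nat.cast_ne_zero.2 p.2.ne_zero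
  constructor
  · intro hn
    by_contra hpP
    have ha0 : a ≠ 0 := by
      rintro rfl
      rw [Int.cast_zero, mul_eq_zero, Nat.cast_eq_zero] at ha
      exact ha.elim hL hb
    have hdvd (n : ℕ) : (p : ℕ) ^ n ∣ a.natAbs := by
      obtain ⟨d, hd, hP', c, hc⟩ := hn n
      have h1 : a * d = c * b * (p : ℕ) ^ n := by
        have : (a : ℝ) * d = c * b * ((p : ℕ) : ℝ) ^ n := by
          rw [← ha, ← hc]
          field_simp
        exact_mod_cast this
      have h2 : (p : ℕ) ^ n ∣ a.natAbs * d := by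
        have h3 : (((p : ℕ) ^ n : ℕ) : ℤ) ∣ a * d := ⟨c * b, by rw [h1]; push_cast; ring⟩
        have h4 := Int.natAbs_dvd_natAbs.2 h3
        rwa [Int.natAbs_natCast, Int.natAbs_mul, Int.natAbs_natCast] at h4
      refine Nat.Coprime.dvd_of_dvd_mul_right (Nat.Coprime.pow_left n ?_) h2
      exact (Nat.Prime.coprime_iff_not_dvd p.2).2 fun h => hpP (hP' p h)
    have h1 := Nat.le_of_dvd (Int.natAbs_pos.2 ha0) (hdvd a.natAbs)
    exact (Nat.lt_pow_self p.2.one_lt).not_ge h1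
  · intro hpP n
    refine ⟨b * (p : ℕ) ^ n, mul_ne_zero hb (pow_ne_zero _ p.2.ne_zero), fun q hq => ?_, a, ?_⟩
    · rcases (q.2.dvd_mul).1 hq with h | h
      · exact hP q h
      · have h1 := (Nat.prime_dvd_prime_iff_eq q.2 p.2).1 (q.2.dvd_of_dvd_pow h)
        rwa [Subtype.ext h1]
    · rw [← ha]
      push_cast
      field_simp

/-- The disjoint union, over `P ∈ J`, of two copies of `ℝ ⧸ ℤ[1/P]`, on which `ℝ` acts by
translations in opposite directions. -/
def OrbitSum (J : Set (Set Nat.Primes)) : Type := Bool × Σ P : J, ℝ ⧸ locInt P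

namespace OrbitSum

variable {J : Set (Set Nat.Primes)}

instance : FlowSpace (OrbitSum J) where
  vadd r x := (x.1, ⟨x.2.1, ((bif x.1 then r else -r : ℝ) : ℝ ⧸ locInt x.2.1) + x.2.2⟩)
  zero_vadd x := by
    obtain ⟨b, P, q⟩ := x
    change (b, (⟨P, _⟩ : Σ P : J, ℝ ⧸ locInt P)) = _
    cases b <;> simp
  add_vadd r s x := by
    obtain ⟨b, P, q⟩ := x
    change (b, (⟨P, ((bif b then r + s else -(r + s) : ℝ) : ℝ ⧸ locInt (P : Set Nat.Primes)) + q⟩ :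
      Σ P : J, ℝ ⧸ locInt P)) = (b, ⟨P, ((bif b then r else -r : ℝ) : ℝ ⧸ locInt _) +
        (((bif b then s else -s : ℝ) : ℝ ⧸ locInt _) + q)⟩)
    rw [← add_assoc, ← QuotientAddGroup.mk_add]
    cases b <;> simp [add_comm] <;> rfl
  rev x := (!x.1, x.2)
  rev_rev x := by
    obtain ⟨b, P, q⟩ := x
    cases b <;> rfl
  rev_ne x h := by simpa using congrArg Prod.fst h
  rev_vadd r x := by
    obtain ⟨b, P, q⟩ := x
    change (!b, (⟨P, _⟩ : Σ P : J, ℝ ⧸ locInt P)) = (!b, ⟨P, _⟩)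
    cases b <;> simp

theorem vadd_eq_self_iff (r : ℝ) (x : OrbitSum J) :
    r +ᵥ x = x ↔ r ∈ locInt (x.2.1 : Set Nat.Primes) := by
  obtain ⟨b, P, q⟩ := x
  change (b, (⟨P, _⟩ : Σ P : J, ℝ ⧸ locInt P)) = (b, ⟨P, q⟩) ↔ r ∈ locInt (P : Set Nat.Primes)
  cases b <;> simp [QuotientAddGroup.eq_zero_iff]

theorem mk_eq (h : ∅ ∈ J) : #(OrbitSum J) = continuum := by
  apply le_antisymm
  · have hs : Function.Surjective fun y : Bool × J × ℝ =>
        ((y.1, ⟨y.2.1, (y.2.2 : ℝ ⧸ locInt (y.2.1 : Set Nat.Primes))⟩) : OrbitSum J) := by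
      rintro ⟨b, P, q⟩
      obtain ⟨r, rfl⟩ := QuotientAddGroup.mk_surjective q
      exact ⟨(b, P, r), rfl⟩
    refine (Cardinal.mk_le_of_surjective hs).trans ?_
    have hJ : #J ≤ continuum := by
      refine (Cardinal.mk_subtype_le _).trans ?_
      change #(Set Nat.Primes) ≤ _
      rw [Cardinal.mk_set, Cardinal.mk_eq_aleph0, two_power_aleph0]
    simp only [Cardinal.mk_prod, Cardinal.lift_id, Cardinal.mk_real]
    refine (mul_le_mul' ((Cardinal.lt_aleph0_of_finite Bool).le.trans aleph0_le_continuum)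
      (mul_le_mul' hJ le_rfl)).trans ?_
    rw [continuum_mul_self, continuum_mul_self]
  · rw [← Cardinal.mk_Ioo_real zero_lt_one]
    refine Cardinal.mk_le_of_injective (f := fun t : Set.Ioo (0 : ℝ) 1 =>
      ((true, ⟨⟨∅, h⟩, ((t : ℝ) : ℝ ⧸ locInt ∅)⟩) : OrbitSum J)) fun s t hst => ?_
    have h1 : ((s : ℝ) : ℝ ⧸ locInt ∅) = ((t : ℝ) : ℝ ⧸ locInt ∅) := by
      have := (Prod.mk.inj hst).2
      simpa using this
    obtain ⟨a, ha⟩ := exists_int_of_mem_locInt_empty (QuotientAddGroup.eq.1 h1)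
    have hs := s.2
    have ht := t.2
    have h2 : a = 0 := by
      have h3 : ((-1 : ℤ) : ℝ) < a := by
        push_cast
        linarith [hs.1, hs.2, ht.1, ht.2]
      have h4 : (a : ℝ) < ((1 : ℤ) : ℝ) := by
        push_cast
        linarith [hs.1, hs.2, ht.1, ht.2]
      have h5 := Int.cast_lt.1 h3
      have h6 := Int.cast_lt.1 h4
      omega
    rw [h2, Int.cast_zero] at ha
    exact Subtype.ext (by linarith)

open FlowWord PathGroup in
theorem exists_rootPrimes_eq_iff [Nonempty (OrbitSum J)] {P : Set Nat.Primes}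
    (hP : P.Nonempty) :
    (∃ g : PathGroup (OrbitSum J), g ≠ 1 ∧ rootPrimes g = P) ↔ P ∈ J := by
  have key (x : OrbitSum J) {L : ℝ} (hL : 0 < L) (hx : L +ᵥ x = x) :
      {p : Nat.Primes | ∀ n : ℕ, (L / ((p : ℕ) : ℝ) ^ n) +ᵥ x = x} = x.2.1 := by
    ext p
    simp only [vadd_eq_self_iff] at hx ⊢
    exact forall_div_mem_locInt hL.ne' hx p
  constructor
  · rintro ⟨g, hg, rfl⟩
    obtain ⟨p, hp⟩ := hP
    obtain ⟨x, L, hL, hx, h⟩ := exists_orbit_of_mem_rootPrimes hg hp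
    rw [h, key x hL hx]
    exact x.2.1.2
  · intro h
    let x : OrbitSum J := (true, ⟨⟨P, h⟩, 0⟩)
    have hx : (1 : ℝ) +ᵥ x = x :=
      (vadd_eq_self_iff _ _).2 (one_mem_locInt P)
    refine ⟨PathGroup.mk (orbitWord _ 1 zero_lt_one.le), fun h1 => ?_,
      (rootPrimes_orbitWord zero_lt_one hx).trans (key _ zero_lt_one hx)⟩
    exact one_ne_zero (len_eq_zero.2 h1)

end OrbitSum

theorem PathGroup.exists_action {X T : Type} [FlowSpace X] [Nonempty X] (hX : #X = continuum)
    [MetricSpace T] [CompleteSpace T] (hT : IsRTree T)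
    (hval : ∀ x : T, valence T x = Cardinal.continuum) :
    ∃ φ : PathGroup X → T → T, IsometricAction φ ∧ FreeAction φ ∧ TransAction φ := by
  rcases isEmpty_or_nonempty T with hT' | ⟨⟨o⟩⟩
  · exact ⟨fun _ x => x, ⟨fun _ => isometry_id, fun _ => rfl, fun _ _ _ => rfl⟩,
      fun _ x => isEmptyElim x, fun x => isEmptyElim x⟩
  obtain ⟨e⟩ := RTree.nonempty_isometryEquiv hT (isRTree (X := X))
    (fun x y => Cardinal.eq.1 ((hval x).trans (valence_eq hX y).symm)) o 1
  refine ⟨fun g x => e.symm (g * e x), ⟨fun g => ?_, fun x => ?_, fun g h x => ?_⟩,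
    fun g x h => ?_, fun x y => ⟨e y * (e x)⁻¹, ?_⟩⟩
  · refine Isometry.of_dist_eq fun x y => ?_
    rw [e.symm.dist_eq, dist_mul_left', e.dist_eq]
  · simp
  · simp [mul_assoc]
  · rw [e.symm_apply_eq] at h
    exact mul_eq_right.1 h
  · simp

/-- There are `2^(2^ℵ₀)` pairwise non-isomorphic groups admitting a free transitive
action by isometries on the complete universal real tree `T` with valence `2^ℵ₀`. -/
theorem stmt1 (T : Type) [MetricSpace T] [CompleteSpace T]
    (hT : IsRTree T) (hval : ∀ x : T, valence T x = Cardinal.continuum) :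
    ∃ (I : Type) (G : I → Type) (_ : ∀ i, Group (G i)),
      #I = 2 ^ Cardinal.continuum ∧
      (∀ i j : I, i ≠ j → IsEmpty (G i ≃* G j)) ∧
      (∀ i : I, ∃ φ : G i → T → T, IsometricAction φ ∧ FreeAction φ ∧ TransAction φ) := by
  let J (i : Set ({∅}ᶜ : Set (Set Nat.Primes))) : Set (Set Nat.Primes) :=
    insert ∅ (Subtype.val '' i)
  have hcard i : #(OrbitSum (J i)) = continuum := OrbitSum.mk_eq (Set.mem_insert _ _)
  have hne i : Nonempty (OrbitSum (J i)) :=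
    Cardinal.mk_ne_zero_iff.1 (by rw [hcard]; exact continuum_ne_zero)
  have hmem i (P : ({∅}ᶜ : Set (Set Nat.Primes))) : (P : Set Nat.Primes) ∈ J i ↔ P ∈ i := by
    have hP : (P : Set Nat.Primes) ≠ ∅ := P.2
    simp [J, hP]
  refine ⟨Set ({∅}ᶜ : Set (Set Nat.Primes)), fun i => PathGroup (OrbitSum (J i)),
    fun i => inferInstance, ?_, fun i j hij => ⟨fun e => hij ?_⟩,
    fun i => PathGroup.exists_action (hcard i) hT hval⟩
  · have h : #(Set Nat.Primes) = continuum := by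
      rw [Cardinal.mk_set, Cardinal.mk_eq_aleph0, two_power_aleph0]
    rw [Cardinal.mk_set, Cardinal.mk_compl_of_infinite, h]
    rw [h, Cardinal.mk_singleton]
    exact one_lt_aleph0.trans_le aleph0_le_continuum
  · ext P
    have hP : (P : Set Nat.Primes).Nonempty := Set.nonempty_iff_ne_empty.2 P.2
    rw [← hmem i, ← hmem j, ← OrbitSum.exists_rootPrimes_eq_iff hP,
      ← OrbitSum.exists_rootPrimes_eq_iff hP]
    constructor
    · rintro ⟨g, hg, h⟩
      exact ⟨e g, (map_ne_one_iff e e.injective).2 hg, (rootPrimes_map e g).trans h⟩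
    · rintro ⟨g, hg, h⟩
      exact ⟨e.symm g, (map_ne_one_iff e.symm e.symm.injective).2 hg,
        (rootPrimes_map e.symm g).trans h⟩
end
end

section
/- There exists a group G admitting a free transitive action by isometries on the ℓ¹ product T₁ × T₂ of two complete ℝ-trees T₁, T₂, each with valence 2^ℵ₀, such that for every subgroup H ≤ G which splits non-trivially as a direct product (H ≅ H₁ × H₂ with H₁ and H₂ both nontrivial), the induced action of H on T₁ × T₂ is not cobounded. -/
open Cardinal

noncomputable section

/-- The ℓ¹ metric on the product of two metric spaces. -/
def l1dist2 {T₁ T₂ : Type} [MetricSpace T₁] [MetricSpace T₂] (p q : T₁ × T₂) : ℝ :=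
  dist p.1 q.1 + dist p.2 q.2

/-- A group `K` splits non-trivially as a direct product. -/
def SplitsAsProduct (K : Type) [Group K] : Prop :=
  ∃ (P Q : Type) (_ : Group P) (_ : Group Q),
    Nontrivial P ∧ Nontrivial Q ∧ Nonempty (K ≃* P × Q)

/-- Reduced `1`-Lipschitz paths in `X` starting at `0`, parametrised on `[0, len]` and extended by
constants. A path is reduced if it does not backtrack at any interior time. -/
structure ReducedPath (X : Type) [NormedAddCommGroup X] where
  len : ℝ
  toFun : ℝ → X
  len_nonneg : 0 ≤ len
  lip : ∀ s t, ‖toFun s - toFun t‖ ≤ |s - t|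
  eq_zero : ∀ t ≤ 0, toFun t = 0
  eq_top : ∀ t, len ≤ t → toFun t = toFun len
  reduced : ∀ x, 0 < x → x < len → ∀ ε > 0, ∃ t, 0 < t ∧ t < ε ∧ toFun (x - t) ≠ toFun (x + t)

namespace ReducedPath

section Basic

variable {X : Type} [NormedAddCommGroup X]

theorem ext_of_eq {u v : ReducedPath X} (h : u.len = v.len) (hf : ∀ t, u.toFun t = v.toFun t) :
    u = v := by
  cases u; cases v
  obtain rfl := h
  obtain rfl := funext hf
  rfl

/-- The endpoint of a path. -/
def tip (u : ReducedPath X) : X := u.toFun u.len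

theorem continuous_toFun (u : ReducedPath X) : Continuous u.toFun := by
  have : LipschitzWith 1 u.toFun := LipschitzWith.of_dist_le_mul fun s t => by
    simpa [dist_eq_norm] using u.lip s t
  exact this.continuous

/-- The times up to which two paths coincide. -/
def agreeSet (u v : ReducedPath X) : Set ℝ :=
  {t | t ≤ u.len ∧ t ≤ v.len ∧ ∀ s ≤ t, u.toFun s = v.toFun s}

/-- The length of the longest common initial segment. -/
def meet (u v : ReducedPath X) : ℝ := sSup (agreeSet u v)

theorem bddAbove_agreeSet (u v : ReducedPath X) : BddAbove (agreeSet u v) :=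
  ⟨u.len, fun _ h => h.1⟩

theorem zero_mem_agreeSet (u v : ReducedPath X) : 0 ∈ agreeSet u v :=
  ⟨u.len_nonneg, v.len_nonneg, fun s hs => by rw [u.eq_zero s hs, v.eq_zero s hs]⟩

theorem le_meet {u v : ReducedPath X} {t : ℝ} (hu : t ≤ u.len) (hv : t ≤ v.len)
    (h : ∀ s ≤ t, u.toFun s = v.toFun s) : t ≤ meet u v :=
  le_csSup (bddAbove_agreeSet u v) ⟨hu, hv, h⟩

theorem meet_nonneg (u v : ReducedPath X) : 0 ≤ meet u v :=
  le_csSup (bddAbove_agreeSet u v) (zero_mem_agreeSet u v)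

theorem meet_le_left (u v : ReducedPath X) : meet u v ≤ u.len :=
  csSup_le ⟨0, zero_mem_agreeSet u v⟩ fun _ h => h.1

theorem meet_le_right (u v : ReducedPath X) : meet u v ≤ v.len :=
  csSup_le ⟨0, zero_mem_agreeSet u v⟩ fun _ h => h.2.1

theorem eq_of_le_meet {u v : ReducedPath X} {s : ℝ} (hs : s ≤ meet u v) :
    u.toFun s = v.toFun s := by
  have hlt : ∀ s < meet u v, u.toFun s = v.toFun s := fun s hs => by
    obtain ⟨t, ht, hst⟩ := exists_lt_of_lt_csSup ⟨0, zero_mem_agreeSet u v⟩ hs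
    exact ht.2.2 s hst.le
  have hcl : IsClosed {s | u.toFun s = v.toFun s} :=
    isClosed_eq u.continuous_toFun v.continuous_toFun
  have : closure (Set.Iio (meet u v)) ⊆ {s | u.toFun s = v.toFun s} :=
    closure_minimal hlt hcl
  rw [closure_Iio] at this
  exact this hs

theorem meet_comm (u v : ReducedPath X) : meet u v = meet v u :=
  le_antisymm (le_meet (meet_le_right _ _) (meet_le_left _ _) fun _ h => (eq_of_le_meet h).symm)
    (le_meet (meet_le_right _ _) (meet_le_left _ _) fun _ h => (eq_of_le_meet h).symm)

theorem meet_self (u : ReducedPath X) : meet u u = u.len :=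
  le_antisymm (meet_le_left _ _) (le_meet le_rfl le_rfl fun _ _ => rfl)

theorem min_meet_le (u v w : ReducedPath X) : min (meet u v) (meet v w) ≤ meet u w :=
  le_meet ((min_le_left _ _).trans (meet_le_left _ _))
    ((min_le_right _ _).trans (meet_le_right _ _)) fun _ h =>
      (eq_of_le_meet (h.trans (min_le_left _ _))).trans
        (eq_of_le_meet (h.trans (min_le_right _ _)))

/-- Past the meet, two paths that both continue differ at arbitrarily small times. -/
theorem exists_ne_of_meet_lt {u v : ReducedPath X} (hu : meet u v < u.len) (hv : meet u v < v.len)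
    {ε : ℝ} (hε : 0 < ε) :
    ∃ t, 0 < t ∧ t < ε ∧ u.toFun (meet u v + t) ≠ v.toFun (meet u v + t) := by
  by_contra! h
  obtain ⟨δ, hδ, hδ2⟩ := exists_between
    (show 0 < min ε (min (u.len - meet u v) (v.len - meet u v)) by
      simp only [lt_min_iff]; exact ⟨hε, by linarith, by linarith⟩)
  simp only [lt_min_iff] at hδ2
  have := le_meet (u := u) (v := v) (t := meet u v + δ) (by linarith) (by linarith) fun s hs => by
    rcases le_or_gt s (meet u v) with h1 | h1
    · exact eq_of_le_meet h1
    · have := h (s - meet u v) (by linarith) (by linarith)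
      simpa using this
  linarith

instance : MetricSpace (ReducedPath X) where
  dist u v := u.len + v.len - 2 * meet u v
  dist_self u := by rw [meet_self]; ring
  dist_comm u v := by rw [meet_comm]; ring
  dist_triangle u v w := by
    have h := min_meet_le u v w
    have h1 := meet_le_right u v
    have h2 := meet_le_left v w
    rcases min_le_iff.1 h with h | h <;> linarith
  eq_of_dist_eq_zero {u v} h := by
    have h1 := meet_le_left u v
    have h2 := meet_le_right u v
    have h : u.len + v.len - 2 * meet u v = 0 := h
    have hl : u.len = v.len := by linarith
    refine ext_of_eq hl fun t => ?_
    rcases le_or_gt t (meet u v) with ht | ht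
    · exact eq_of_le_meet ht
    · rw [u.eq_top t (by linarith), v.eq_top t (by linarith), ← hl]
      exact eq_of_le_meet (by linarith)

theorem dist_def (u v : ReducedPath X) : dist u v = u.len + v.len - 2 * meet u v := rfl

theorem zeroHyp : ZeroHyp (ReducedPath X) := by
  intro p x y z
  have h1 := min_meet_le x p y
  have h2 := min_meet_le x z y
  have h3 := min_meet_le x p z
  have h4 := min_meet_le x y z
  have h5 := min_meet_le x y p
  have h6 := min_meet_le x z p
  have h7 := min_meet_le y x z
  have h8 := min_meet_le y p z
  have h9 := min_meet_le y x p
  have h10 := min_meet_le y z p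
  have h11 := min_meet_le z x p
  have h12 := min_meet_le z y p
  simp only [dist_def]
  rw [meet_comm p y, meet_comm p z, meet_comm y x, meet_comm z y, meet_comm z x] at *
  simp only [min_le_iff] at *
  by_contra! h
  obtain ⟨ha, hb⟩ := h
  grind

/-- The constant path. -/
def nil : ReducedPath X where
  len := 0
  toFun _ := 0
  len_nonneg := le_rfl
  lip s t := by simp
  eq_zero _ _ := rfl
  eq_top _ _ := rfl
  reduced x h1 h2 := absurd h1 h2.not_gt

theorem meet_nil (u : ReducedPath X) : meet nil u = 0 :=
  le_antisymm (meet_le_left _ _) (meet_nonneg _ _)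

theorem dist_nil (u : ReducedPath X) : dist nil u = u.len := by
  rw [dist_def, meet_nil]; simp [nil]

theorem norm_toFun_sub_le (u v : ReducedPath X) (t : ℝ) :
    ‖u.toFun t - v.toFun t‖ ≤ dist u v := by
  rcases le_or_gt t (meet u v) with ht | ht
  · rw [eq_of_le_meet ht]; simp
  · have key : ∀ w : ReducedPath X, meet u v ≤ w.len →
        ‖w.toFun t - w.toFun (meet u v)‖ ≤ w.len - meet u v := fun w hw => by
      rcases le_or_gt t w.len with h | h
      · have := w.lip t (meet u v)
        rw [abs_of_pos (by linarith)] at this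
        linarith
      · rw [w.eq_top t h.le]
        have := w.lip w.len (meet u v)
        rwa [abs_of_nonneg (by linarith)] at this
    have h1 := key u (meet_le_left _ _)
    have h2 := key v (meet_le_right _ _)
    rw [eq_of_le_meet (le_refl (meet u v))] at h1
    have := norm_sub_le (u.toFun t - v.toFun (meet u v)) (v.toFun t - v.toFun (meet u v))
    rw [sub_sub_sub_cancel_right] at this
    rw [dist_def]
    linarith

theorem tip_eq {u : ReducedPath X} {t : ℝ} (h : u.len ≤ t) : u.tip = u.toFun t :=
  (u.eq_top t h).symm

theorem norm_tip_sub_le (u v : ReducedPath X) : ‖u.tip - v.tip‖ ≤ dist u v := by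
  rw [tip_eq (le_max_left u.len v.len), tip_eq (le_max_right u.len v.len)]
  exact norm_toFun_sub_le _ _ _

/-- The initial segment of length `a`. -/
def initSeg (u : ReducedPath X) (a : ℝ) (h0 : 0 ≤ a) (ha : a ≤ u.len) : ReducedPath X where
  len := a
  toFun t := u.toFun (min t a)
  len_nonneg := h0
  lip s t := (u.lip _ _).trans (abs_min_sub_min_le_max s a t a |>.trans (by simp))
  eq_zero t ht := u.eq_zero _ (min_le_of_left_le ht)
  eq_top t ht := by rw [min_eq_right ht, min_self]
  reduced x hx hxa ε hε := by
    obtain ⟨t, ht, hte, h⟩ := u.reduced x hx (by linarith) (min ε (a - x))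
      (lt_min hε (by linarith))
    rw [lt_min_iff] at hte
    refine ⟨t, ht, hte.1, ?_⟩
    rwa [min_eq_left (by linarith), min_eq_left (by linarith)]

theorem tip_initSeg (u : ReducedPath X) (a : ℝ) (h0 : 0 ≤ a) (ha : a ≤ u.len) :
    (u.initSeg a h0 ha).tip = u.toFun a := by
  simp [tip, initSeg]

theorem dist_initSeg (u : ReducedPath X) {a b : ℝ} (h0 : 0 ≤ a) (hab : a ≤ b) (hb : b ≤ u.len) :
    dist (u.initSeg a h0 (hab.trans hb)) (u.initSeg b (h0.trans hab) hb) = b - a := by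
  have : meet (u.initSeg a h0 (hab.trans hb)) (u.initSeg b (h0.trans hab) hb) = a :=
    le_antisymm (meet_le_left _ _) (le_meet le_rfl hab fun s hs => by
      simp only [initSeg]
      rw [min_eq_left hs, min_eq_left (hs.trans hab)])
  rw [dist_def, this]
  simp only [initSeg]
  ring

theorem initSeg_len (u : ReducedPath X) : u.initSeg u.len u.len_nonneg le_rfl = u :=
  ext_of_eq rfl fun t => by
    simp only [initSeg]
    rcases le_total t u.len with h | h
    · rw [min_eq_left h]
    · rw [min_eq_right h, u.eq_top t h]

theorem dist_initSeg_self (u : ReducedPath X) {a : ℝ} (h0 : 0 ≤ a) (ha : a ≤ u.len) :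
    dist (u.initSeg a h0 ha) u = u.len - a := by
  have := u.dist_initSeg h0 ha le_rfl
  rwa [initSeg_len] at this

/-- A point between the base point and `u` is an initial segment of `u`. -/
theorem toFun_eq_tip_of_between {u w : ReducedPath X} (h : w.len + dist w u = u.len) :
    u.toFun w.len = w.tip := by
  rw [dist_def] at h
  exact (eq_of_le_meet (by linarith)).symm

theorem eq_of_isometry {g : ReducedPath X → ReducedPath X} (hg : Isometry g) (h0 : g nil = nil)
    (ht : ∀ u, (g u).tip = u.tip) (u : ReducedPath X) : g u = u := by
  have hlen : ∀ u, (g u).len = u.len := fun u => by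
    rw [← dist_nil, ← dist_nil u, ← hg.dist_eq nil u, h0]
  refine ext_of_eq (hlen u) fun t => ?_
  rcases le_or_gt t 0 with h | h
  · rw [eq_zero _ _ h, eq_zero _ _ h]
  rcases le_or_gt t u.len with h2 | h2
  · have := toFun_eq_tip_of_between (u := g u) (w := g (u.initSeg t h.le h2)) (by
      rw [hg.dist_eq, hlen, hlen, dist_initSeg_self]; simp [initSeg])
    rw [hlen, ht, tip_initSeg] at this
    exact this
  · rw [← tip_eq (by rw [hlen]; exact h2.le), ht, tip_eq h2.le]

/-- The reduced path that travels from the endpoint of `u` to the endpoint of `v`. -/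
def reroot (u v : ReducedPath X) : ReducedPath X where
  len := u.len + v.len - 2 * meet u v
  toFun t := if t ≤ u.len - meet u v then u.toFun (u.len - t) - u.tip
    else v.toFun (t - u.len + 2 * meet u v) - u.tip
  len_nonneg := by
    have h1 := meet_le_left u v
    have h2 := meet_le_right u v
    linarith
  lip s t := by
    wlog hst : s ≤ t generalizing s t
    · rw [norm_sub_rev, abs_sub_comm]
      exact this t s (by linarith)
    have hm := eq_of_le_meet (le_refl (meet u v))
    split_ifs with h1 h2 h2
    · rw [sub_sub_sub_cancel_right]
      refine (u.lip _ _).trans (le_of_eq ?_)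
      rw [abs_sub_comm]; congr 1; ring
    · rw [sub_sub_sub_cancel_right]
      have e1 := u.lip (u.len - s) (meet u v)
      have e2 := v.lip (meet u v) (t - u.len + 2 * meet u v)
      rw [hm] at e1
      rw [abs_of_nonneg (by linarith)] at e1
      rw [abs_of_nonpos (by linarith)] at e2
      rw [abs_of_nonpos (by linarith)]
      have := norm_sub_le_norm_sub_add_norm_sub (u.toFun (u.len - s)) (v.toFun (meet u v))
        (v.toFun (t - u.len + 2 * meet u v))
      linarith
    · linarith
    · rw [sub_sub_sub_cancel_right]
      refine (v.lip _ _).trans (le_of_eq ?_)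
      congr 1; ring
  eq_zero t ht := by
    have h1 := meet_le_left u v
    rw [if_pos (by linarith), tip, u.eq_top _ (by linarith), sub_self]
  eq_top t ht := by
    have h1 := meet_le_left u v
    have h2 := meet_le_right u v
    have hm := eq_of_le_meet (le_refl (meet u v))
    split_ifs with h3 h4 h4
    · have e1 : t = u.len - meet u v := by linarith
      have e2 : u.len + v.len - 2 * meet u v = t := by linarith
      rw [e2]
    · linarith
    · have e : v.len = meet u v := by linarith
      rw [v.eq_top _ (by linarith), e, show u.len - (u.len + meet u v - 2 * meet u v) = meet u v by
        ring, hm]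
    · rw [v.eq_top _ (by linarith), v.eq_top (_ - _ + _) (by linarith)]
  reduced x hx hxl ε hε := by
    have h1 := meet_le_left u v
    have h2 := meet_le_right u v
    have h0 := meet_nonneg u v
    rcases lt_trichotomy x (u.len - meet u v) with h | h | h
    · obtain ⟨t, ht, hte, hne⟩ := u.reduced (u.len - x) (by linarith) (by linarith)
        (min ε (u.len - meet u v - x)) (lt_min hε (by linarith))
      rw [lt_min_iff] at hte
      refine ⟨t, ht, hte.1, ?_⟩
      rw [if_pos (by linarith), if_pos (by linarith), Ne, sub_left_inj,
        show u.len - (x - t) = u.len - x + t by ring, show u.len - (x + t) = u.len - x - t by ring]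
      exact hne.symm
    · obtain ⟨t, ht, hte, hne⟩ := exists_ne_of_meet_lt (u := u) (v := v) (by linarith)
        (by linarith) hε
      refine ⟨t, ht, hte, ?_⟩
      rw [if_pos (by linarith), if_neg (by linarith), Ne, sub_left_inj,
        show u.len - (x - t) = meet u v + t by linarith,
        show x + t - u.len + 2 * meet u v = meet u v + t by linarith]
      exact hne
    · obtain ⟨t, ht, hte, hne⟩ := v.reduced (x - u.len + 2 * meet u v) (by linarith) (by linarith)
        (min ε (x - (u.len - meet u v))) (lt_min hε (by linarith))
      rw [lt_min_iff] at hte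
      refine ⟨t, ht, hte.1, ?_⟩
      rw [if_neg (by linarith), if_neg (by linarith), Ne, sub_left_inj,
        show x - t - u.len + 2 * meet u v = x - u.len + 2 * meet u v - t by ring,
        show x + t - u.len + 2 * meet u v = x - u.len + 2 * meet u v + t by ring]
      exact hne

theorem reroot_len (u v : ReducedPath X) : (reroot u v).len = u.len + v.len - 2 * meet u v := rfl

theorem reroot_toFun_of_le {u v : ReducedPath X} {t : ℝ} (h : t ≤ u.len - meet u v) :
    (reroot u v).toFun t = u.toFun (u.len - t) - u.tip := if_pos h

theorem reroot_toFun_of_ge {u v : ReducedPath X} {t : ℝ} (h : u.len - meet u v ≤ t) :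
    (reroot u v).toFun t = v.toFun (t - u.len + 2 * meet u v) - u.tip := by
  rcases h.eq_or_lt with h | h
  · rw [reroot_toFun_of_le h.ge, ← h, show u.len - (u.len - meet u v) = meet u v by ring,
      show u.len - meet u v - u.len + 2 * meet u v = meet u v by ring, eq_of_le_meet le_rfl]
  · exact if_neg h.not_ge

theorem tip_reroot (u v : ReducedPath X) : (reroot u v).tip = v.tip - u.tip := by
  rw [tip, reroot_len, reroot_toFun_of_ge (by linarith [meet_le_right u v])]
  congr 2
  ring

theorem reroot_self (u : ReducedPath X) : reroot u u = nil := by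
  have hl : (reroot u u).len = 0 := by rw [reroot_len, meet_self]; ring
  refine ext_of_eq hl fun t => ?_
  rcases le_total t 0 with h | h
  · rw [eq_zero _ _ h, eq_zero _ _ h]
  · rw [eq_top _ t (by rwa [hl]), hl, eq_zero _ _ le_rfl]; rfl

theorem meet_reroot_of_lt {u v w : ReducedPath X} (h : meet u w < meet u v) :
    meet (reroot u v) (reroot u w) = u.len - meet u v := by
  have h1 := meet_le_left u v
  have h2 := meet_le_right u v
  have h3 := meet_le_right u w
  have h0 := meet_nonneg u w
  apply le_antisymm
  · refine csSup_le ⟨0, zero_mem_agreeSet _ _⟩ fun t ht => ?_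
    obtain ⟨ht1, -, ht3⟩ := ht
    rw [reroot_len] at ht1
    by_contra! hc
    obtain ⟨r, hr, hre, hne⟩ := v.reduced (meet u v) (by linarith) (by linarith)
      (min (t - (u.len - meet u v)) (meet u v - meet u w)) (lt_min (by linarith) (by linarith))
    rw [lt_min_iff] at hre
    have := ht3 (u.len - meet u v + r) (by linarith)
    rw [reroot_toFun_of_ge (by linarith), reroot_toFun_of_le (by linarith), sub_left_inj,
      show u.len - meet u v + r - u.len + 2 * meet u v = meet u v + r by ring,
      show u.len - (u.len - meet u v + r) = meet u v - r by ring,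
      eq_of_le_meet (u := u) (v := v) (by linarith)] at this
    exact hne this.symm
  · refine le_meet (by rw [reroot_len]; linarith) (by rw [reroot_len]; linarith) fun s hs => ?_
    rw [reroot_toFun_of_le hs, reroot_toFun_of_le (by linarith)]

theorem meet_reroot_of_eq {u v w : ReducedPath X} (h : meet u v = meet u w)
    (h' : meet u v ≤ meet v w) :
    meet (reroot u v) (reroot u w) = u.len - 2 * meet u v + meet v w := by
  have h1 := meet_le_left v w
  have h2 := meet_le_right v w
  apply le_antisymm
  · refine csSup_le ⟨0, zero_mem_agreeSet _ _⟩ fun t ht => ?_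
    obtain ⟨ht1, ht2, ht3⟩ := ht
    rw [reroot_len] at ht1 ht2
    have := le_meet (u := v) (v := w) (t := t - u.len + 2 * meet u v) (by linarith) (by linarith)
      fun s hs => by
        rcases le_or_gt s (meet v w) with hs2 | hs2
        · exact eq_of_le_meet hs2
        · have := ht3 (s + u.len - 2 * meet u v) (by linarith)
          rw [reroot_toFun_of_ge (by linarith), reroot_toFun_of_ge (by linarith), sub_left_inj,
            ← h, show s + u.len - 2 * meet u v - u.len + 2 * meet u v = s by ring] at this
          exact this
    linarith
  · refine le_meet (by rw [reroot_len]; linarith) (by rw [reroot_len]; linarith) fun s hs => ?_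
    rcases le_or_gt s (u.len - meet u v) with hs2 | hs2
    · rw [reroot_toFun_of_le hs2, reroot_toFun_of_le (by linarith)]
    · rw [reroot_toFun_of_ge hs2.le, reroot_toFun_of_ge (by linarith), ← h,
        eq_of_le_meet (v := w) (by linarith)]

theorem isometry_reroot (u : ReducedPath X) : Isometry (reroot u) := by
  refine Isometry.of_dist_eq fun v w => ?_
  rw [dist_def, dist_def, reroot_len, reroot_len]
  have h1 := min_meet_le u v w
  have h2 := min_meet_le u w v
  have h3 := min_meet_le v u w
  rw [meet_comm w v] at h2
  rw [meet_comm v u] at h3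
  simp only [min_le_iff] at h1 h2 h3
  rcases lt_trichotomy (meet u v) (meet u w) with h | h | h
  · rw [meet_comm (reroot u v), meet_reroot_of_lt h]
    grind
  · rw [meet_reroot_of_eq h (by grind), ← h]
    grind
  · rw [meet_reroot_of_lt h]
    grind

theorem reroot_reroot (u v : ReducedPath X) : reroot (reroot u nil) (reroot u v) = v := by
  refine eq_of_isometry (g := fun v => reroot (reroot u nil) (reroot u v))
    ((isometry_reroot _).comp (isometry_reroot _)) (reroot_self _) (fun v => ?_) v
  have : (nil : ReducedPath X).tip = 0 := rfl
  simp only [tip_reroot, this]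
  abel

theorem reroot_reroot' (u v : ReducedPath X) : reroot u (reroot (reroot u nil) v) = v := by
  have h : reroot (reroot u nil) nil = u := by
    have := reroot_reroot u u
    rwa [reroot_self] at this
  have := reroot_reroot (reroot u nil) v
  rwa [h] at this

/-- Moving the base point to `u` is an isometry. -/
def rerootEquiv (u : ReducedPath X) : ReducedPath X ≃ᵢ ReducedPath X where
  toFun := reroot u
  invFun := reroot (reroot u nil)
  left_inv := reroot_reroot u
  right_inv := reroot_reroot' u
  isometry_toFun := isometry_reroot u

/-- Isometries that translate endpoints by a constant. -/
def TranslatesTips (g : ReducedPath X ≃ᵢ ReducedPath X) : Prop :=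
  ∃ c, ∀ u, (g u).tip = u.tip + c

theorem exists_translatesTips_apply_eq (u v : ReducedPath X) :
    ∃ g : ReducedPath X ≃ᵢ ReducedPath X, TranslatesTips g ∧ g u = v := by
  refine ⟨(rerootEquiv u).trans (rerootEquiv v).symm, ⟨v.tip - u.tip, fun w => ?_⟩, ?_⟩
  · change (reroot (reroot v nil) (reroot u w)).tip = _
    simp only [tip_reroot]
    simp only [nil, tip]
    abel
  · rw [IsometryEquiv.trans_apply, IsometryEquiv.symm_apply_eq]
    change reroot u u = reroot v v
    rw [reroot_self, reroot_self]

theorem TranslatesTips.eq_one {g : ReducedPath X ≃ᵢ ReducedPath X} (hg : TranslatesTips g)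
    {u : ReducedPath X} (hu : g u = u) : g = 1 := by
  obtain ⟨c, hc⟩ := hg
  have hc0 : c = 0 := by simpa [hu] using hc u
  have key : ∀ v, rerootEquiv u (g ((rerootEquiv u).symm v)) = v := by
    refine eq_of_isometry (g := fun v => rerootEquiv u (g ((rerootEquiv u).symm v)))
      ((rerootEquiv u).isometry.comp (g.isometry.comp (rerootEquiv u).symm.isometry)) ?_ ?_
    · have : (rerootEquiv u).symm nil = u := by
        rw [IsometryEquiv.symm_apply_eq]; exact (reroot_self u).symm
      rw [this, hu]
      exact reroot_self u
    · intro v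
      change (reroot u (g ((rerootEquiv u).symm v))).tip = _
      rw [tip_reroot, hc, hc0, add_zero, ← tip_reroot]
      change (rerootEquiv u ((rerootEquiv u).symm v)).tip = _
      rw [IsometryEquiv.apply_symm_apply]
  ext v
  have := key (rerootEquiv u v)
  rw [IsometryEquiv.symm_apply_apply] at this
  exact (rerootEquiv u).injective this

theorem geodesicSpace : GeodesicSpace (ReducedPath X) := by
  intro x y
  obtain ⟨g, -, hg⟩ := exists_translatesTips_apply_eq x nil
  set w := g y with hw
  have hd : dist x y = w.len := by rw [← dist_nil, hw, ← hg, g.dist_eq]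
  have hclamp : ∀ s ∈ Set.Icc 0 w.len, min (max s 0) w.len = s := fun s hs => by
    rw [max_eq_left hs.1, min_eq_left hs.2]
  refine ⟨fun s => g.symm (w.initSeg (min (max s 0) w.len)
    (le_min (le_max_right _ _) w.len_nonneg) (min_le_right _ _)), ?_, ?_, ?_⟩
  · rw [IsometryEquiv.symm_apply_eq, hg, eq_comm, ← dist_eq_zero, dist_nil]
    simp [initSeg, w.len_nonneg]
  · rw [IsometryEquiv.symm_apply_eq, ← hw, ← dist_eq_zero, dist_initSeg_self, hd]
    simp [w.len_nonneg]
  · intro s hs t ht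
    rw [hd] at hs ht
    rw [g.symm.dist_eq]
    wlog hst : s ≤ t generalizing s t
    · rw [dist_comm, abs_sub_comm]
      exact this t ht s hs (by linarith)
    have e1 := hclamp s hs
    have e2 := hclamp t ht
    rw [w.dist_initSeg _ (by rw [e1, e2]; exact hst) (min_le_right _ _), e1, e2, abs_sub_comm,
      abs_of_nonneg (by linarith)]

theorem isRTree : IsRTree (ReducedPath X) := ⟨geodesicSpace, zeroHyp⟩

/-- Endpoints are not constant along nontrivial geodesics. -/
theorem exists_between_tip_ne {u v : ReducedPath X} (h : u ≠ v) :
    ∃ w, dist u w + dist w v = dist u v ∧ w.tip ≠ u.tip := by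
  obtain ⟨g, ⟨c, hc⟩, hg⟩ := exists_translatesTips_apply_eq u nil
  set z := g v with hz
  have hd : dist u v = z.len := by rw [← dist_nil, hz, ← hg, g.dist_eq]
  have hpos : 0 < z.len := by rw [← hd]; exact dist_pos.2 h
  obtain ⟨t, ht0, ht1, ht⟩ : ∃ t, 0 ≤ t ∧ t ≤ z.len ∧ z.toFun t ≠ 0 := by
    by_contra! hcon
    obtain ⟨t, ht, hte, hne⟩ := z.reduced (z.len / 2) (by linarith) (by linarith) (z.len / 2)
      (by linarith)
    exact hne ((hcon _ (by linarith) (by linarith)).trans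
      (hcon _ (by linarith) (by linarith)).symm)
  refine ⟨g.symm (z.initSeg t ht0 ht1), ?_, fun hcon => ht ?_⟩
  · rw [← g.dist_eq, ← g.dist_eq (g.symm _), g.apply_symm_apply, hg, ← hz, dist_nil,
      dist_initSeg_self, hd]
    simp [initSeg]
  · have h1 := hc (g.symm (z.initSeg t ht0 ht1))
    rw [g.apply_symm_apply, hcon, ← hc, hg, tip_initSeg] at h1
    exact h1

theorem completeSpace [CompleteSpace X] : CompleteSpace (ReducedPath X) := by
  refine Metric.complete_of_cauchySeq_tendsto fun u hu => ?_
  rw [Metric.cauchySeq_iff'] at hu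
  have hlen_le : ∀ a b : ReducedPath X, |a.len - b.len| ≤ dist a b := fun a b => by
    rw [dist_def, abs_le]
    constructor <;> linarith [meet_le_left a b, meet_le_right a b]
  have hlc : CauchySeq fun n => (u n).len := Metric.cauchySeq_iff'.2 fun ε hε => by
    obtain ⟨N, hN⟩ := hu ε hε
    exact ⟨N, fun n hn => (hlen_le _ _).trans_lt (hN n hn)⟩
  have hfc : ∀ t, CauchySeq fun n => (u n).toFun t := fun t => Metric.cauchySeq_iff'.2 fun ε hε => by
    obtain ⟨N, hN⟩ := hu ε hε
    refine ⟨N, fun n hn => ?_⟩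
    rw [dist_eq_norm]
    exact (norm_toFun_sub_le _ _ _).trans_lt (hN n hn)
  obtain ⟨L, hL⟩ := cauchySeq_tendsto_of_complete hlc
  choose f hf using fun t => cauchySeq_tendsto_of_complete (hfc t)
  have hL0 : 0 ≤ L := ge_of_tendsto' hL fun n => (u n).len_nonneg
  have stab : ∀ ε > 0, ∃ N, ∀ n ≥ N, |(u n).len - L| ≤ ε ∧
      ∀ s ≤ (u n).len - ε, f s = (u n).toFun s := fun ε hε => by
    obtain ⟨N, hN⟩ := hu (ε / 2) (by linarith)
    have hd : ∀ n ≥ N, ∀ k ≥ N, dist (u n) (u k) ≤ ε := fun n hn k hk => by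
      have := dist_triangle_right (u n) (u k) (u N)
      linarith [hN n hn, hN k hk]
    refine ⟨N, fun n hn => ⟨?_, fun s hs => ?_⟩⟩
    · refine le_of_tendsto ((tendsto_const_nhds.sub hL).abs) ?_
      filter_upwards [Filter.eventually_ge_atTop N] with k hk
      exact (hlen_le _ _).trans (hd n hn k hk)
    · refine tendsto_nhds_unique (hf s) (tendsto_const_nhds.congr' ?_)
      filter_upwards [Filter.eventually_ge_atTop N] with k hk
      refine eq_of_le_meet ?_
      have h1 := hd n hn k hk
      have h2 := (abs_le.1 ((hlen_le (u n) (u k)).trans h1)).2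
      rw [dist_def] at h1
      linarith
  have hlip : ∀ s t, ‖f s - f t‖ ≤ |s - t| := fun s t =>
    le_of_tendsto' ((hf s).sub (hf t)).norm fun n => (u n).lip s t
  have htop : ∀ t, L ≤ t → f t = f L := fun t ht => by
    rw [← sub_eq_zero, ← norm_eq_zero]
    refine le_antisymm (le_of_tendsto_of_tendsto' ((hf t).sub (hf L)).norm
      (g := fun n => |(u n).len - L|) ?_ fun n => ?_) (norm_nonneg _)
    · simpa using (hL.sub_const L).abs
    · rcases le_total (u n).len L with h | h
      · rw [(u n).eq_top t (h.trans ht), (u n).eq_top L h]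
        simp
      · rcases le_total t (u n).len with h' | h'
        · refine ((u n).lip t L).trans (abs_le_abs_of_nonneg ?_ ?_) <;> linarith
        · rw [(u n).eq_top t h']
          exact (u n).lip _ _
  have hred : ∀ x, 0 < x → x < L → ∀ ε > 0, ∃ t, 0 < t ∧ t < ε ∧ f (x - t) ≠ f (x + t) := by
    intro x hx hxL ε hε
    obtain ⟨N, hN⟩ := stab ((L - x) / 4) (by linarith)
    obtain ⟨h1, h2⟩ := hN N le_rfl
    rw [abs_le] at h1
    obtain ⟨t, ht, hte, hne⟩ := (u N).reduced x hx (by linarith) (min ε ((L - x) / 4))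
      (lt_min hε (by linarith))
    rw [lt_min_iff] at hte
    refine ⟨t, ht, hte.1, ?_⟩
    rwa [h2 _ (by linarith), h2 _ (by linarith)]
  have hzero : ∀ t ≤ 0, f t = 0 := fun t ht =>
    tendsto_nhds_unique (hf t) (tendsto_const_nhds.congr fun n => by rw [(u n).eq_zero t ht])
  refine ⟨⟨L, f, hL0, hlip, hzero, htop, hred⟩, ?_⟩
  rw [Metric.tendsto_atTop]
  intro ε hε
  obtain ⟨N, hN⟩ := stab (ε / 8) (by linarith)
  refine ⟨N, fun n hn => ?_⟩
  obtain ⟨h1, h2⟩ := hN n hn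
  rw [abs_le] at h1
  rw [dist_def]
  have := le_meet (u := u n) (v := ⟨L, f, hL0, hlip, hzero, htop, hred⟩) (t := (u n).len - ε / 8 - ε / 8)
    (by linarith) (by simp only; linarith) fun s hs => (h2 s (by linarith)).symm
  simp only at this ⊢
  linarith

theorem mk_le_continuum (hX : #X ≤ continuum) : #(ReducedPath X) ≤ continuum := by
  have hinj : Function.Injective
      (fun u : ReducedPath X => ((u.len, fun q : ℚ => u.toFun q) : ℝ × (ℚ → X))) := by
    intro u v h
    simp only [Prod.mk.injEq] at h
    refine ext_of_eq h.1 fun t => congrFun (Rat.denseRange_cast.equalizer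
      u.continuous_toFun v.continuous_toFun (funext fun q => congrFun h.2 q)) t
  calc #(ReducedPath X) ≤ #(ℝ × (ℚ → X)) := mk_le_of_injective hinj
    _ = continuum * #X ^ ℵ₀ := by simp [mk_prod, mk_real]
    _ ≤ continuum * continuum ^ ℵ₀ := mul_le_mul_right (power_le_power_right hX) _
    _ = continuum := by simp

end Basic

section Rays

variable {X : Type} [NormedAddCommGroup X] [NormedSpace ℝ X]

/-- The straight path of length `n` with velocity `e`. -/
def ray (n : ℝ) (hn : 0 ≤ n) (e : X) (h1 : ‖e‖ ≤ 1) (h0 : e ≠ 0) : ReducedPath X where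
  len := n
  toFun t := min (max t 0) n • e
  len_nonneg := hn
  lip s t := by
    rw [← sub_smul, norm_smul]
    have h2 : |min (max s 0) n - min (max t 0) n| ≤ |s - t| :=
      (abs_min_sub_min_le_max _ _ _ _).trans
        (by simpa using abs_max_sub_max_le_abs s t 0)
    calc _ ≤ |s - t| * 1 := mul_le_mul h2 h1 (norm_nonneg _) (abs_nonneg _)
      _ = _ := mul_one _
  eq_zero t ht := by simp [ht, hn]
  eq_top t ht := by simp [ht, hn, hn.trans ht]
  reduced x hx hxn ε hε := by
    obtain ⟨t, ht, ht2⟩ := exists_between (show 0 < min ε (min x (n - x)) by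
      simp only [lt_min_iff]; exact ⟨hε, hx, by linarith⟩)
    simp only [lt_min_iff] at ht2
    refine ⟨t, ht, ht2.1, fun h => ?_⟩
    rw [max_eq_left (by linarith), max_eq_left (by linarith), min_eq_left (by linarith),
      min_eq_left (by linarith)] at h
    have := smul_left_injective ℝ h0 h
    linarith

theorem tip_ray {n : ℝ} (hn : 0 ≤ n) {e : X} (h1 : ‖e‖ ≤ 1) (h0 : e ≠ 0) :
    (ray n hn e h1 h0).tip = n • e := by
  simp [tip, ray, hn]

theorem dist_ray {n : ℝ} (hn : 0 ≤ n) {e e' : X} (h1 : ‖e‖ ≤ 1) (h0 : e ≠ 0) (h1' : ‖e'‖ ≤ 1)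
    (h0' : e' ≠ 0) (hne : e ≠ e') :
    dist (ray n hn e h1 h0) (ray n hn e' h1' h0') = 2 * n := by
  have : meet (ray n hn e h1 h0) (ray n hn e' h1' h0') = 0 := by
    refine le_antisymm ?_ (meet_nonneg _ _)
    by_contra! h
    have h2 := eq_of_le_meet (le_refl (meet (ray n hn e h1 h0) (ray n hn e' h1' h0')))
    have h3 := meet_le_left (ray n hn e h1 h0) (ray n hn e' h1' h0')
    revert h2
    generalize meet (ray n hn e h1 h0) (ray n hn e' h1' h0') = m at *
    intro h2
    have h3 : m ≤ n := h3
    simp only [ray] at h2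
    rw [max_eq_left h.le, min_eq_left h3] at h2
    exact hne (smul_right_injective X h.ne' h2)
  rw [dist_def, this]
  simp only [ray]
  ring

end Rays

end ReducedPath

section Valence

variable {T : Type} [MetricSpace T]

/-- In a `0`-hyperbolic space, points `y`, `z` with `x` between them are in different components
of the complement of `x`. -/
theorem ZeroHyp.components_ne (hT : ZeroHyp T) {x : T} {y z : {y : T // y ≠ x}}
    (h : dist y.1 x + dist z.1 x = dist y.1 z.1) :
    (y : ConnectedComponents {y : T // y ≠ x}) ≠ z := by
  set U : Set {y : T // y ≠ x} := {w | 0 < dist y.1 x + dist w.1 x - dist y.1 w.1} with hU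
  have hopen : IsOpen U := isOpen_lt continuous_const (by fun_prop)
  have hclosed : IsClosed U := by
    rw [← isOpen_compl_iff, Metric.isOpen_iff]
    intro w hw
    have hwx : 0 < dist w.1 x := dist_pos.2 w.2
    refine ⟨dist w.1 x, hwx, fun w' hw' hcon => hw ?_⟩
    rw [Metric.mem_ball, Subtype.dist_eq] at hw'
    have h1 := hT x y.1 w.1 w'.1
    simp only [hU, Set.mem_ofPred_eq] at hcon ⊢
    have h2 : 0 < dist w'.1 x := dist_pos.2 w'.2
    rcases min_le_iff.1 h1 with h1 | h1 <;> linarith [dist_nonneg (x := w'.1) (y := x)]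
  have hyU : y ∈ U := by
    simp only [hU, Set.mem_ofPred_eq, dist_self]
    linarith [dist_pos.2 y.2]
  intro hcon
  rw [eq_comm, ConnectedComponents.coe_eq_coe'] at hcon
  have := IsClopen.connectedComponent_subset ⟨hclosed, hopen⟩ hyU hcon
  simp only [hU, Set.mem_ofPred_eq] at this
  linarith

theorem ReducedPath.valence_eq {X : Type} [NormedAddCommGroup X] [NormedSpace ℝ X] [Nontrivial X]
    (hX : #X ≤ continuum) (x : ReducedPath X) : valence (ReducedPath X) x = continuum := by
  apply le_antisymm
  · exact (mk_le_of_surjective ConnectedComponents.surjective_coe).trans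
      ((mk_subtype_le _).trans (mk_le_continuum hX))
  · obtain ⟨e, he⟩ := exists_norm_eq X zero_le_one
    have he0 : e ≠ 0 := by rintro rfl; simp at he
    obtain ⟨g, -, hg⟩ := exists_translatesTips_apply_eq nil x
    have hc1 : ∀ c : Set.Ioc (0 : ℝ) 1, ‖(c : ℝ) • e‖ ≤ 1 := fun c => by
      rw [norm_smul, he, mul_one, Real.norm_of_nonneg c.2.1.le]; exact c.2.2
    have hc0 : ∀ c : Set.Ioc (0 : ℝ) 1, (c : ℝ) • e ≠ 0 := fun c =>
      smul_ne_zero c.2.1.ne' he0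
    set r : Set.Ioc (0 : ℝ) 1 → ReducedPath X := fun c => ray 1 zero_le_one _ (hc1 c) (hc0 c)
    have hd : ∀ c, dist (g (r c)) x = 1 := fun c => by
      rw [← hg, g.dist_eq, dist_comm, dist_nil]; rfl
    have hne : ∀ c, g (r c) ≠ x := fun c => dist_pos.1 (by rw [hd]; exact one_pos)
    have hinj : Function.Injective (fun c => ((⟨g (r c), hne c⟩ : {y // y ≠ x}) :
        ConnectedComponents {y // y ≠ x})) := by
      intro c c' h
      by_contra hcc
      refine zeroHyp.components_ne ?_ h
      simp only [hd, g.dist_eq]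
      rw [dist_ray zero_le_one (hc1 c) (hc0 c) (hc1 c') (hc0 c')
        fun h => hcc (Subtype.ext (smul_left_injective ℝ he0 h))]
      norm_num
    have := mk_le_of_injective hinj
    rwa [Cardinal.mk_Ioc_real zero_lt_one] at this

end Valence

section Axis

variable {T : Type} [MetricSpace T]

/-- `x` is moved by `p` along an axis. -/
def OnAxis (p : T ≃ᵢ T) (x : T) : Prop :=
  0 < dist x (p x) ∧ dist x (p (p x)) = 2 * dist x (p x)

/-- An isometry of an `ℝ`-tree without fixed points translates some point along an axis. -/
theorem IsRTree.exists_axis_point (hT : IsRTree T) (p : T ≃ᵢ T) (hp : ∀ x, p x ≠ x) (o : T) :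
    ∃ x, OnAxis p x := by
  obtain ⟨γ, h0, h1, hγ⟩ := hT.1 o (p o)
  have hpos : 0 ≤ dist o (p o) := dist_nonneg
  have hm : dist o (p o) / 2 ∈ Set.Icc 0 (dist o (p o)) := ⟨by linarith, by linarith⟩
  have e1 := hγ _ ⟨le_rfl, hpos⟩ _ hm
  have e2 := hγ _ hm _ ⟨hpos, le_rfl⟩
  rw [h0, abs_of_nonpos (by linarith)] at e1
  rw [h1, abs_of_nonpos (by linarith)] at e2
  set m := γ (dist o (p o) / 2)
  refine ⟨m, dist_pos.2 (hp m).symm, ?_⟩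
  have e3 : dist (p o) (p m) = dist o (p o) / 2 := by rw [p.dist_eq]; linarith
  have e4 : dist (p m) (p (p o)) = dist o (p o) / 2 := by rw [p.dist_eq]; linarith
  have e5 : dist (p o) (p (p o)) = dist o (p o) := p.dist_eq _ _
  have e6 : dist (p m) (p (p m)) = dist m (p m) := p.dist_eq _ _
  have e7 : dist (p o) (p (p m)) = dist o (p m) := p.dist_eq _ _
  have hlt : 0 < dist m (p m) := dist_pos.2 (hp m).symm
  have a1 := hT.2 (p o) m (p m) o
  have a2 := hT.2 (p o) o (p m) (p (p o))
  have a3 := hT.2 (p o) o (p (p o)) m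
  have a4 := hT.2 (p o) m (p (p o)) (p m)
  have a6 := hT.2 (p m) (p o) (p (p m)) m
  have a7 := hT.2 (p o) o (p (p o)) (p m)
  have a8 := hT.2 (p o) m (p m) (p (p o))
  have t1 := dist_triangle m (p m) (p (p m))
  have t2 := dist_triangle (p o) m (p m)
  have t3 := dist_triangle o m (p m)
  have t4 := dist_triangle o (p o) (p (p o))
  simp only [min_le_iff, dist_comm (p m) (p o), dist_comm m (p o), dist_comm (p (p o)) (p o),
    dist_comm m o, dist_comm (p (p o)) (p m), dist_comm (p (p m)) (p m)] at *
  rw [e3, e5] at *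
  grind

theorem OnAxis.dist_pow (hT : ZeroHyp T) {p : T ≃ᵢ T} {x : T} (hx : OnAxis p x) (n : ℕ) :
    dist x ((p ^ n) x) = n * dist x (p x) := by
  obtain ⟨hpos, h2⟩ := hx
  have key : ∀ n : ℕ, dist x ((p ^ (n + 1)) x) = (n + 1) * dist x (p x) ∧
      dist x ((p ^ (n + 2)) x) = (n + 2) * dist x (p x) := by
    intro n
    induction n with
    | zero => simpa [pow_succ, IsometryEquiv.mul_apply] using h2
    | succ n ih =>
      obtain ⟨ih1, ih2⟩ := ih
      refine ⟨by rw [add_assoc]; convert ih2 using 2; push_cast; ring, ?_⟩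
      have e : ∀ k, (p ^ (k + 1)) x = p ((p ^ k) x) := fun k => by
        rw [pow_succ', IsometryEquiv.mul_apply]
      have h1 := hT (p x) x ((p ^ (n + 2)) x) ((p ^ (n + 3)) x)
      have d1 : dist ((p ^ (n + 3)) x) (p x) = (n + 2) * dist x (p x) := by
        rw [e (n + 2), p.dist_eq, dist_comm, ih2]
      have d2 : dist ((p ^ (n + 2)) x) (p x) = (n + 1) * dist x (p x) := by
        rw [e (n + 1), p.dist_eq, dist_comm, ih1]
      have d3 : dist ((p ^ (n + 3)) x) ((p ^ (n + 2)) x) = dist x (p x) := by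
        rw [pow_succ p (n + 2), IsometryEquiv.mul_apply, IsometryEquiv.dist_eq, dist_comm]
      have t := dist_triangle x (p x) ((p ^ (n + 3)) x)
      rw [dist_comm (p x)] at t
      rw [show n + 1 + 2 = n + 3 by ring]
      push_cast
      have hn : 0 ≤ n * dist x (p x) := by positivity
      rcases min_le_iff.1 h1 with h1 | h1 <;> linarith
  rcases n with - | n
  · simp
  · rw [(key n).1]; push_cast; ring

theorem OnAxis.dist_zpow (hT : ZeroHyp T) {p : T ≃ᵢ T} {x : T} (hx : OnAxis p x) (i j : ℤ) :
    dist ((p ^ i) x) ((p ^ j) x) = |(i : ℝ) - j| * dist x (p x) := by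
  wlog hij : i ≤ j generalizing i j
  · rw [dist_comm, abs_sub_comm]
    exact this j i (by linarith)
  obtain ⟨n, rfl⟩ := Int.le.dest hij
  rw [zpow_add, IsometryEquiv.mul_apply, IsometryEquiv.dist_eq, zpow_natCast, hx.dist_pow hT]
  simp

/-- `y` is the point with coordinate `s` on the axis of `p` through `x`. -/
def AxisCoord (p : T ≃ᵢ T) (x : T) (s : ℝ) (y : T) : Prop :=
  ∃ N : ℕ, ∀ n : ℕ, N ≤ n → dist y ((p ^ (n : ℤ)) x) = n * dist x (p x) - s ∧
    dist y ((p ^ (-n : ℤ)) x) = n * dist x (p x) + s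

theorem OnAxis.axisCoord_of_le (hT : ZeroHyp T) {p : T ≃ᵢ T} {x : T} (hx : OnAxis p x) {s : ℝ}
    {y : T} {N M : ℕ} (h1 : dist y ((p ^ (N : ℤ)) x) ≤ N * dist x (p x) - s)
    (h2 : dist y ((p ^ (-M : ℤ)) x) ≤ M * dist x (p x) + s) : AxisCoord p x s y := by
  refine ⟨max N M, fun n hn => ?_⟩
  have hN : (N : ℝ) ≤ n := by exact_mod_cast (le_max_left _ _).trans hn
  have hM : (M : ℝ) ≤ n := by exact_mod_cast (le_max_right _ _).trans hn
  have t1 := dist_triangle y ((p ^ (N : ℤ)) x) ((p ^ (n : ℤ)) x)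
  have t2 := dist_triangle y ((p ^ (-M : ℤ)) x) ((p ^ (-n : ℤ)) x)
  have t3 := dist_triangle_left ((p ^ (n : ℤ)) x) ((p ^ (-n : ℤ)) x) y
  rw [hx.dist_zpow hT] at t1 t2 t3
  push_cast at t1 t2 t3
  rw [abs_of_nonpos (by linarith)] at t1
  rw [abs_of_nonneg (by linarith)] at t2
  rw [abs_of_nonneg (by linarith)] at t3
  constructor <;> linarith

theorem AxisCoord.dist_eq (hT : ZeroHyp T) {p : T ≃ᵢ T} {x : T} (hx : OnAxis p x) {s s' : ℝ}
    {y y' : T} (h : AxisCoord p x s y) (h' : AxisCoord p x s' y') : dist y y' = |s - s'| := by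
  wlog hs : s ≤ s' generalizing s s' y y'
  · rw [dist_comm, abs_sub_comm]
    exact this h' h (by linarith)
  obtain ⟨N, hN⟩ := h
  obtain ⟨N', hN'⟩ := h'
  obtain ⟨h1, h2⟩ := hN (max N N') (le_max_left _ _)
  obtain ⟨h3, h4⟩ := hN' (max N N') (le_max_right _ _)
  generalize max N N' = K at *
  have e := hx.dist_zpow hT K (-K)
  push_cast at e
  rw [abs_of_nonneg (by linarith [K.cast_nonneg (α := ℝ)])] at e
  have t := dist_triangle y y' ((p ^ (K : ℤ)) x)
  have k := hT y ((p ^ (K : ℤ)) x) ((p ^ (-K : ℤ)) x) y'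
  rw [dist_comm _ y, dist_comm _ y, dist_comm _ y, dist_comm ((p ^ (K : ℤ)) x) y', h1, h2, h3, h4, e] at k
  rw [h1, h3] at t
  rw [abs_of_nonpos (by linarith)]
  rcases min_le_iff.1 k with k | k <;> linarith

theorem IsRTree.exists_axisCoord (hT : IsRTree T) {p : T ≃ᵢ T} {x : T} (hx : OnAxis p x) (s : ℝ) :
    ∃ y, AxisCoord p x s y := by
  obtain ⟨N, hN⟩ := exists_nat_gt (|s| / dist x (p x))
  rw [div_lt_iff₀ hx.1] at hN
  have hs := abs_lt.1 hN
  have e := hx.dist_zpow hT.2 (-N) N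
  push_cast at e
  rw [abs_of_nonpos (by linarith [N.cast_nonneg (α := ℝ)])] at e
  obtain ⟨γ, h0, h1, hγ⟩ := hT.1 ((p ^ (-N : ℤ)) x) ((p ^ (N : ℤ)) x)
  rw [e] at h1 hγ
  have m0 : 0 ∈ Set.Icc 0 (-(-(N : ℝ) - N) * dist x (p x)) := ⟨le_rfl, by linarith⟩
  have m1 : -(-(N : ℝ) - N) * dist x (p x) ∈ Set.Icc 0 (-(-(N : ℝ) - N) * dist x (p x)) :=
    ⟨by linarith, le_rfl⟩
  have m2 : N * dist x (p x) + s ∈ Set.Icc 0 (-(-(N : ℝ) - N) * dist x (p x)) :=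
    ⟨by linarith, by linarith⟩
  refine ⟨γ (N * dist x (p x) + s), hx.axisCoord_of_le hT.2 (N := N) (M := N) ?_ ?_⟩
  · rw [← h1, hγ _ m2 _ m1, abs_of_nonpos (by linarith)]; linarith
  · rw [← h0, hγ _ m2 _ m0, abs_of_nonneg (by linarith)]; linarith

theorem axisCoord_zero (p : T ≃ᵢ T) {x : T} (hT : ZeroHyp T) (hx : OnAxis p x) :
    AxisCoord p x 0 x := by
  refine hx.axisCoord_of_le hT (N := 0) (M := 0) ?_ ?_ <;> simp

/-- An isometry commuting with `p` preserves the axis of `p`. -/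
theorem OnAxis.exists_axisCoord_apply (hT : ZeroHyp T) {p g : T ≃ᵢ T} (hg : Commute g p) {x : T}
    (hx : OnAxis p x) : ∃ t, AxisCoord p x t (g x) := by
  have hgz : ∀ (n : ℤ) (z : T), g ((p ^ n) z) = (p ^ n) (g z) := fun n z => by
    rw [← IsometryEquiv.mul_apply, (hg.zpow_right n).eq, IsometryEquiv.mul_apply]
  obtain ⟨N, hN⟩ := exists_nat_gt (dist x (g x) / dist x (p x))
  rw [div_lt_iff₀ hx.1] at hN
  have e := hx.dist_zpow hT
  set y := g x with hy
  have d1 : ∀ n : ℤ, dist ((p ^ n) y) ((p ^ n) x) = dist x y := fun n => by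
    rw [IsometryEquiv.dist_eq, dist_comm]
  have d2 : ∀ i j : ℤ, dist ((p ^ i) y) ((p ^ j) y) = |(i : ℝ) - j| * dist x (p x) := fun i j => by
    rw [hy, ← hgz, ← hgz, g.dist_eq, e]
  have d3 : ∀ i : ℤ, dist ((p ^ i) y) y = |(i : ℝ)| * dist x (p x) := fun i => by
    simpa using d2 i 0
  have f1 := d3 N
  have f2 := d3 (-N)
  have f3 := d2 N (-N)
  have f4 := d1 N
  have f5 := d1 (-N)
  have f6 := e N (-N)
  push_cast at f1 f2 f3 f6
  have hN0 : (0 : ℝ) ≤ N := N.cast_nonneg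
  rw [abs_neg] at f2
  rw [abs_of_nonneg (by linarith)] at f1 f2 f3 f6
  have k1 := hT y ((p ^ (N : ℤ)) y) ((p ^ (-N : ℤ)) x) ((p ^ (N : ℤ)) x)
  have k2 := hT y ((p ^ (N : ℤ)) y) ((p ^ (-N : ℤ)) y) ((p ^ (-N : ℤ)) x)
  have t1 := dist_triangle y ((p ^ (N : ℤ)) x) ((p ^ (N : ℤ)) y)
  have t2 := dist_triangle y ((p ^ (-N : ℤ)) x) ((p ^ (-N : ℤ)) y)
  refine ⟨N * dist x (p x) - dist y ((p ^ (N : ℤ)) x),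
    hx.axisCoord_of_le hT (N := N) (M := N) (by linarith) ?_⟩
  simp only [dist_comm _ y, dist_comm ((p ^ (N : ℤ)) x) ((p ^ (N : ℤ)) y),
    dist_comm ((p ^ (-N : ℤ)) x) ((p ^ (-N : ℤ)) y)] at *
  rcases min_le_iff.1 k1 with k1 | k1 <;> rcases min_le_iff.1 k2 with k2 | k2 <;> linarith

theorem AxisCoord.apply (hT : ZeroHyp T) {p g : T ≃ᵢ T} (hg : Commute g p) {x : T}
    (hx : OnAxis p x) {s t : ℝ} {y : T} (hy : AxisCoord p x s y) (ht : AxisCoord p x t (g x)) :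
    AxisCoord p x (s + t) (g y) := by
  have hgz : ∀ (n : ℤ) (z : T), g ((p ^ n) z) = (p ^ n) (g z) := fun n z => by
    rw [← IsometryEquiv.mul_apply, (hg.zpow_right n).eq, IsometryEquiv.mul_apply]
  obtain ⟨N, hN⟩ := hy
  obtain ⟨M, hM⟩ := ht
  obtain ⟨h1, h2⟩ := hN N le_rfl
  obtain ⟨h3, h4⟩ := hM M le_rfl
  refine hx.axisCoord_of_le hT (N := N + M) (M := N + M) ?_ ?_
  · refine (dist_triangle _ (g ((p ^ (N : ℤ)) x)) _).trans ?_
    rw [g.dist_eq, h1, hgz]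
    push_cast
    rw [zpow_add, IsometryEquiv.mul_apply, IsometryEquiv.dist_eq, h3]
    linarith
  · refine (dist_triangle _ (g ((p ^ (-N : ℤ)) x)) _).trans ?_
    rw [g.dist_eq, h2, hgz]
    push_cast
    rw [neg_add, zpow_add, IsometryEquiv.mul_apply, IsometryEquiv.dist_eq, h4]
    linarith

/-- Isometries commuting with `p` commute with each other along the axis of `p`. -/
theorem OnAxis.apply_apply_comm (hT : ZeroHyp T) {p g h : T ≃ᵢ T} {x : T} (hx : OnAxis p x)
    (hg : Commute g p) (hh : Commute h p) : g (h x) = h (g x) := by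
  obtain ⟨s, hs⟩ := hx.exists_axisCoord_apply hT hg
  obtain ⟨t, ht⟩ := hx.exists_axisCoord_apply hT hh
  have h1 := ht.apply hT hg hx hs
  have h2 := hs.apply hT hh hx ht
  rw [← dist_eq_zero, h1.dist_eq hT hx h2]
  simp [add_comm]

end Axis

namespace ReducedPath

variable {X : Type} [NormedAddCommGroup X]

/-- The image of a path under a norm-preserving automorphism. -/
def map (σ : X ≃+ X) (hσ : ∀ x, ‖σ x‖ = ‖x‖) (u : ReducedPath X) : ReducedPath X where
  len := u.len
  toFun t := σ (u.toFun t)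
  len_nonneg := u.len_nonneg
  lip s t := by rw [← map_sub, hσ]; exact u.lip s t
  eq_zero t ht := by rw [u.eq_zero t ht, map_zero]
  eq_top t ht := by rw [u.eq_top t ht]
  reduced x h0 h1 ε hε := by
    obtain ⟨t, ht0, ht1, ht⟩ := u.reduced x h0 h1 ε hε
    exact ⟨t, ht0, ht1, fun h => ht (σ.injective h)⟩

theorem isometry_map (σ : X ≃+ X) (hσ : ∀ x, ‖σ x‖ = ‖x‖) : Isometry (map σ hσ) := by
  refine Isometry.of_dist_eq fun u v => ?_
  have : meet (map σ hσ u) (map σ hσ v) = meet u v :=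
    le_antisymm (le_meet (meet_le_left _ _) (meet_le_right _ _) fun s hs =>
      σ.injective (eq_of_le_meet hs))
      (le_meet (meet_le_left _ _) (meet_le_right _ _) fun s hs =>
        congrArg σ (eq_of_le_meet hs))
  rw [dist_def, dist_def, this]
  rfl

/-- The isometry induced by a norm-preserving automorphism. -/
def mapEquiv (σ : X ≃+ X) (hσ : ∀ x, ‖σ x‖ = ‖x‖) : ReducedPath X ≃ᵢ ReducedPath X where
  toFun := map σ hσ
  invFun := map σ.symm fun x => by rw [← hσ, σ.apply_symm_apply]
  left_inv u := ext_of_eq rfl fun t => σ.symm_apply_apply _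
  right_inv u := ext_of_eq rfl fun t => σ.apply_symm_apply _
  isometry_toFun := isometry_map σ hσ

theorem tip_mapEquiv (σ : X ≃+ X) (hσ : ∀ x, ‖σ x‖ = ‖x‖) (u : ReducedPath X) :
    (mapEquiv σ hσ u).tip = σ u.tip := rfl

theorem TranslatesTips.eq_of_apply_eq {g h : ReducedPath X ≃ᵢ ReducedPath X}
    (hg : TranslatesTips g) (hh : TranslatesTips h) {u : ReducedPath X} (hu : g u = h u) :
    g = h := by
  obtain ⟨c, hc⟩ := hg
  obtain ⟨d, hd⟩ := hh
  have : TranslatesTips (h⁻¹ * g) := by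
    refine ⟨c - d, fun v => ?_⟩
    have h1 := hd ((h⁻¹ * g) v)
    rw [IsometryEquiv.mul_apply, IsometryEquiv.apply_inv_self, hc] at h1
    rw [IsometryEquiv.mul_apply, ← sub_eq_iff_eq_add.2 h1]
    abel
  have := this.eq_one (u := u) (by rw [IsometryEquiv.mul_apply, hu, IsometryEquiv.inv_apply_self])
  rwa [inv_mul_eq_one, eq_comm] at this

theorem TranslatesTips.mul {g h : ReducedPath X ≃ᵢ ReducedPath X} (hg : TranslatesTips g)
    (hh : TranslatesTips h) : TranslatesTips (g * h) := by
  obtain ⟨c, hc⟩ := hg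
  obtain ⟨d, hd⟩ := hh
  exact ⟨d + c, fun v => by rw [IsometryEquiv.mul_apply, hc, hd, add_assoc]⟩

/-- Two commuting groups of tip-translating isometries which together act coboundedly on
`ReducedPath ℝ` are not both nontrivial. -/
theorem eq_one_or_eq_one_of_cobounded {P Q : Type} [Group P] [Group Q]
    (A : P →* (ReducedPath ℝ ≃ᵢ ReducedPath ℝ)) (B : Q →* (ReducedPath ℝ ≃ᵢ ReducedPath ℝ))
    (hA : ∀ a, TranslatesTips (A a)) (hB : ∀ b, TranslatesTips (B b))
    (hAB : ∀ a b, Commute (A a) (B b)) {y₀ : ReducedPath ℝ} {R : ℝ}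
    (hcob : ∀ y, ∃ a b, dist y ((A a * B b) y₀) ≤ R) : (∀ a, A a = 1) ∨ ∀ b, B b = 1 := by
  by_contra! h
  obtain ⟨⟨a₀, ha₀⟩, b₀, hb₀⟩ := h
  obtain ⟨x, hx⟩ := isRTree.exists_axis_point (A a₀) (fun x h => ha₀ ((hA _).eq_one h)) nil
  obtain ⟨z, hz⟩ := isRTree.exists_axis_point (B b₀) (fun x h => hb₀ ((hB _).eq_one h)) nil
  have hcomm : ∀ a b, Commute (A a * B b) (A a₀) := fun a b => by
    refine Commute.mul_left ?_ (hAB a₀ b).symm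
    refine ((hA a).mul (hA a₀)).eq_of_apply_eq ((hA a₀).mul (hA a)) (u := z) ?_
    exact OnAxis.apply_apply_comm zeroHyp hz (hAB a b₀) (hAB a₀ b₀)
  have hnear : ∀ y, ∃ t w, AxisCoord (A a₀) x t w ∧ dist y w ≤ R + dist y₀ x := fun y => by
    obtain ⟨a, b, hab⟩ := hcob y
    obtain ⟨t, ht⟩ := OnAxis.exists_axisCoord_apply zeroHyp (hcomm a b) hx
    refine ⟨t, _, ht, (dist_triangle _ _ _).trans (add_le_add hab ?_)⟩
    rw [IsometryEquiv.dist_eq]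
  set R' := R + dist y₀ x
  have hR : 0 ≤ R' := by
    obtain ⟨_, w, _, h⟩ := hnear nil
    exact dist_nonneg.trans h
  have hn : 0 ≤ 3 * R' + 1 := by linarith
  have n1 : ‖(1 : ℝ)‖ ≤ 1 := by norm_num
  have n2 : ‖(1 / 2 : ℝ)‖ ≤ 1 := by norm_num
  have n3 : ‖(1 / 3 : ℝ)‖ ≤ 1 := by norm_num
  have z1 : (1 : ℝ) ≠ 0 := by norm_num
  have z2 : (1 / 2 : ℝ) ≠ 0 := by norm_num
  have z3 : (1 / 3 : ℝ) ≠ 0 := by norm_num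
  have d12 := dist_ray hn n1 z1 n2 z2 (by norm_num)
  have d13 := dist_ray hn n1 z1 n3 z3 (by norm_num)
  have d23 := dist_ray hn n2 z2 n3 z3 (by norm_num)
  obtain ⟨t1, w1, c1, e1⟩ := hnear (ray _ hn _ n1 z1)
  obtain ⟨t2, w2, c2, e2⟩ := hnear (ray _ hn _ n2 z2)
  obtain ⟨t3, w3, c3, e3⟩ := hnear (ray _ hn _ n3 z3)
  generalize ray _ hn _ n1 z1 = r1 at *
  generalize ray _ hn _ n2 z2 = r2 at *
  generalize ray _ hn _ n3 z3 = r3 at *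
  have f12 := c1.dist_eq zeroHyp hx c2
  have f13 := c1.dist_eq zeroHyp hx c3
  have f23 := c2.dist_eq zeroHyp hx c3
  have near : ∀ r r' w w' : ReducedPath ℝ, dist r w ≤ R' → dist r' w' ≤ R' →
      dist r r' ≤ dist w w' + 2 * R' ∧ dist w w' ≤ dist r r' + 2 * R' := by
    intro r r' w w' h h'
    have t1 := dist_triangle4 r w w' r'
    have t2 := dist_triangle4 w r r' w'
    rw [dist_comm w' r'] at t1
    rw [dist_comm w r] at t2
    constructor <;> linarith
  obtain ⟨g1, g1'⟩ := near _ _ _ _ e1 e2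
  obtain ⟨g2, g2'⟩ := near _ _ _ _ e1 e3
  obtain ⟨g3, g3'⟩ := near _ _ _ _ e2 e3
  rw [f12] at g1 g1'
  rw [f13] at g2 g2'
  rw [f23] at g3 g3'
  rcases abs_cases (t1 - t2) with h | h <;> rcases abs_cases (t1 - t3) with h' | h' <;>
    rcases abs_cases (t2 - t3) with h'' | h'' <;> linarith

end ReducedPath

section Shift

open Filter Topology ZeroAtInfty

/-- Translation of functions vanishing at infinity. -/
def shift (c : ℝ) : C₀(ℝ, ℝ) ≃+ C₀(ℝ, ℝ) where
  toFun f := f.comp (Homeomorph.addRight c).toCocompactMap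
  invFun f := f.comp (Homeomorph.addRight (-c)).toCocompactMap
  left_inv f := by ext x; simp
  right_inv f := by ext x; simp
  map_add' f g := rfl

theorem shift_apply (c : ℝ) (f : C₀(ℝ, ℝ)) (x : ℝ) : shift c f x = f (x + c) := rfl

theorem shift_zero (f : C₀(ℝ, ℝ)) : shift 0 f = f := by
  ext x; simp [shift_apply]

theorem shift_shift (a b : ℝ) (f : C₀(ℝ, ℝ)) : shift a (shift b f) = shift (a + b) f := by
  ext x; simp [shift_apply, add_assoc]

theorem norm_shift (c : ℝ) (f : C₀(ℝ, ℝ)) : ‖shift c f‖ = ‖f‖ := by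
  have h : ∀ c (f : C₀(ℝ, ℝ)), ‖shift c f‖ ≤ ‖f‖ := fun c f => by
    rw [← ZeroAtInftyContinuousMap.norm_toBCF_eq_norm,
      BoundedContinuousFunction.norm_le (norm_nonneg _),
      ← ZeroAtInftyContinuousMap.norm_toBCF_eq_norm]
    exact fun x => f.toBCF.norm_coe_le_norm (x + c)
  refine le_antisymm (h c f) ?_
  calc ‖f‖ = ‖shift (-c) (shift c f)‖ := by rw [shift_shift, neg_add_cancel, shift_zero]
    _ ≤ _ := h _ _

/-- A vector whose iterated shifts stay in a compact set is zero. -/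
theorem eq_zero_of_shift_mem {K : Set C₀(ℝ, ℝ)} (hK : IsCompact K) {r : ℝ} (hr : r ≠ 0)
    {f : C₀(ℝ, ℝ)} (hf : ∀ n : ℕ, shift (n * r) f ∈ K) : f = 0 := by
  obtain ⟨g, -, φ, hφ, hg⟩ := hK.tendsto_subseq hf
  have hg0 : g = 0 := by
    ext x
    have h1 : Tendsto (fun n => shift (φ n * r) f x) atTop (𝓝 (g x)) :=
      ((ZeroAtInftyContinuousMap.tendsto_iff_tendstoUniformly.1 hg).tendsto_at x)
    have h2 : Tendsto (fun n : ℕ => x + φ n * r) atTop (cocompact ℝ) := by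
      have h3 : Tendsto (fun n : ℕ => (φ n : ℝ) * r) atTop (cocompact ℝ) :=
        (Homeomorph.mulRight₀ r hr).isClosedEmbedding.tendsto_cocompact.comp
          ((tendsto_natCast_atTop_atTop.comp hφ.tendsto_atTop).mono_right atTop_le_cocompact)
      exact (Homeomorph.addLeft x).isClosedEmbedding.tendsto_cocompact.comp h3
    exact tendsto_nhds_unique h1 ((zero_at_infty f).comp h2)
  have h4 := hg.norm
  simp only [Function.comp_def, norm_shift, hg0, norm_zero] at h4
  exact norm_eq_zero.1 (tendsto_nhds_unique tendsto_const_nhds h4)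

/-- A curve that is equivariant both for a translation and for an affine isometry with nontrivial
shift part is constant. -/
theorem eq_of_add_eq_shift {f : ℝ → C₀(ℝ, ℝ)} (hf : Continuous f) {ℓ t r : ℝ} (hℓ : ℓ ≠ 0)
    (hr : r ≠ 0) {c d : C₀(ℝ, ℝ)} (h1 : ∀ s, f (s + ℓ) = f s + d)
    (h2 : ∀ s, f (s + t) = shift r (f s) + c) (a b : ℝ) : f a = f b := by
  set D : ℝ → C₀(ℝ, ℝ) := fun s => f (s + (a - b)) - f s with hD
  have hper : Function.Periodic D ℓ := fun s => by
    simp only [hD]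
    rw [add_right_comm, h1, h1, add_sub_add_right_eq_sub]
  have hshift : ∀ s, D (s + t) = shift r (D s) := fun s => by
    simp only [hD]
    rw [add_right_comm, h2, h2, add_sub_add_right_eq_sub, map_sub]
  have hn : ∀ n : ℕ, D (b + n * t) = shift (n * r) (D b) := fun n => by
    induction n with
    | zero => simp [shift_zero]
    | succ n ih =>
      rw [show b + (n + 1 : ℕ) * t = b + n * t + t by push_cast; ring, hshift, ih, shift_shift]
      congr 2
      push_cast; ring
  have := eq_zero_of_shift_mem (hper.compact_of_continuous hℓ (by fun_prop)) hr
    (f := D b) fun n => ⟨_, hn n⟩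
  simpa [hD, sub_eq_zero] using this

theorem mk_zeroAtInfty_le : #C₀(ℝ, ℝ) ≤ continuum := by
  have hinj : Function.Injective (fun (f : C₀(ℝ, ℝ)) (q : ℚ) => f (q : ℝ)) := fun f g h =>
    DFunLike.coe_injective (Rat.denseRange_cast.equalizer f.continuous g.continuous h)
  refine (mk_le_of_injective hinj).trans ?_
  simp [mk_real]

instance : Nontrivial C₀(ℝ, ℝ) := by
  refine ⟨⟨⟨fun x => Real.exp (-‖x‖), by fun_prop⟩, ?_⟩, 0, fun h => ?_⟩
  · exact Real.tendsto_exp_neg_atTop_nhds_zero.comp (tendsto_norm_cocompact_atTop (E := ℝ))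
  · have := DFunLike.congr_fun h 0
    exact (Real.exp_pos _).ne' this

end Shift

section ShiftGroup

open ZeroAtInfty

namespace ReducedPath

/-- A tip-translating isometry with an axis does not commute with an isometry acting on tips with
a nontrivial shift part. -/
theorem TranslatesTips.eq_zero_of_commute {k a : ReducedPath C₀(ℝ, ℝ) ≃ᵢ ReducedPath C₀(ℝ, ℝ)}
    (hk : TranslatesTips k) (hk1 : k ≠ 1) (hak : Commute a k) {r : ℝ} {c : C₀(ℝ, ℝ)}
    (ha : ∀ x, (a x).tip = shift r x.tip + c) : r = 0 := by
  by_contra hr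
  obtain ⟨x, hx⟩ := isRTree.exists_axis_point k (fun x h => hk1 (hk.eq_one h)) nil
  obtain ⟨d, hd⟩ := hk
  choose y hy using fun s => isRTree.exists_axisCoord hx s
  have huniq : ∀ {s w}, AxisCoord k x s w → w = y s := fun {s w} hw => by
    rw [← dist_eq_zero, hw.dist_eq zeroHyp hx (hy s), sub_self, abs_zero]
  obtain ⟨t, ht⟩ := hx.exists_axisCoord_apply zeroHyp hak
  obtain ⟨ℓ, hℓ⟩ := hx.exists_axisCoord_apply zeroHyp (Commute.refl k)
  have hℓ0 : ℓ ≠ 0 := by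
    rintro rfl
    have := (axisCoord_zero k zeroHyp hx).dist_eq zeroHyp hx hℓ
    simp only [sub_self, abs_zero] at this
    exact hx.1.ne' this
  have hcont : Continuous fun s => (y s).tip := by
    refine (LipschitzWith.of_dist_le_mul (K := 1) fun s s' => ?_).continuous
    rw [dist_eq_norm, Real.dist_eq, ← (hy s).dist_eq zeroHyp hx (hy s')]
    simpa using norm_tip_sub_le (y s) (y s')
  have hconst := eq_of_add_eq_shift hcont hℓ0 hr (c := c) (d := d) (t := t)
    (fun s => by rw [← huniq ((hy s).apply zeroHyp (Commute.refl k) hx hℓ), hd])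
    (fun s => by rw [← huniq ((hy s).apply zeroHyp hak hx ht), ha])
  have hx0 : x = y 0 := huniq (axisCoord_zero k zeroHyp hx)
  have h01 := (axisCoord_zero k zeroHyp hx).dist_eq zeroHyp hx (hy 1)
  norm_num at h01
  obtain ⟨w, hw, hne⟩ := exists_between_tip_ne (u := x) (v := y 1)
    (dist_pos.1 (by rw [h01]; exact one_pos))
  obtain ⟨N, hN⟩ := hy 1
  have hwc : AxisCoord k x (dist x w) w := by
    refine hx.axisCoord_of_le zeroHyp (N := N) (M := 0) ?_ ?_
    · have := dist_triangle w (y 1) ((k ^ (N : ℤ)) x)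
      rw [(hN N le_rfl).1] at this
      linarith
    · simp [dist_comm]
  rw [huniq hwc] at hne
  apply hne
  conv_rhs => rw [hx0]
  exact hconst _ _

/-- Pairs of isometries acting on tips by affine isometries whose shift part on the first factor
is the translation of tips on the second factor. -/
def shiftGroup : Subgroup ((ReducedPath C₀(ℝ, ℝ) ≃ᵢ ReducedPath C₀(ℝ, ℝ)) ×
    (ReducedPath ℝ ≃ᵢ ReducedPath ℝ)) where
  carrier := {g | ∃ c : ℝ, (∀ y, (g.2 y).tip = y.tip + c) ∧
    ∃ d, ∀ x, (g.1 x).tip = shift c x.tip + d}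
  one_mem' := ⟨0, fun y => (add_zero _).symm, 0, fun x => by simp [shift_zero]⟩
  mul_mem' := by
    rintro g h ⟨c, hc, d, hd⟩ ⟨c', hc', d', hd'⟩
    refine ⟨c + c', fun y => ?_, shift c d' + d, fun x => ?_⟩
    · rw [Prod.snd_mul, IsometryEquiv.mul_apply, hc, hc']; ring
    · rw [Prod.fst_mul, IsometryEquiv.mul_apply, hd, hd', map_add, shift_shift, add_assoc]
  inv_mem' := by
    rintro g ⟨c, hc, d, hd⟩
    refine ⟨-c, fun y => ?_, -shift (-c) d, fun x => ?_⟩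
    · have := hc (g.2⁻¹ y)
      rw [IsometryEquiv.apply_inv_self] at this
      rw [Prod.snd_inv, this]; ring
    · have := hd (g.1⁻¹ x)
      rw [IsometryEquiv.apply_inv_self] at this
      rw [Prod.fst_inv, this, map_add, shift_shift, neg_add_cancel, shift_zero]
      abel

theorem shiftGroup.translatesTips_snd (g : shiftGroup) : TranslatesTips g.1.2 :=
  let ⟨c, hc, _⟩ := g.2
  ⟨c, hc⟩

theorem shiftGroup.translatesTips_fst {g : shiftGroup} {y : ReducedPath ℝ}
    (h : (g.1.2 y).tip = y.tip) : TranslatesTips g.1.1 := by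
  obtain ⟨c, hc, d, hd⟩ := g.2
  obtain rfl : c = 0 := by simpa [h] using hc y
  exact ⟨d, fun x => by rw [hd, shift_zero]⟩

/-- The action of `shiftGroup` on the product of the two trees. -/
def shiftAct (g : shiftGroup) (p : ReducedPath C₀(ℝ, ℝ) × ReducedPath ℝ) :
    ReducedPath C₀(ℝ, ℝ) × ReducedPath ℝ := (g.1.1 p.1, g.1.2 p.2)

theorem shiftAct_free (g : shiftGroup) (p : ReducedPath C₀(ℝ, ℝ) × ReducedPath ℝ)
    (h : shiftAct g p = p) : g = 1 := by
  obtain ⟨h1, h2⟩ := Prod.ext_iff.1 h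
  have h1 : g.1.1 p.1 = p.1 := h1
  have h2 : g.1.2 p.2 = p.2 := h2
  exact Subtype.ext (Prod.ext
    ((shiftGroup.translatesTips_fst (congrArg tip h2)).eq_one h1)
    ((shiftGroup.translatesTips_snd g).eq_one h2))

theorem shiftAct_transitive (p q : ReducedPath C₀(ℝ, ℝ) × ReducedPath ℝ) :
    ∃ g, shiftAct g p = q := by
  obtain ⟨g, ⟨c, hc⟩, hg⟩ := exists_translatesTips_apply_eq p.2 q.2
  obtain ⟨h, ⟨d, hd⟩, hh⟩ :=
    exists_translatesTips_apply_eq (mapEquiv (shift c) (norm_shift c) p.1) q.1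
  refine ⟨⟨(h * mapEquiv (shift c) (norm_shift c), g), c, hc, d, fun x => ?_⟩, Prod.ext hh hg⟩
  rw [IsometryEquiv.mul_apply, hd, tip_mapEquiv]

theorem eq_one_of_snd_eq_one {P Q : Type} [Group P] [Group Q] (α : P →* shiftGroup)
    (β : Q →* shiftGroup) (hαβ : ∀ a b, Commute (α a) (β b))
    (p₀ : ReducedPath C₀(ℝ, ℝ) × ReducedPath ℝ) {R : ℝ}
    (hcob : ∀ q, ∃ a b, l1dist2 q (shiftAct (α a * β b) p₀) ≤ R)
    (hα : ∀ a, (α a).1.2 = 1) (a : P) : α a = 1 := by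
  have n1 : ‖(1 : ℝ)‖ ≤ 1 := by norm_num
  set n : ℝ := |p₀.2.tip| + |R| + 1
  have hn : 0 ≤ n := by positivity
  obtain ⟨a', b, hab⟩ := hcob (p₀.1, ray n hn 1 n1 one_ne_zero)
  obtain ⟨r, hr, d, hd⟩ := (β b).2
  have hr0 : r ≠ 0 := by
    rintro rfl
    have e1 : (shiftAct (α a' * β b) p₀).2 = (β b).1.2 p₀.2 := by
      change ((α a').1.2 * (β b).1.2) p₀.2 = _
      rw [hα, one_mul]
    have e2 := norm_tip_sub_le (ray n hn 1 n1 one_ne_zero) ((β b).1.2 p₀.2)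
    rw [tip_ray, hr, Real.norm_eq_abs] at e2
    simp only [l1dist2, e1] at hab
    have e3 := dist_nonneg (x := p₀.1) (y := (shiftAct (α a' * β b) p₀).1)
    have e4 := le_abs_self R
    have e5 := le_abs_self p₀.2.tip
    have e6 := (le_abs_self _).trans e2
    simp only [smul_eq_mul] at e6
    linarith
  have hk : TranslatesTips (α a).1.1 := shiftGroup.translatesTips_fst (y := nil) (by rw [hα]; rfl)
  by_contra hne
  refine hr0 (hk.eq_zero_of_commute (fun h => hne (Subtype.ext (Prod.ext h (hα a)))) ?_ hd)
  exact congrArg (fun g : shiftGroup => g.1.1) (hαβ a b).symm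

theorem not_cobounded_of_splits (H : Subgroup shiftGroup) (hH : SplitsAsProduct H)
    (p₀ : ReducedPath C₀(ℝ, ℝ) × ReducedPath ℝ) (R : ℝ) :
    ¬ ∀ q, ∃ h ∈ H, l1dist2 q (shiftAct h p₀) ≤ R := by
  intro hcob
  obtain ⟨P, Q, _, _, hP, hQ, ⟨e⟩⟩ := hH
  set α : P →* shiftGroup := H.subtype.comp (e.symm.toMonoidHom.comp (MonoidHom.inl P Q)) with hα
  set β : Q →* shiftGroup := H.subtype.comp (e.symm.toMonoidHom.comp (MonoidHom.inr P Q)) with hβ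
  have hαi : Function.Injective α :=
    Subtype.val_injective.comp (e.symm.injective.comp fun a b h => (Prod.ext_iff.1 h).1)
  have hβi : Function.Injective β :=
    Subtype.val_injective.comp (e.symm.injective.comp fun a b h => (Prod.ext_iff.1 h).2)
  have hcomm : ∀ a b, Commute (α a) (β b) := fun a b =>
    ((MonoidHom.commute_inl_inr a b).map e.symm.toMonoidHom).map H.subtype
  have hcob1 : ∀ q, ∃ a b, l1dist2 q (shiftAct (α a * β b) p₀) ≤ R := fun q => by
    obtain ⟨h, hh, hq⟩ := hcob q
    refine ⟨(e ⟨h, hh⟩).1, (e ⟨h, hh⟩).2, ?_⟩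
    have : α (e ⟨h, hh⟩).1 * β (e ⟨h, hh⟩).2 = h := by
      change ((e.symm ((e ⟨h, hh⟩).1, 1) * e.symm (1, (e ⟨h, hh⟩).2) : H) : shiftGroup) = h
      rw [← map_mul, Prod.mk_mul_mk, one_mul, mul_one, Prod.mk.eta, e.symm_apply_apply]
    rwa [this]
  have hcob2 : ∀ q, ∃ b a, l1dist2 q (shiftAct (β b * α a) p₀) ≤ R := fun q => by
    obtain ⟨a, b, h⟩ := hcob1 q
    exact ⟨b, a, by rwa [← (hcomm a b).eq]⟩
  let snd : shiftGroup →* (ReducedPath ℝ ≃ᵢ ReducedPath ℝ) :=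
    (MonoidHom.snd _ _).comp shiftGroup.subtype
  rcases eq_one_or_eq_one_of_cobounded (snd.comp α) (snd.comp β)
    (fun _ => shiftGroup.translatesTips_snd _) (fun _ => shiftGroup.translatesTips_snd _)
    (fun a b => (hcomm a b).map snd) (y₀ := p₀.2) (R := R) (fun y => by
      obtain ⟨a, b, h⟩ := hcob1 (p₀.1, y)
      exact ⟨a, b, le_trans (le_add_of_nonneg_left dist_nonneg) h⟩) with h | h
  · obtain ⟨a, ha⟩ := exists_ne (1 : P)
    exact ha (hαi ((eq_one_of_snd_eq_one α β hcomm p₀ hcob1 h a).trans (map_one α).symm))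
  · obtain ⟨b, hb⟩ := exists_ne (1 : Q)
    exact hb (hβi ((eq_one_of_snd_eq_one β α (fun b a => (hcomm a b).symm) p₀ hcob2 h b).trans
      (map_one β).symm))

end ReducedPath

end ShiftGroup

/-- There is a group acting freely and transitively by isometries on the ℓ¹ product of
two complete ℝ-trees with valence `2^ℵ₀` such that no subgroup splitting non-trivially
as a direct product acts coboundedly. -/
theorem stmt6 :
    ∃ (T₁ T₂ : Type) (_ : MetricSpace T₁) (_ : MetricSpace T₂)
      (_ : CompleteSpace T₁) (_ : CompleteSpace T₂),
      IsRTree T₁ ∧ IsRTree T₂ ∧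
      (∀ x : T₁, valence T₁ x = Cardinal.continuum) ∧
      (∀ x : T₂, valence T₂ x = Cardinal.continuum) ∧
      ∃ (G : Type) (_ : Group G) (φ : G → T₁ × T₂ → T₁ × T₂),
        (∀ g : G, ∀ p q : T₁ × T₂, l1dist2 (φ g p) (φ g q) = l1dist2 p q) ∧
        (∀ p : T₁ × T₂, φ 1 p = p) ∧
        (∀ g h : G, ∀ p : T₁ × T₂, φ (g * h) p = φ g (φ h p)) ∧
        (∀ g : G, ∀ p : T₁ × T₂, φ g p = p → g = 1) ∧
        (∀ p q : T₁ × T₂, ∃ g : G, φ g p = q) ∧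
        ∀ H : Subgroup G, SplitsAsProduct H →
          ¬ ∃ (p : T₁ × T₂) (R : ℝ), 0 < R ∧
              ∀ q : T₁ × T₂, ∃ h ∈ H, l1dist2 q (φ h p) ≤ R := by
  refine ⟨ReducedPath (ZeroAtInftyContinuousMap ℝ ℝ), ReducedPath ℝ, inferInstance, inferInstance,
    ReducedPath.completeSpace, ReducedPath.completeSpace, ReducedPath.isRTree,
    ReducedPath.isRTree, ReducedPath.valence_eq mk_zeroAtInfty_le,
    ReducedPath.valence_eq mk_real.le, ReducedPath.shiftGroup, inferInstance,
    ReducedPath.shiftAct, fun g p q => ?_, fun p => rfl, fun g h p => rfl,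
    ReducedPath.shiftAct_free, ReducedPath.shiftAct_transitive, ?_⟩
  · exact congrArg₂ (· + ·) (g.1.1.dist_eq _ _) (g.1.2.dist_eq _ _)
  · rintro H hH ⟨p, R, -, h⟩
    exact ReducedPath.not_cobounded_of_splits H hH p R h
end
end
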